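/- arXiv:2504.08335 — 2 statements merged into one kernel-verified Lean document; each statement's English description precedes it below -/
import Mathlib

section
/- Let N ~ N_d(0,I_d) be independent of A and set F_t := √Γ_t · N, and write M_t := Γ_t^{−1}(A−K). Then for every t ∈ [0,1]: (i) E[(h₂(A,t,F_t))²·1_E] = E[tr(M_t⁴)·1_E] + (1/2)·E[(tr(M_t²))²·1_E]; (ii) E[(h₃(A,t,F_t))²·1_E] = (3/4)·E[(tr(M_t²))³·1_E] + 6·E[tr(M_t⁶)·1_E] + (9/2)·E[tr(M_t²)·tr(M_t⁴)·1_E]; (iii) E[(h₄(A,t,F_t))²·1_E] = (3/2)·E[(tr(M_t²))⁴·1_E] + 18·E[(tr(M_t²))²·tr(M_t⁴)·1_E] + 18·E[(tr(M_t⁴))²·1_E] + 72·E[tr(M_t⁸)·1_E] + 48·E[tr(M_t²)·tr(M_t⁶)·1_E]. -/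
open MeasureTheory ProbabilityTheory Matrix

noncomputable section

/-- Euclidean norm on `Fin d → ℝ`. -/
def euclNorm {d : ℕ} (x : Fin d → ℝ) : ℝ := Real.sqrt (∑ i, x i ^ 2)

/-- Hilbert–Schmidt norm of a matrix. -/
def hsNorm {d : ℕ} (M : Matrix (Fin d) (Fin d) ℝ) : ℝ := Real.sqrt (∑ i, ∑ j, M i j ^ 2)

/-- Operator norm of a matrix (w.r.t. the Euclidean norm). -/
def opNorm {d : ℕ} (M : Matrix (Fin d) (Fin d) ℝ) : ℝ :=
  sSup {r : ℝ | ∃ x : Fin d → ℝ, euclNorm x = 1 ∧ r = euclNorm (M.mulVec x)}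

/-- Smallest eigenvalue of a symmetric matrix (as the infimum of the Rayleigh quotient). -/
def lambdaMin {d : ℕ} (M : Matrix (Fin d) (Fin d) ℝ) : ℝ :=
  sInf {r : ℝ | ∃ x : Fin d → ℝ, euclNorm x = 1 ∧ r = x ⬝ᵥ M.mulVec x}

/-- Density of the centered Gaussian law `N_d(0, M)` on `ℝ^d`. -/
def gaussDensity {d : ℕ} (M : Matrix (Fin d) (Fin d) ℝ) (x : Fin d → ℝ) : ℝ :=
  (Real.sqrt ((2 * Real.pi) ^ d * M.det))⁻¹ * Real.exp (-(1/2) * (x ⬝ᵥ M⁻¹.mulVec x))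

/-- The centered Gaussian law `N_d(0, M)` on `ℝ^d` (for `M` positive definite). -/
def gaussLaw {d : ℕ} (M : Matrix (Fin d) (Fin d) ℝ) : Measure (Fin d → ℝ) :=
  volume.withDensity fun x => ENNReal.ofReal (gaussDensity M x)

/-- Relative entropy (Kullback–Leibler divergence) of `μ` with respect to `ν`. -/
def relEnt {E : Type*} [MeasurableSpace E] (μ ν : Measure E) : ℝ :=
  ∫ x, Real.log ((μ.rnDeriv ν x).toReal) ∂μ

/-- `F` is a centered, integrable random vector which is conditionally Gaussian with respect to
the σ-field `𝓕`, with conditional covariance matrix `A`. -/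
def CondGaussian {Ω : Type*} [MeasurableSpace Ω] (P : Measure Ω) {d : ℕ}
    (F : Ω → Fin d → ℝ) (𝓕 : MeasurableSpace Ω)
    (A : Ω → Matrix (Fin d) (Fin d) ℝ) : Prop :=
  Integrable F P ∧ (∫ ω, F ω ∂P) = 0 ∧
  (∀ ω, (A ω).PosSemidef) ∧
  Measurable[𝓕] (fun ω i j => A ω i j) ∧
  ∀ y : Fin d → ℝ,
    P[(fun ω => Complex.exp (Complex.I * ((y ⬝ᵥ F ω : ℝ) : ℂ))) | 𝓕] =ᵐ[P]
      fun ω => ((Real.exp (-(1/2) * (y ⬝ᵥ (A ω).mulVec y)) : ℝ) : ℂ)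

/-- The dimensional constant `2√6 + 3√2 + 2 + √d`. -/
def Cfac (d : ℕ) : ℝ := 2 * Real.sqrt 6 + 3 * Real.sqrt 2 + 2 + Real.sqrt d

/-- `max{ |log(2^d det K/(2‖K‖_op + λ(K))^d)| , log(2^d det K/λ(K)^d) }`. -/
def maxLog {d : ℕ} (K : Matrix (Fin d) (Fin d) ℝ) : ℝ :=
  max |Real.log ((2 ^ d * K.det) / ((2 * opNorm K + lambdaMin K) ^ d))|
      (Real.log ((2 ^ d * K.det) / (lambdaMin K ^ d)))


/-- The event `E = {‖A − K‖_op ≤ λ(K)/2}`. -/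
def EvSet {Ω : Type*} {d : ℕ} (A : Ω → Matrix (Fin d) (Fin d) ℝ)
    (K : Matrix (Fin d) (Fin d) ℝ) : Set Ω :=
  {ω | opNorm (A ω - K) ≤ lambdaMin K / 2}


/-- The interpolating matrix `Γ_t = tA + (1−t)K`. -/
def Gam {d : ℕ} (A K : Matrix (Fin d) (Fin d) ℝ) (t : ℝ) : Matrix (Fin d) (Fin d) ℝ :=
  t • A + (1 - t) • K

/-- The interpolating density ratio `g(A,t,x) = φ_{Γ_t}(x)/φ_K(x)`. -/
def gfun {d : ℕ} (A K : Matrix (Fin d) (Fin d) ℝ) (t : ℝ) (x : Fin d → ℝ) : ℝ :=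
  gaussDensity (Gam A K t) x / gaussDensity K x

/-- `h_k(A,t,x) = (∂^k g/∂t^k)(A,t,x) / g(A,t,x)`. -/
def hfun {d : ℕ} (k : ℕ) (A K : Matrix (Fin d) (Fin d) ℝ) (t : ℝ) (x : Fin d → ℝ) : ℝ :=
  iteratedDeriv k (fun s => gfun A K s x) t / gfun A K t x

/-- `g̃(A,t,x) = E[φ_{Γ_t}(x) 1_E] / (P(E) φ_K(x))`. -/
def gtilde {Ω : Type*} [MeasurableSpace Ω] (P : Measure Ω) {d : ℕ}
    (A : Ω → Matrix (Fin d) (Fin d) ℝ) (K : Matrix (Fin d) (Fin d) ℝ)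
    (t : ℝ) (x : Fin d → ℝ) : ℝ :=
  (∫ ω in EvSet A K, gaussDensity (Gam (A ω) K t) x ∂P) /
    ((P (EvSet A K)).toReal * gaussDensity K x)

end

noncomputable section
namespace MomH
open Finset

/-- Coefficients of `exp (∑ j, a j / j * θ ^ j)` up to order 4. -/
def C (a : ℕ → ℝ) : ℕ → ℝ
  | 0 => 1
  | 1 => a 1
  | 2 => a 2 / 2 + a 1 ^ 2 / 2
  | 3 => a 3 / 3 + a 1 * a 2 / 2 + a 1 ^ 3 / 6
  | 4 => a 4 / 4 + a 1 * a 3 / 3 + a 2 ^ 2 / 8 + a 1 ^ 2 * a 2 / 4 + a 1 ^ 4 / 24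
  | _ => 0

theorem C_add (a b : ℕ → ℝ) (k : ℕ) (hk : k ≤ 4) :
    C (fun j => a j + b j) k = ∑ p ∈ antidiagonal k, C a p.1 * C b p.2 := by
  interval_cases k <;>
    simp only [Finset.Nat.sum_antidiagonal_eq_sum_range_succ_mk, Finset.sum_range_succ,
      Finset.sum_range_zero, C] <;> norm_num [C] <;> ring

theorem C_zero (k : ℕ) : C (fun _ => 0) k = if k = 0 then 1 else 0 := by
  match k with
  | 0 => simp [C]
  | 1 => simp [C]
  | 2 => simp [C]
  | 3 => simp [C]
  | 4 => simp [C]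
  | (n+5) => simp [C]

theorem C_smul (a : ℕ → ℝ) (c : ℝ) (k : ℕ) :
    C (fun j => c ^ j * a j) k = c ^ k * C a k := by
  match k with
  | 0 => simp [C]
  | 1 => simp [C]
  | 2 => simp [C]; ring
  | 3 => simp [C]; ring
  | 4 => simp [C]; ring
  | (n+5) => simp [C]

theorem C_sum {ι : Type*} [DecidableEq ι] (s : Finset ι) (a : ι → ℕ → ℝ) (k : ℕ) (hk : k ≤ 4) :
    C (fun j => ∑ i ∈ s, a i j) k =
      ∑ n ∈ s.finsuppAntidiag k, ∏ i ∈ s, C (a i) (n i) := by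
  have key : ∀ k ≤ 4, C (fun j => ∑ i ∈ s, a i j) k =
      PowerSeries.coeff k (∏ i ∈ s, PowerSeries.mk (C (a i))) := by
    induction s using Finset.induction_on with
    | empty => intro k hk; simp [C_zero, PowerSeries.coeff_one]
    | insert i s hi ih =>
      intro k hk
      simp only [Finset.sum_insert hi, Finset.prod_insert hi]
      rw [C_add _ _ k hk, PowerSeries.coeff_mul]
      refine Finset.sum_congr rfl fun p hp => ?_
      have := Finset.HasAntidiagonal.mem_antidiagonal.1 hp
      rw [ih p.2 (by omega)]; simp
  rw [key k hk, PowerSeries.coeff_prod]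
  simp

/-- one-dimensional coefficients -/
def a1 (z : ℝ) (j : ℕ) : ℝ := (1/2) * (-1) ^ (j+1) * (j * z ^ 2 - 1)

def w (j : ℕ) : ℝ := C (fun _ => 1/2) j

/-- moments -/
def dens (x : ℝ) : ℝ := (Real.sqrt (2 * Real.pi))⁻¹ * Real.exp (-(1/2) * x ^ 2)

theorem dens_int (n : ℕ) : Integrable (fun x : ℝ => x ^ n * dens x) := by
  have h := integrable_rpow_mul_exp_neg_mul_sq (b := 1/2) (by norm_num) (s := n) (by
    have : (0:ℝ) ≤ n := Nat.cast_nonneg n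
    linarith)
  have := h.const_mul (Real.sqrt (2 * Real.pi))⁻¹
  refine this.congr (Filter.Eventually.of_forall fun x => ?_)
  simp only [dens, Real.rpow_natCast]; ring

theorem dens_one : ∫ x : ℝ, dens x = 1 := by
  have := integral_gaussian (1/2)
  simp only [dens]
  rw [integral_const_mul, this]
  rw [show Real.pi / (1/2) = 2 * Real.pi by ring]
  apply inv_mul_cancel₀
  positivity

theorem dens_rec (n : ℕ) : ∫ x : ℝ, x ^ (n+2) * dens x = (n+1) * ∫ x : ℝ, x ^ n * dens x := by
  have hd : ∀ x : ℝ, HasDerivAt (fun x : ℝ => x ^ (n+1) * dens x)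
      ((n+1) * (x ^ n * dens x) - x ^ (n+2) * dens x) x := by
    intro x
    have h1 : HasDerivAt dens (-x * dens x) x := by
      have : HasDerivAt (fun x : ℝ => -(1/2) * x ^ 2) (-(1/2) * (2 * x)) x := by
        simpa using (hasDerivAt_pow 2 x).const_mul (-(1/2:ℝ))
      have := (this.exp).const_mul (Real.sqrt (2 * Real.pi))⁻¹
      refine this.congr_deriv ?_
      simp only [dens]; ring
    have := (hasDerivAt_pow (n+1) x).mul h1
    refine this.congr_deriv ?_
    simp only [Nat.add_sub_cancel]; push_cast; ring
  have h0 := integral_eq_zero_of_hasDerivAt_of_integrable hd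
    (((dens_int n).const_mul _).sub (dens_int (n+2))) (dens_int (n+1))
  rw [integral_sub ((dens_int n).const_mul _) (dens_int (n+2)), integral_const_mul] at h0
  linarith

/-- polynomial in `z^2` integrates through moments -/
def mom : ℕ → ℝ
  | 0 => 1
  | (n+1) => (2 * n + 1) * mom n

theorem dens_mom (n : ℕ) : ∫ x : ℝ, x ^ (2*n) * dens x = mom n := by
  induction n with
  | zero => simp [mom, dens_one]
  | succ n ih => rw [show 2*(n+1) = 2*n+2 by ring, dens_rec, ih, mom]; push_cast; ring

/-- coefficient lists of the one-dimensional polynomials -/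
def pc : ℕ → ℕ → ℝ
  | 0, 0 => 1
  | 1, 0 => -1/2
  | 1, 1 => 1/2
  | 2, 0 => 3/8
  | 2, 1 => -6/8
  | 2, 2 => 1/8
  | 3, 0 => -15/48
  | 3, 1 => 45/48
  | 3, 2 => -15/48
  | 3, 3 => 1/48
  | 4, 0 => 105/384
  | 4, 1 => -420/384
  | 4, 2 => 210/384
  | 4, 3 => -28/384
  | 4, 4 => 1/384
  | _, _ => 0

theorem C_pc (z : ℝ) (k : ℕ) (hk : k ≤ 4) :
    C (a1 z) k = ∑ i ∈ range 5, pc k i * z ^ (2*i) := by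
  interval_cases k <;> simp [C, a1, pc, Finset.sum_range_succ] <;> ring

set_option maxHeartbeats 4000000 in
theorem C_orth (k l : ℕ) (hk : k ≤ 4) (hl : l ≤ 4) :
    Integrable (fun z => (C (a1 z) k * C (a1 z) l) * dens z) ∧
    ∫ z : ℝ, (C (a1 z) k * C (a1 z) l) * dens z = if k = l then w k else 0 := by
  have h1 : (fun z => (C (a1 z) k * C (a1 z) l) * dens z) = fun z =>
      ∑ i ∈ range 5, ∑ j ∈ range 5, (pc k i * pc l j) * (z ^ (2*(i+j)) * dens z) := by
    funext z
    rw [C_pc z k hk, C_pc z l hl, Finset.sum_mul_sum, Finset.sum_mul]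
    refine Finset.sum_congr rfl fun i _ => ?_
    rw [Finset.sum_mul]
    refine Finset.sum_congr rfl fun j _ => ?_
    ring
  have hi : ∀ i j, Integrable (fun z => (pc k i * pc l j) * (z ^ (2*(i+j)) * dens z)) :=
    fun i j => (dens_int _).const_mul _
  rw [h1]
  refine ⟨integrable_finsetSum _ fun i _ => integrable_finsetSum _ fun j _ => hi i j, ?_⟩
  rw [integral_finsetSum _ fun i _ => integrable_finsetSum _ fun j _ => hi i j]
  simp_rw [integral_finsetSum _ fun j _ => hi _ j, integral_const_mul, dens_mom]
  interval_cases k <;> interval_cases l <;>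
    norm_num [pc, mom, w, C, Finset.sum_range_succ]

end MomH
end

noncomputable section
namespace MomH
open Finset

theorem dens_nonneg (x : ℝ) : 0 ≤ dens x := by unfold dens; positivity

theorem gaussDensity_one {d : ℕ} (x : Fin d → ℝ) :
    gaussDensity (1 : Matrix (Fin d) (Fin d) ℝ) x = ∏ i, dens (x i) := by
  simp only [gaussDensity, dens, Matrix.det_one, mul_one, inv_one, Matrix.one_mulVec, dotProduct]
  rw [Finset.prod_mul_distrib, ← Real.exp_sum, Finset.prod_const, Finset.card_univ, Fintype.card_fin,
    inv_pow, Finset.mul_sum]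
  congr 2
  · rw [Real.sqrt_eq_rpow, Real.sqrt_eq_rpow, ← Real.rpow_natCast, ← Real.rpow_natCast,
      ← Real.rpow_mul (by positivity), ← Real.rpow_mul (by positivity), mul_comm (d:ℝ)]
  · exact Finset.sum_congr rfl fun i _ => by rw [sq]

theorem meas_gd {d : ℕ} (M : Matrix (Fin d) (Fin d) ℝ) : Measurable (gaussDensity M) := by
  unfold gaussDensity
  have : Continuous fun x : Fin d → ℝ => x ⬝ᵥ M⁻¹.mulVec x := by fun_prop
  exact (Continuous.measurable (by fun_prop))

theorem gd_nonneg {d : ℕ} (M : Matrix (Fin d) (Fin d) ℝ) (x : Fin d → ℝ) : 0 ≤ gaussDensity M x := by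
  unfold gaussDensity; positivity

theorem integral_gl {d : ℕ} (M : Matrix (Fin d) (Fin d) ℝ) (f : (Fin d → ℝ) → ℝ) :
    ∫ x, f x ∂(gaussLaw M) = ∫ x, f x * gaussDensity M x := by
  unfold gaussLaw
  rw [integral_withDensity_eq_integral_toReal_smul]
  · refine integral_congr_ae (Filter.Eventually.of_forall fun x => ?_)
    simp [ENNReal.toReal_ofReal (gd_nonneg M x), mul_comm]
  · exact (meas_gd M).ennreal_ofReal
  · simp

theorem integrable_gl {d : ℕ} (M : Matrix (Fin d) (Fin d) ℝ) (f : (Fin d → ℝ) → ℝ) :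
    Integrable f (gaussLaw M) ↔ Integrable fun x => f x * gaussDensity M x := by
  unfold gaussLaw
  rw [integrable_withDensity_iff_integrable_smul']
  · refine integrable_congr (Filter.Eventually.of_forall fun x => ?_)
    simp [ENNReal.toReal_ofReal (gd_nonneg M x), mul_comm]
  · exact (meas_gd M).ennreal_ofReal
  · simp

theorem prob_gl {d : ℕ} : IsProbabilityMeasure (gaussLaw (1 : Matrix (Fin d) (Fin d) ℝ)) := by
  constructor
  unfold gaussLaw
  rw [withDensity_apply _ MeasurableSet.univ, Measure.restrict_univ,
    ← ofReal_integral_eq_lintegral_ofReal]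
  · simp only [gaussDensity_one]
    rw [integral_fintype_prod_volume_eq_prod]; simp [dens_one]
  · simp only [funext gaussDensity_one]
    exact Integrable.fintype_prod fun i => by simpa using dens_int 0
  · exact Filter.Eventually.of_forall fun x => gd_nonneg _ x

theorem E_diag {d : ℕ} (μ : Fin d → ℝ) (k : ℕ) (hk : k ≤ 4) :
    Integrable (fun z : Fin d → ℝ => (C (fun j => ∑ i, μ i ^ j * a1 (z i) j) k) ^ 2)
      (gaussLaw (1 : Matrix (Fin d) (Fin d) ℝ)) ∧
    ∫ z : Fin d → ℝ, (C (fun j => ∑ i, μ i ^ j * a1 (z i) j) k) ^ 2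
      ∂(gaussLaw (1 : Matrix (Fin d) (Fin d) ℝ)) =
    C (fun j => ∑ i, (μ i ^ 2) ^ j * (1/2)) k := by
  classical
  rw [integral_gl, integrable_gl]
  set T := (Finset.univ : Finset (Fin d)).finsuppAntidiag k
  have hT : ∀ n ∈ T, ∀ i, n i ≤ 4 := by
    intro n hn i
    have : ∑ i, n i = k := (Finset.mem_finsuppAntidiag.1 hn).1
    have h2 : n i ≤ ∑ i, n i := Finset.single_le_sum (f := fun i => n i) (fun _ _ => Nat.zero_le _)
      (Finset.mem_univ i)
    omega
  have h1 : (fun z : Fin d → ℝ => (C (fun j => ∑ i, μ i ^ j * a1 (z i) j) k) ^ 2 *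
      gaussDensity 1 z) = fun z => ∑ n ∈ T, ∑ m ∈ T, ∏ i,
        ((μ i ^ n i * μ i ^ m i) * ((C (a1 (z i)) (n i) * C (a1 (z i)) (m i)) * dens (z i))) := by
    funext z
    rw [C_sum _ (fun i j => μ i ^ j * a1 (z i) j) k hk, gaussDensity_one, sq, Finset.sum_mul_sum,
      Finset.sum_mul]
    refine Finset.sum_congr rfl fun n _ => ?_
    rw [Finset.sum_mul]
    refine Finset.sum_congr rfl fun m _ => ?_
    rw [← Finset.prod_mul_distrib, ← Finset.prod_mul_distrib]
    refine Finset.prod_congr rfl fun i _ => ?_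
    rw [C_smul, C_smul]; ring
  have hi : ∀ n ∈ T, ∀ m ∈ T, Integrable (fun z : Fin d → ℝ => ∏ i,
        ((μ i ^ n i * μ i ^ m i) * ((C (a1 (z i)) (n i) * C (a1 (z i)) (m i)) * dens (z i)))) := by
    intro n hn m hm
    exact Integrable.fintype_prod (f := fun i z => ((μ i ^ n i * μ i ^ m i) *
      ((C (a1 z) (n i) * C (a1 z) (m i)) * dens z)))
      fun i => ((C_orth _ _ (hT n hn i) (hT m hm i)).1).const_mul _
  rw [h1]
  refine ⟨integrable_finsetSum _ fun n hn => integrable_finsetSum _ fun m hm => hi n hn m hm, ?_⟩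
  rw [integral_finsetSum _ fun n hn => integrable_finsetSum _ fun m hm => hi n hn m hm,
    C_sum _ (fun i j => (μ i ^ 2) ^ j * (1/2)) k hk]
  refine Finset.sum_congr rfl fun n hn => ?_
  rw [integral_finsetSum _ fun m hm => hi n hn m hm]
  have h3 : ∀ m ∈ T, (∫ z : Fin d → ℝ, ∏ i,
        ((μ i ^ n i * μ i ^ m i) * ((C (a1 (z i)) (n i) * C (a1 (z i)) (m i)) * dens (z i)))) =
      if n = m then ∏ i, C (fun j => (μ i ^ 2) ^ j * (1/2)) (n i) else 0 := by
    intro m hm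
    rw [integral_fintype_prod_volume_eq_prod (f := fun i z => ((μ i ^ n i * μ i ^ m i) *
      ((C (a1 z) (n i) * C (a1 z) (m i)) * dens z)))]
    simp_rw [integral_const_mul]
    have h4 : ∀ i, ∫ z : ℝ, (C (a1 z) (n i) * C (a1 z) (m i)) * dens z =
        if n i = m i then w (n i) else 0 := fun i => (C_orth _ _ (hT n hn i) (hT m hm i)).2
    simp_rw [h4]
    split_ifs with h
    · subst h
      refine Finset.prod_congr rfl fun i _ => ?_
      rw [C_smul (fun _ => 1/2)]; simp only [w, if_true]; ring
    · obtain ⟨i, hi⟩ : ∃ i, n i ≠ m i := by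
        by_contra hc; push Not at hc; exact h (Finsupp.ext hc)
      exact Finset.prod_eq_zero (Finset.mem_univ i) (by simp [hi])
  rw [Finset.sum_congr rfl h3, Finset.sum_ite_eq, if_pos hn]

theorem gl_rot {d : ℕ} (U : Matrix (Fin d) (Fin d) ℝ) (hU : Uᵀ * U = 1) :
    MeasurePreserving (fun x : Fin d → ℝ => U.mulVec x) (gaussLaw 1) (gaussLaw 1) := by
  have hdet : U.det * U.det = 1 := by
    have := congrArg Matrix.det hU; simpa using this
  have hd0 : U.det ≠ 0 := by intro h; simp [h] at hdet
  have habs : |U.det⁻¹| = 1 := by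
    rw [abs_inv]
    have : |U.det| * |U.det| = 1 := by rw [← abs_mul, hdet, abs_one]
    have h0 := abs_nonneg U.det
    have : |U.det| = 1 := by nlinarith
    simp [this]
  have hm : Measurable (fun x : Fin d → ℝ => U.mulVec x) :=
    Continuous.measurable (by fun_prop)
  have hv : Measure.map (fun x : Fin d → ℝ => U.mulVec x) volume = volume := by
    have := Real.map_matrix_volume_pi_eq_smul_volume_pi hd0
    rw [habs] at this; simp only [ENNReal.ofReal_one, one_smul] at this
    exact this
  refine ⟨hm, ?_⟩
  ext s hs
  rw [Measure.map_apply hm hs]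
  unfold gaussLaw
  rw [withDensity_apply _ (hm hs), withDensity_apply _ hs]
  conv_rhs => rw [← hv]
  rw [setLIntegral_map hs (meas_gd _).ennreal_ofReal hm]
  refine lintegral_congr fun x => ?_
  congr 1
  simp only [gaussDensity, inv_one, Matrix.one_mulVec]
  rw [Matrix.dotProduct_mulVec, Matrix.vecMul_mulVec, hU, Matrix.vecMul_one]

end MomH
end

noncomputable section
namespace MomH
open Finset

/-- one-dimensional density ratio -/
def G (z μ ε : ℝ) : ℝ := (Real.sqrt (1 + ε * μ))⁻¹ * Real.exp ((1/2) * z ^ 2 * (1 - (1 + ε * μ)⁻¹))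

def psi (z μ : ℝ) : Polynomial ℝ :=
  Polynomial.C (μ/2) * (Polynomial.C (z^2) * Polynomial.X ^ 2 - Polynomial.X)

def R (z μ : ℝ) : ℕ → Polynomial ℝ
  | 0 => 1
  | (k+1) => psi z μ * R z μ k - Polynomial.C μ * Polynomial.X ^ 2 * Polynomial.derivative (R z μ k)

theorem G_deriv (z μ ε : ℝ) (h : 0 < 1 + ε * μ) (q : Polynomial ℝ) :
    HasDerivAt (fun ε => G z μ ε * q.eval ((1 + ε * μ)⁻¹))
      (G z μ ε * (psi z μ * q - Polynomial.C μ * Polynomial.X ^ 2 * Polynomial.derivative q).eval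
        ((1 + ε * μ)⁻¹)) ε := by
  have h0 : HasDerivAt (fun ε => 1 + ε * μ) μ ε := by
    simpa using ((hasDerivAt_id ε).mul_const μ).const_add 1
  have hv : HasDerivAt (fun ε => (1 + ε * μ)⁻¹) (-μ / (1 + ε * μ) ^ 2) ε := h0.inv h.ne'
  have hs : HasDerivAt (fun ε => (Real.sqrt (1 + ε * μ))⁻¹)
      (-(μ / (2 * Real.sqrt (1 + ε * μ))) / (Real.sqrt (1 + ε * μ)) ^ 2) ε :=
    (h0.sqrt h.ne').inv (Real.sqrt_pos.2 h).ne'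
  have he := ((hv.const_sub 1).const_mul ((1/2) * z ^ 2)).exp
  have hG := hs.mul he
  have hq := (q.hasDerivAt ((1 + ε * μ)⁻¹)).comp ε hv
  refine (hG.mul hq).congr_deriv ?_
  have hsq : Real.sqrt (1 + ε * μ) ^ 2 = 1 + ε * μ := Real.sq_sqrt h.le
  have hsp := (Real.sqrt_pos.2 h).ne'
  simp only [G, psi, Polynomial.eval_sub, Polynomial.eval_mul, Polynomial.eval_C, Polynomial.eval_pow,
    Polynomial.eval_X, Function.comp, Pi.mul_apply, hsq]
  generalize Real.sqrt (1 + ε * μ) = r at *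
  generalize Real.exp _ = e
  generalize (Polynomial.derivative q).eval _ = q'
  generalize Polynomial.eval _ q = q0
  have := h.ne'
  field_simp
  ring

theorem ev_pos (μ : ℝ) : ∀ᶠ ε in nhds (0:ℝ), 0 < 1 + ε * μ := by
  have : Continuous fun ε : ℝ => 1 + ε * μ := by fun_prop
  exact this.continuousAt.eventually (lt_mem_nhds (by simp))

theorem G_iter (z μ : ℝ) (k : ℕ) (ε : ℝ) (h : 0 < 1 + ε * μ) :
    iteratedDeriv k (G z μ) ε = G z μ ε * (R z μ k).eval ((1 + ε * μ)⁻¹) := by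
  induction k generalizing ε with
  | zero => simp [R]
  | succ k ih =>
    rw [iteratedDeriv_succ]
    have ho : ∀ᶠ x in nhds ε, 0 < 1 + x * μ := by
      have : Continuous fun ε : ℝ => 1 + ε * μ := by fun_prop
      exact this.continuousAt.eventually (lt_mem_nhds h)
    have : iteratedDeriv k (G z μ) =ᶠ[nhds ε]
        fun ε => G z μ ε * (R z μ k).eval ((1 + ε * μ)⁻¹) := by
      filter_upwards [ho] with x hx using ih x hx
    rw [this.deriv_eq]
    exact (G_deriv z μ ε h _).deriv

theorem G_zero (z μ : ℝ) : G z μ 0 = 1 := by simp [G]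

theorem G_iter0 (z μ : ℝ) (k : ℕ) (hk : k ≤ 4) :
    iteratedDeriv k (G z μ) 0 = k.factorial * C (fun j => μ ^ j * a1 z j) k := by
  rw [G_iter z μ k 0 (by simp), G_zero, C_smul]
  interval_cases k <;> simp [R, psi, C, a1, Nat.factorial, -map_pow] <;> ring

theorem G_smooth (z μ : ℝ) : ContDiffAt ℝ 4 (G z μ) 0 := by
  unfold G
  have h0 : ContDiffAt ℝ 4 (fun ε : ℝ => 1 + ε * μ) 0 := by fun_prop
  have h1 : ContDiffAt ℝ 4 (fun ε : ℝ => Real.sqrt (1 + ε * μ)) 0 := h0.sqrt (by simp)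
  have h2 := h1.inv (by simp)
  have h3 := h0.inv (by simp)
  exact h2.mul ((contDiffAt_const.mul (contDiffAt_const.sub h3)).exp)

theorem prodG {ι : Type*} (s : Finset ι) (z μ : ι → ℝ) :
    ContDiffAt ℝ 4 (fun ε => ∏ i ∈ s, G (z i) (μ i) ε) 0 ∧
    ∀ k ≤ 4, iteratedDeriv k (fun ε => ∏ i ∈ s, G (z i) (μ i) ε) 0 =
      k.factorial * C (fun j => ∑ i ∈ s, μ i ^ j * a1 (z i) j) k := by
  classical
  induction s using Finset.induction_on with
  | empty =>
    refine ⟨by simpa using contDiffAt_const, fun k hk => ?_⟩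
    simp only [Finset.prod_empty, Finset.sum_empty, C_zero, iteratedDeriv_const]
    split_ifs with h <;> simp [h]
  | insert i s hi ih =>
    simp only [Finset.prod_insert hi, Finset.sum_insert hi]
    refine ⟨(G_smooth _ _).mul ih.1, fun k hk => ?_⟩
    have hk' : (k : WithTop ℕ∞) ≤ 4 := by exact_mod_cast hk
    rw [iteratedDeriv_fun_mul ((G_smooth _ _).of_le hk') (ih.1.of_le hk'), C_add _ _ k hk,
      Finset.Nat.sum_antidiagonal_eq_sum_range_succ_mk, Finset.mul_sum]
    refine Finset.sum_congr rfl fun j hj => ?_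
    have hj' : j ≤ k := by simpa [Nat.lt_succ_iff] using hj
    rw [G_iter0 _ _ j (by omega), ih.2 (k - j) (by omega)]
    have := Nat.choose_mul_factorial_mul_factorial hj'
    rw [← this]; push_cast; ring

/-- orthogonal diagonalisation -/
structure Dg {d : ℕ} (B U : Matrix (Fin d) (Fin d) ℝ) (μ : Fin d → ℝ) : Prop where
  h1 : Uᵀ * U = 1
  h2 : U * Uᵀ = 1
  h3 : B = U * Matrix.diagonal μ * Uᵀ

theorem exists_Dg {d : ℕ} (B : Matrix (Fin d) (Fin d) ℝ) (hB : B.IsHermitian) :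
    ∃ U μ, Dg B U μ := by
  refine ⟨hB.eigenvectorUnitary, hB.eigenvalues, ?_, ?_, ?_⟩
  · have := Unitary.coe_star_mul_self hB.eigenvectorUnitary
    simpa [Matrix.star_eq_conjTranspose, Matrix.conjTranspose_eq_transpose_of_trivial] using this
  · have := Unitary.coe_mul_star_self hB.eigenvectorUnitary
    simpa [Matrix.star_eq_conjTranspose, Matrix.conjTranspose_eq_transpose_of_trivial] using this
  · have := hB.spectral_theorem
    rw [Unitary.conjStarAlgAut_apply] at this
    simpa [Matrix.star_eq_conjTranspose, Matrix.conjTranspose_eq_transpose_of_trivial,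
      Function.comp_def] using this

theorem Dg.pow {d : ℕ} {B U : Matrix (Fin d) (Fin d) ℝ} {μ : Fin d → ℝ} (h : Dg B U μ) (j : ℕ) :
    B ^ j = U * Matrix.diagonal (fun i => μ i ^ j) * Uᵀ := by
  induction j with
  | zero => simp [h.h2]
  | succ j ih =>
    rw [pow_succ, ih]
    conv_lhs => rw [h.h3]
    calc U * diagonal (fun i => μ i ^ j) * Uᵀ * (U * diagonal μ * Uᵀ)
        = U * diagonal (fun i => μ i ^ j) * (Uᵀ * U) * diagonal μ * Uᵀ := by
          simp only [Matrix.mul_assoc]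
      _ = _ := by
          rw [h.h1, Matrix.mul_one, Matrix.mul_assoc U, Matrix.diagonal_mul_diagonal]
          simp only [pow_succ]

theorem Dg.trace {d : ℕ} {B U : Matrix (Fin d) (Fin d) ℝ} {μ : Fin d → ℝ} (h : Dg B U μ) (j : ℕ) :
    Matrix.trace (B ^ j) = ∑ i, μ i ^ j := by
  rw [h.pow, Matrix.trace_mul_comm, ← Matrix.mul_assoc, h.h1, Matrix.one_mul, Matrix.trace_diagonal]

theorem quad {d : ℕ} (U : Matrix (Fin d) (Fin d) ℝ) (v : Fin d → ℝ) (n : Fin d → ℝ) :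
    n ⬝ᵥ (U * Matrix.diagonal v * Uᵀ).mulVec n = ∑ i, v i * (Uᵀ.mulVec n i) ^ 2 := by
  rw [← Matrix.mulVec_mulVec, ← Matrix.mulVec_mulVec, Matrix.dotProduct_mulVec,
    ← Matrix.mulVec_transpose, dotProduct]
  refine Finset.sum_congr rfl fun i _ => ?_
  rw [Matrix.mulVec_diagonal]; ring

/-- the `j`-th coefficient -/
def alpha {d : ℕ} (B : Matrix (Fin d) (Fin d) ℝ) (n : Fin d → ℝ) (j : ℕ) : ℝ :=
  (1/2) * (-1) ^ (j+1) * (j * (n ⬝ᵥ (B ^ j).mulVec n) - Matrix.trace (B ^ j))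

theorem Dg.alpha {d : ℕ} {B U : Matrix (Fin d) (Fin d) ℝ} {μ : Fin d → ℝ} (h : Dg B U μ)
    (n : Fin d → ℝ) (j : ℕ) :
    alpha B n j = ∑ i, μ i ^ j * a1 (Uᵀ.mulVec n i) j := by
  rw [MomH.alpha, h.trace, h.pow, quad, Finset.mul_sum, ← Finset.sum_sub_distrib, Finset.mul_sum]
  refine Finset.sum_congr rfl fun i _ => ?_
  simp only [a1]; ring

theorem Dg.one_add {d : ℕ} {B U : Matrix (Fin d) (Fin d) ℝ} {μ : Fin d → ℝ} (h : Dg B U μ)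
    (ε : ℝ) : 1 + ε • B = U * diagonal (fun i => 1 + ε * μ i) * Uᵀ := by
  have : diagonal (fun i => 1 + ε * μ i) = (1 : Matrix (Fin d) (Fin d) ℝ) + ε • diagonal μ := by
    ext i j
    by_cases hij : i = j
    · subst hij; simp
    · simp [hij]
  rw [this, Matrix.mul_add, Matrix.add_mul, Matrix.mul_one, h.h2, Matrix.mul_smul, Matrix.smul_mul,
    ← h.h3]

theorem Dg.gauss {d : ℕ} {B U : Matrix (Fin d) (Fin d) ℝ} {μ : Fin d → ℝ} (h : Dg B U μ)
    (ε : ℝ) (hε : ∀ i, 0 < 1 + ε * μ i) (n : Fin d → ℝ) :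
    (Real.sqrt (1 + ε • B).det)⁻¹ * Real.exp (-(1/2) * (n ⬝ᵥ (1 + ε • B)⁻¹.mulVec n)) =
      Real.exp (-(1/2) * (n ⬝ᵥ n)) * ∏ i, G (Uᵀ.mulVec n i) (μ i) ε := by
  have hdet : (1 + ε • B).det = ∏ i, (1 + ε * μ i) := by
    rw [h.one_add, Matrix.det_mul_right_comm, h.h2, Matrix.one_mul, Matrix.det_diagonal]
  have hinv : (1 + ε • B)⁻¹ = U * diagonal (fun i => (1 + ε * μ i)⁻¹) * Uᵀ := by
    apply Matrix.inv_eq_right_inv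
    rw [h.one_add]
    calc _ = U * diagonal (fun i => 1 + ε * μ i) * (Uᵀ * U) *
          diagonal (fun i => (1 + ε * μ i)⁻¹) * Uᵀ := by simp only [Matrix.mul_assoc]
      _ = _ := by
        rw [h.h1, Matrix.mul_one, Matrix.mul_assoc U, Matrix.diagonal_mul_diagonal]
        have : (fun i => (1 + ε * μ i) * (1 + ε * μ i)⁻¹) = fun _ => 1 := by
          funext i; exact mul_inv_cancel₀ (hε i).ne'
        rw [this, Matrix.diagonal_one, Matrix.mul_one, h.h2]
  have hnn : n ⬝ᵥ n = ∑ i, (Uᵀ.mulVec n i) ^ 2 := by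
    have := quad U (fun _ => 1) n
    simpa [h.h2] using this
  rw [hdet, hinv, quad, hnn]
  simp only [G]
  rw [Finset.prod_mul_distrib, ← Real.exp_sum, Finset.prod_inv_distrib,
    Real.sqrt_prod _ (fun i _ => (hε i).le), mul_left_comm, ← Real.exp_add]
  congr 2
  rw [Finset.mul_sum, Finset.mul_sum, ← Finset.sum_add_distrib]
  refine Finset.sum_congr rfl fun i _ => ?_
  ring

theorem hfun_eq {d : ℕ} (A K S : Matrix (Fin d) (Fin d) ℝ) (t : ℝ) (hK : K.PosDef)
    (hS : IsUnit S.det) (hSS : S * S = Gam A K t)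
    (hB : (S⁻¹ * (A - K) * S⁻¹).IsHermitian) (n : Fin d → ℝ) (k : ℕ) (hk : k ≤ 4)
    (hST : Sᵀ = S) :
    hfun k A K t (S.mulVec n) = k.factorial * C (alpha (S⁻¹ * (A - K) * S⁻¹) n) k := by
  set B := S⁻¹ * (A - K) * S⁻¹ with hBdef
  obtain ⟨U, μ, h⟩ := exists_Dg B hB
  have hG : ∀ s, Gam A K s = S * (1 + (s - t) • B) * S := by
    intro s
    have e1 : S * B * S = A - K := by
      rw [hBdef, ← Matrix.mul_assoc, ← Matrix.mul_assoc, Matrix.mul_nonsing_inv S hS, Matrix.one_mul,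
        Matrix.mul_assoc, Matrix.nonsing_inv_mul S hS, Matrix.mul_one]
    rw [Matrix.mul_add, Matrix.add_mul, Matrix.mul_one, hSS, Matrix.mul_smul, Matrix.smul_mul, e1]
    simp only [Gam]
    module
  set c : ℝ := (Real.sqrt ((2 * Real.pi) ^ d * (S.det * S.det)))⁻¹ *
    Real.exp (-(1/2) * (n ⬝ᵥ n)) / gaussDensity K (S.mulVec n) with hc
  have hc0 : c ≠ 0 := by
    have hd : S.det ≠ 0 := hS.ne_zero
    have : 0 < S.det * S.det := mul_self_pos.2 hd
    have hKd := hK.det_pos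
    have : 0 < gaussDensity K (S.mulVec n) := by unfold gaussDensity; positivity
    rw [hc]; positivity
  have hg : ∀ s, (∀ i, 0 < 1 + (s - t) * μ i) → gfun A K s (S.mulVec n) =
      c * ∏ i, G (Uᵀ.mulVec n i) (μ i) (s - t) := by
    intro s hs
    have e2 : S.mulVec n ⬝ᵥ (Gam A K s)⁻¹.mulVec (S.mulVec n) =
        n ⬝ᵥ (1 + (s - t) • B)⁻¹.mulVec n := by
      rw [hG, Matrix.mul_inv_rev, Matrix.mul_inv_rev, Matrix.mulVec_mulVec, Matrix.mul_assoc,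
        Matrix.mul_assoc, Matrix.nonsing_inv_mul S hS, Matrix.mul_one, ← Matrix.mulVec_mulVec,
        Matrix.dotProduct_mulVec, ← Matrix.mulVec_transpose, Matrix.mulVec_mulVec,
        Matrix.transpose_nonsing_inv, hST, Matrix.nonsing_inv_mul S hS, Matrix.one_mulVec]
    have e3 : (Gam A K s).det = S.det * S.det * (1 + (s - t) • B).det := by
      rw [hG, Matrix.det_mul, Matrix.det_mul]; ring
    rw [gfun, gaussDensity, e2, e3, ← mul_assoc, Real.sqrt_mul (by
      have := mul_self_nonneg S.det
      positivity), mul_inv, mul_assoc, h.gauss _ hs, hc]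
    ring
  have hev : (fun s => gfun A K s (S.mulVec n)) =ᶠ[nhds t]
      fun s => c * ∏ i, G (Uᵀ.mulVec n i) (μ i) (s - t) := by
    have h1 : ∀ᶠ ε in nhds (0:ℝ), ∀ i, 0 < 1 + ε * μ i :=
      Filter.eventually_all.2 fun i => ev_pos (μ i)
    have h2 : Filter.Tendsto (fun s : ℝ => s - t) (nhds t) (nhds 0) := by
      have : Continuous fun s : ℝ => s - t := by fun_prop
      simpa using this.tendsto t
    filter_upwards [h2.eventually h1] with s hs using hg s hs
  have ht : gfun A K t (S.mulVec n) = c := by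
    rw [hg t (by simp)]; simp [G_zero]
  rw [hfun, ht, hev.iteratedDeriv_eq k, iteratedDeriv_const_mul_field,
    iteratedDeriv_comp_sub_const k (fun ε => ∏ i, G (Uᵀ.mulVec n i) (μ i) ε) t]
  beta_reduce
  rw [sub_self, (prodG _ _ _).2 k hk]
  rw [mul_div_assoc, mul_comm, div_mul_cancel₀ _ hc0]
  congr 2
  funext j
  rw [h.alpha]

theorem E_B {d : ℕ} (B : Matrix (Fin d) (Fin d) ℝ) (hB : B.IsHermitian) (k : ℕ) (hk : k ≤ 4) :
    Integrable (fun n : Fin d → ℝ => (C (alpha B n) k) ^ 2) (gaussLaw 1) ∧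
    ∫ n, (C (alpha B n) k) ^ 2 ∂(gaussLaw (1 : Matrix (Fin d) (Fin d) ℝ)) =
      C (fun j => Matrix.trace (B ^ (2 * j)) / 2) k := by
  obtain ⟨U, μ, h⟩ := exists_Dg B hB
  have e : ∀ n, alpha B n = fun j => ∑ i, μ i ^ j * a1 (Uᵀ.mulVec n i) j :=
    fun n => funext fun j => h.alpha n j
  have hr := gl_rot Uᵀ (by rw [Matrix.transpose_transpose]; exact h.h2)
  have hme : MeasurableEmbedding (fun x : Fin d → ℝ => Uᵀ.mulVec x) := by
    apply Continuous.measurableEmbedding (by fun_prop)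
    intro x y hxy
    have := congrArg (fun v => U.mulVec v) hxy
    simpa [Matrix.mulVec_mulVec, h.h2] using this
  obtain ⟨f, hf⟩ : ∃ f : (Fin d → ℝ) → ℝ, f =
    fun z => (C (fun j => ∑ i, μ i ^ j * a1 (z i) j) k) ^ 2 := ⟨_, rfl⟩
  have hE := E_diag μ k hk
  rw [← hf] at hE
  have e' : (fun n => (C (alpha B n) k) ^ 2) = fun n => f (Uᵀ.mulVec n) := by
    funext n; rw [e, hf]
  have h2 : ∫ z, f z ∂(gaussLaw (1 : Matrix (Fin d) (Fin d) ℝ)) =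
      C (fun j => ∑ i, (μ i ^ 2) ^ j * (1/2)) k := by rw [← hE.2, hf]
  rw [e']
  refine ⟨(hr.integrable_comp_emb hme).2 hE.1, ?_⟩
  rw [hr.integral_comp hme f, h2]
  congr 1
  funext j
  rw [h.trace, Finset.sum_div]
  refine Finset.sum_congr rfl fun i _ => ?_
  rw [pow_mul]; ring

end MomH
end

noncomputable section
namespace MomH
open Finset

theorem dot_self_eq {d : ℕ} (x : Fin d → ℝ) : x ⬝ᵥ x = ∑ i, x i ^ 2 := by
  simp only [dotProduct, sq]

theorem euclNorm_sq {d : ℕ} (x : Fin d → ℝ) : euclNorm x ^ 2 = x ⬝ᵥ x := by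
  rw [euclNorm, Real.sq_sqrt (Finset.sum_nonneg fun i _ => sq_nonneg _), dot_self_eq]

theorem euclNorm_nonneg {d : ℕ} (x : Fin d → ℝ) : 0 ≤ euclNorm x := Real.sqrt_nonneg _

theorem euclNorm_eq {d : ℕ} (x : Fin d → ℝ) : euclNorm x = ‖WithLp.toLp 2 x‖ := by
  rw [EuclideanSpace.norm_eq]; simp [euclNorm]

theorem euclNorm_smul {d : ℕ} (c : ℝ) (x : Fin d → ℝ) : euclNorm (c • x) = |c| * euclNorm x := by
  rw [euclNorm_eq, euclNorm_eq, WithLp.toLp_smul, norm_smul, Real.norm_eq_abs]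

theorem abs_dot_le {d : ℕ} (x y : Fin d → ℝ) : |x ⬝ᵥ y| ≤ euclNorm x * euclNorm y := by
  refine abs_le_of_sq_le_sq ?_ (mul_nonneg (euclNorm_nonneg _) (euclNorm_nonneg _))
  rw [mul_pow, euclNorm_sq, euclNorm_sq, dot_self_eq, dot_self_eq]
  exact Finset.sum_mul_sq_le_sq_mul_sq _ _ _

theorem opNorm_bdd {d : ℕ} (M : Matrix (Fin d) (Fin d) ℝ) :
    BddAbove {r : ℝ | ∃ x : Fin d → ℝ, euclNorm x = 1 ∧ r = euclNorm (M.mulVec x)} := by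
  refine ⟨‖Matrix.toEuclideanCLM (n := Fin d) (𝕜 := ℝ) M‖, ?_⟩
  rintro r ⟨x, hx, rfl⟩
  have := (Matrix.toEuclideanCLM (n := Fin d) (𝕜 := ℝ) M).le_opNorm (WithLp.toLp 2 x)
  rw [Matrix.toEuclideanCLM_toLp, ← euclNorm_eq, ← euclNorm_eq, hx, mul_one] at this
  exact this

theorem opNorm_le_iff {d : ℕ} (hd : 1 ≤ d) (M : Matrix (Fin d) (Fin d) ℝ) (c : ℝ) :
    opNorm M ≤ c ↔ ∀ x : Fin d → ℝ, euclNorm x = 1 → euclNorm (M.mulVec x) ≤ c := by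
  constructor
  · intro h x hx
    exact (le_csSup (opNorm_bdd M) ⟨x, hx, rfl⟩).trans h
  · intro h
    apply csSup_le
    · refine ⟨_, Pi.single ⟨0, hd⟩ 1, ?_, rfl⟩
      have : ∀ i : Fin d, (Pi.single (⟨0, hd⟩ : Fin d) (1:ℝ) : Fin d → ℝ) i ^ 2 =
          if i = ⟨0, hd⟩ then 1 else 0 := by
        intro i; by_cases hi : i = ⟨0, hd⟩
        · subst hi; simp
        · simp [Pi.single_eq_of_ne hi, hi]
      simp [euclNorm, this]
    · rintro r ⟨x, hx, rfl⟩; exact h x hx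

theorem unit_exists {d : ℕ} (x : Fin d → ℝ) (hx : x ≠ 0) :
    ∃ u : Fin d → ℝ, ∃ r : ℝ, euclNorm u = 1 ∧ x = r • u := by
  have h0 : euclNorm x ≠ 0 := by
    rw [euclNorm_eq, norm_ne_zero_iff]
    intro h; exact hx (by simpa using h)
  refine ⟨(euclNorm x)⁻¹ • x, euclNorm x, ?_, ?_⟩
  · rw [euclNorm_smul, abs_of_nonneg (inv_nonneg.2 (euclNorm_nonneg x)), inv_mul_cancel₀ h0]
  · rw [smul_smul, mul_inv_cancel₀ h0, one_smul]

theorem quad_op {d : ℕ} (hd : 1 ≤ d) (M : Matrix (Fin d) (Fin d) ℝ) (c : ℝ) (h : opNorm M ≤ c)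
    (x : Fin d → ℝ) : |x ⬝ᵥ M.mulVec x| ≤ c * (x ⬝ᵥ x) := by
  by_cases hx : x = 0
  · simp [hx]
  · obtain ⟨u, r, hu, rfl⟩ := unit_exists x hx
    have h1 := (opNorm_le_iff hd M c).1 h u hu
    have h2 := abs_dot_le u (M.mulVec u)
    rw [hu, one_mul] at h2
    have h3 : u ⬝ᵥ u = 1 := by rw [← euclNorm_sq, hu]; norm_num
    simp only [Matrix.mulVec_smul, smul_dotProduct, dotProduct_smul, smul_eq_mul, h3]
    rw [abs_mul, abs_mul, ← mul_assoc, abs_mul_abs_self]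
    nlinarith [mul_self_nonneg r, h2.trans h1]

theorem quad_lam {d : ℕ} (K : Matrix (Fin d) (Fin d) ℝ) (hK : K.PosDef) (x : Fin d → ℝ) :
    lambdaMin K * (x ⬝ᵥ x) ≤ x ⬝ᵥ K.mulVec x := by
  by_cases hx : x = 0
  · simp [hx]
  · obtain ⟨u, r, hu, rfl⟩ := unit_exists x hx
    have h1 : lambdaMin K ≤ u ⬝ᵥ K.mulVec u := by
      apply csInf_le
      · refine ⟨0, ?_⟩
        rintro s ⟨y, _, rfl⟩
        simpa using hK.posSemidef.dotProduct_mulVec_nonneg y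
      · exact ⟨u, hu, rfl⟩
    have h3 : u ⬝ᵥ u = 1 := by rw [← euclNorm_sq, hu]; norm_num
    simp only [Matrix.mulVec_smul, smul_dotProduct, dotProduct_smul, smul_eq_mul, h3]
    nlinarith [mul_self_nonneg r]

theorem Gam_quad {d : ℕ} (hd : 1 ≤ d) (A K : Matrix (Fin d) (Fin d) ℝ) (hK : K.PosDef)
    (hE : opNorm (A - K) ≤ lambdaMin K / 2) (t : ℝ) (ht : t ∈ Set.Icc (0:ℝ) 1) (x : Fin d → ℝ) :
    |x ⬝ᵥ (A - K).mulVec x| ≤ x ⬝ᵥ (Gam A K t).mulVec x ∧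
    x ⬝ᵥ K.mulVec x ≤ 2 * (x ⬝ᵥ (Gam A K t).mulVec x) := by
  have e : x ⬝ᵥ (Gam A K t).mulVec x = x ⬝ᵥ K.mulVec x + t * (x ⬝ᵥ (A - K).mulVec x) := by
    have : Gam A K t = K + t • (A - K) := by simp only [Gam]; module
    rw [this, Matrix.add_mulVec, Matrix.smul_mulVec, dotProduct_add, dotProduct_smul, smul_eq_mul]
  have h1 := quad_op hd _ _ hE x
  have h2 := quad_lam K hK x
  rw [e]
  obtain ⟨h3, h4⟩ := abs_le.1 h1
  obtain ⟨t0, t1⟩ := ht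
  set q := lambdaMin K / 2 * (x ⬝ᵥ x)
  have h5 : 2 * q ≤ x ⬝ᵥ K.mulVec x := by simp only [q]; linarith
  have hq : 0 ≤ q := (abs_nonneg _).trans h1
  have h6 : -q ≤ t * (x ⬝ᵥ (A - K).mulVec x) := by nlinarith
  constructor
  · linarith
  · nlinarith

theorem Gam_posDef {d : ℕ} (hd : 1 ≤ d) (A K : Matrix (Fin d) (Fin d) ℝ) (hK : K.PosDef)
    (hA : A.PosSemidef)
    (hE : opNorm (A - K) ≤ lambdaMin K / 2) (t : ℝ) (ht : t ∈ Set.Icc (0:ℝ) 1) :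
    (Gam A K t).PosDef := by
  refine Matrix.PosDef.of_dotProduct_mulVec_pos ?_ fun {x} hx => ?_
  · have h1 := hA.1
    have h2 := hK.1
    unfold Gam
    rw [Matrix.IsHermitian] at *
    rw [Matrix.conjTranspose_add, Matrix.conjTranspose_smul, Matrix.conjTranspose_smul, h1, h2]
    simp
  · have := (Gam_quad hd A K hK hE t ht x).2
    have h2 := hK.dotProduct_mulVec_pos hx
    simp only [star_trivial] at *
    linarith

structure Good {d : ℕ} (A K S : Matrix (Fin d) (Fin d) ℝ) (t : ℝ) : Prop where
  u : IsUnit S.det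
  T : Sᵀ = S
  herm : (S⁻¹ * (A - K) * S⁻¹).IsHermitian
  bd : ∀ j, |Matrix.trace ((S⁻¹ * (A - K) * S⁻¹) ^ j)| ≤ (d : ℝ)
  tr : ∀ j, Matrix.trace (((Gam A K t)⁻¹ * (A - K)) ^ j) = Matrix.trace ((S⁻¹ * (A - K) * S⁻¹) ^ j)

theorem Dg.bd {d : ℕ} {B U : Matrix (Fin d) (Fin d) ℝ} {μ : Fin d → ℝ} (h : Dg B U μ)
    (hB : ∀ x : Fin d → ℝ, |x ⬝ᵥ B.mulVec x| ≤ x ⬝ᵥ x) (i : Fin d) : |μ i| ≤ 1 := by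
  have h1 := hB (U.mulVec (Pi.single i 1))
  rw [h.h3, quad] at h1
  have h2 := quad U (fun _ => 1) (U.mulVec (Pi.single i 1))
  rw [Matrix.diagonal_one, Matrix.mul_one, h.h2, Matrix.one_mulVec] at h2
  rw [h2] at h1
  have h3 : ∀ j, ((Pi.single i (1:ℝ) : Fin d → ℝ) j) ^ 2 = if j = i then 1 else 0 := by
    intro j; by_cases hj : j = i
    · subst hj; simp
    · simp [Pi.single_eq_of_ne hj, hj]
  rw [Matrix.mulVec_mulVec, h.h1, Matrix.one_mulVec] at h1
  simpa [h3] using h1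

theorem good {d : ℕ} (hd : 1 ≤ d) (A K S : Matrix (Fin d) (Fin d) ℝ) (hK : K.PosDef)
    (hA : A.PosSemidef)
    (hE : opNorm (A - K) ≤ lambdaMin K / 2) (t : ℝ) (ht : t ∈ Set.Icc (0:ℝ) 1)
    (hS : S.PosSemidef) (hSS : S * S = Gam A K t) : Good A K S t := by
  have hG := Gam_posDef hd A K hK hA hE t ht
  have u : IsUnit S.det := by
    have h1 := hG.det_pos
    rw [← hSS, Matrix.det_mul] at h1
    rw [isUnit_iff_ne_zero]
    intro h; simp [h] at h1
  have T : Sᵀ = S := by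
    have := hS.1
    rwa [Matrix.IsHermitian, Matrix.conjTranspose_eq_transpose_of_trivial] at this
  have hAK : (A - K)ᵀ = A - K := by
    have := hA.1.sub hK.1
    rwa [Matrix.IsHermitian, Matrix.conjTranspose_eq_transpose_of_trivial] at this
  have herm : (S⁻¹ * (A - K) * S⁻¹).IsHermitian := by
    rw [Matrix.IsHermitian, Matrix.conjTranspose_eq_transpose_of_trivial, Matrix.transpose_mul,
      Matrix.transpose_mul, hAK, Matrix.transpose_nonsing_inv, T, Matrix.mul_assoc]
  have hq : ∀ x : Fin d → ℝ, |x ⬝ᵥ (S⁻¹ * (A - K) * S⁻¹).mulVec x| ≤ x ⬝ᵥ x := by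
    intro x
    have h1 := (Gam_quad hd A K hK hE t ht (S⁻¹.mulVec x)).1
    have h2 : S⁻¹.mulVec x ⬝ᵥ (Gam A K t).mulVec (S⁻¹.mulVec x) = x ⬝ᵥ x := by
      rw [← hSS, ← Matrix.mulVec_mulVec, Matrix.mulVec_mulVec x, Matrix.mul_nonsing_inv S u,
        Matrix.one_mulVec, Matrix.dotProduct_mulVec, ← Matrix.mulVec_transpose, T,
        Matrix.mulVec_mulVec, Matrix.mul_nonsing_inv S u, Matrix.one_mulVec]
    have h3 : x ⬝ᵥ (S⁻¹ * (A - K) * S⁻¹).mulVec x =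
        S⁻¹.mulVec x ⬝ᵥ (A - K).mulVec (S⁻¹.mulVec x) := by
      rw [← Matrix.mulVec_mulVec, ← Matrix.mulVec_mulVec, Matrix.dotProduct_mulVec,
        ← Matrix.mulVec_transpose, Matrix.transpose_nonsing_inv, T]
    rw [h3, ← h2]; exact h1
  refine ⟨u, T, herm, ?_, ?_⟩
  · intro j
    obtain ⟨U, μ, h⟩ := exists_Dg _ herm
    rw [h.trace]
    refine (Finset.abs_sum_le_sum_abs _ _).trans ?_
    calc ∑ i, |μ i ^ j| ≤ ∑ i : Fin d, (1:ℝ) := Finset.sum_le_sum fun i _ => by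
          rw [abs_pow]; exact pow_le_one₀ (abs_nonneg _) (h.bd hq i)
      _ = d := by simp
  · intro j
    have e : (Gam A K t)⁻¹ * (A - K) = S⁻¹ * (S⁻¹ * (A - K) * S⁻¹) * S := by
      rw [← hSS, Matrix.mul_inv_rev, Matrix.mul_assoc S⁻¹ _ S, Matrix.mul_assoc (S⁻¹ * (A - K)),
        Matrix.nonsing_inv_mul S u, Matrix.mul_one, Matrix.mul_assoc]
    rw [e]
    generalize S⁻¹ * (A - K) * S⁻¹ = B
    have : (S⁻¹ * B * S) ^ j = S⁻¹ * B ^ j * S := by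
      induction j with
      | zero => simp [Matrix.nonsing_inv_mul S u]
      | succ j ih =>
        rw [pow_succ, ih, pow_succ]
        calc S⁻¹ * B ^ j * S * (S⁻¹ * B * S) = S⁻¹ * B ^ j * (S * S⁻¹) * B * S := by
              simp only [Matrix.mul_assoc]
          _ = _ := by rw [Matrix.mul_nonsing_inv S u]; simp only [Matrix.mul_assoc, Matrix.one_mul]
    rw [this, Matrix.trace_mul_comm, ← Matrix.mul_assoc, Matrix.mul_nonsing_inv S u, Matrix.one_mul]

open scoped MatrixOrder Matrix.Norms.L2Operator in
theorem sq_inj {d : ℕ} (S T : Matrix (Fin d) (Fin d) ℝ) (hS : S.PosSemidef) (hT : T.PosSemidef)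
    (h : S * S = T * T) : S = T := by
  have h1 := CFC.sqrt_unique (a := S * S) rfl hS.nonneg
  have h2 := CFC.sqrt_unique (a := S * S) h.symm hT.nonneg
  exact h1.symm.trans h2

end MomH
end

noncomputable section
namespace MomH
open Finset

/-- the product σ-algebra on matrices -/
@[reducible] def matMS (d : ℕ) : MeasurableSpace (Matrix (Fin d) (Fin d) ℝ) :=
  (inferInstance : MeasurableSpace (Fin d → Fin d → ℝ))

attribute [local instance] matMS

theorem matBorel (d : ℕ) : BorelSpace (Matrix (Fin d) (Fin d) ℝ) :=
  (inferInstance : BorelSpace (Fin d → Fin d → ℝ))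

theorem matPolish (d : ℕ) : PolishSpace (Matrix (Fin d) (Fin d) ℝ) :=
  (inferInstance : PolishSpace (Fin d → Fin d → ℝ))

theorem matSec (d : ℕ) : SecondCountableTopology (Matrix (Fin d) (Fin d) ℝ) :=
  (inferInstance : SecondCountableTopology (Fin d → Fin d → ℝ))

attribute [local instance] matBorel matPolish matSec

theorem meas_inv (d : ℕ) : Measurable (fun M : Matrix (Fin d) (Fin d) ℝ => M⁻¹) := by
  have h1 : Measurable (fun M : Matrix (Fin d) (Fin d) ℝ => (M.det)⁻¹) :=
    (Continuous.measurable (by fun_prop : Continuous fun M : Matrix (Fin d) (Fin d) ℝ => M.det)).inv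
  have h2 : Measurable (fun M : Matrix (Fin d) (Fin d) ℝ => M.adjugate) :=
    Continuous.measurable (by fun_prop)
  have h3 : Continuous (fun p : ℝ × Matrix (Fin d) (Fin d) ℝ => p.1 • p.2) := by fun_prop
  have := h3.measurable.comp (h1.prodMk h2)
  have e : (fun M : Matrix (Fin d) (Fin d) ℝ => M⁻¹) =
      (fun p : ℝ × Matrix (Fin d) (Fin d) ℝ => p.1 • p.2) ∘ fun a => ((a.det)⁻¹, a.adjugate) := by
    funext M
    simp [Matrix.inv_def, Ring.inverse_eq_inv']
  rw [e]; exact this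

theorem psd_closed (d : ℕ) : IsClosed {M : Matrix (Fin d) (Fin d) ℝ | M.PosSemidef} := by
  have : {M : Matrix (Fin d) (Fin d) ℝ | M.PosSemidef} =
      {M | Mᵀ = M} ∩ ⋂ x : Fin d → ℝ, {M | 0 ≤ x ⬝ᵥ M.mulVec x} := by
    ext M
    simp only [Set.mem_ofPred_eq, Set.mem_inter_iff, Set.mem_iInter,
      Matrix.posSemidef_iff_dotProduct_mulVec, Matrix.IsHermitian,
      Matrix.conjTranspose_eq_transpose_of_trivial, star_trivial]
  rw [this]
  refine IsClosed.inter (isClosed_eq (by fun_prop) (by fun_prop)) (isClosed_iInter fun x => ?_)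
  exact isClosed_le (by fun_prop) (by fun_prop)

theorem ev_closed {d : ℕ} (hd : 1 ≤ d) (K : Matrix (Fin d) (Fin d) ℝ) (c : ℝ) :
    IsClosed {M : Matrix (Fin d) (Fin d) ℝ | opNorm (M - K) ≤ c} := by
  have : {M : Matrix (Fin d) (Fin d) ℝ | opNorm (M - K) ≤ c} =
      ⋂ x : Fin d → ℝ, ⋂ _ : euclNorm x = 1, {M | euclNorm ((M - K).mulVec x) ≤ c} := by
    ext M
    simp only [Set.mem_ofPred_eq, Set.mem_iInter, opNorm_le_iff hd]
  rw [this]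
  refine isClosed_iInter fun x => isClosed_iInter fun _ => ?_
  refine isClosed_le ?_ (by fun_prop)
  unfold euclNorm
  have : ∀ i, Continuous fun M : Matrix (Fin d) (Fin d) ℝ => ((M - K).mulVec x) i := fun i => by
    have h : Continuous fun M : Matrix (Fin d) (Fin d) ℝ => (M - K).mulVec x :=
      Continuous.matrix_mulVec (by fun_prop) continuous_const
    exact (continuous_apply i).comp h
  fun_prop

theorem S_meas {Ω : Type*} {m : MeasurableSpace Ω} {d : ℕ} (Γ S : Ω → Matrix (Fin d) (Fin d) ℝ)
    (hΓ : Measurable Γ) (hS : ∀ ω, (S ω).PosSemidef ∧ S ω * S ω = Γ ω) : Measurable S := by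
  intro T hT
  have him : MeasurableSet ((fun M : Matrix (Fin d) (Fin d) ℝ => M * M) ''
      (T ∩ {M | M.PosSemidef})) := by
    refine (hT.inter (psd_closed d).measurableSet).image_of_continuousOn_injOn
      (Continuous.continuousOn (by fun_prop)) ?_
    rintro a ⟨_, ha⟩ b ⟨_, hb⟩ hab
    exact sq_inj a b ha hb hab
  convert hΓ him using 1
  ext ω
  simp only [Set.mem_preimage, Set.mem_image]
  constructor
  · intro h; exact ⟨S ω, ⟨h, (hS ω).1⟩, (hS ω).2⟩
  · rintro ⟨M, ⟨hM, hM'⟩, e⟩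
    rw [sq_inj (S ω) M (hS ω).1 hM' ((hS ω).2.trans e.symm)]; exact hM

theorem alpha_cont {d : ℕ} (j : ℕ) :
    Continuous fun p : Matrix (Fin d) (Fin d) ℝ × (Fin d → ℝ) => alpha p.1 p.2 j := by
  unfold alpha
  have : Continuous fun p : Matrix (Fin d) (Fin d) ℝ × (Fin d → ℝ) => (p.1 ^ j).mulVec p.2 :=
    Continuous.matrix_mulVec (by fun_prop) (by fun_prop)
  have h2 : Continuous fun p : Matrix (Fin d) (Fin d) ℝ × (Fin d → ℝ) =>
    p.2 ⬝ᵥ (p.1 ^ j).mulVec p.2 := Continuous.dotProduct (by fun_prop) this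
  have h3 : Continuous fun p : Matrix (Fin d) (Fin d) ℝ × (Fin d → ℝ) => (p.1 ^ j).trace :=
    Continuous.matrix_trace (by fun_prop)
  fun_prop

theorem C_cont {X : Type*} [TopologicalSpace X] (a : X → ℕ → ℝ) (ha : ∀ j, Continuous fun x => a x j)
    (k : ℕ) : Continuous fun x => C (a x) k := by
  match k with
  | 0 => simp only [C]; fun_prop
  | 1 => simp only [C]; fun_prop
  | 2 => simp only [C]; fun_prop
  | 3 => simp only [C]; fun_prop
  | 4 => simp only [C]; fun_prop
  | (n+5) => simp only [C]; fun_prop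

theorem main_abs {Ω : Type*} [MeasurableSpace Ω] (P : Measure Ω) [IsProbabilityMeasure P] {d : ℕ}
    (B : Ω → Matrix (Fin d) (Fin d) ℝ) (hB : Measurable B) (hsym : ∀ ω, (B ω).IsHermitian)
    (N : Ω → Fin d → ℝ) (hN : Measure.map N P = gaussLaw (1 : Matrix (Fin d) (Fin d) ℝ))
    (hInd : IndepFun N B P) (k : ℕ) (hk : k ≤ 4)
    (hIntg : Integrable (fun ω => C (fun j => Matrix.trace (B ω ^ (2 * j)) / 2) k) P) :
    ∫ ω, (C (alpha (B ω) (N ω)) k) ^ 2 ∂P =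
      ∫ ω, C (fun j => Matrix.trace (B ω ^ (2 * j)) / 2) k ∂P := by
  haveI := prob_gl (d := d)
  have hNm : AEMeasurable N P := by
    by_contra h
    rw [Measure.map_of_not_aemeasurable h] at hN
    have := measure_univ (μ := gaussLaw (1 : Matrix (Fin d) (Fin d) ℝ))
    rw [← hN] at this
    simp at this
  have hprod := (indepFun_iff_map_prod_eq_prod_map_map hB.aemeasurable hNm).1 hInd.symm
  rw [hN] at hprod
  haveI : IsProbabilityMeasure (Measure.map B P) := Measure.isProbabilityMeasure_map hB.aemeasurable
  obtain ⟨Φ, hΦ⟩ : ∃ Φ : Matrix (Fin d) (Fin d) ℝ × (Fin d → ℝ) → ℝ,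
    Φ = fun p => (C (alpha p.1 p.2) k) ^ 2 := ⟨_, rfl⟩
  have hΦ' : ∀ b n, Φ (b, n) = (C (alpha b n) k) ^ 2 := fun b n => by rw [hΦ]
  have hΦc : Continuous Φ := by
    rw [hΦ]; exact (C_cont _ (fun j => alpha_cont j) k).pow 2
  obtain ⟨ρ, hρ⟩ : ∃ ρ : Matrix (Fin d) (Fin d) ℝ → ℝ,
    ρ = fun b => C (fun j => Matrix.trace (b ^ (2 * j)) / 2) k := ⟨_, rfl⟩
  have hρ' : ∀ b, ρ b = C (fun j => Matrix.trace (b ^ (2 * j)) / 2) k := fun b => by rw [hρ]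
  have hρc : Continuous ρ := by
    rw [hρ]
    refine C_cont _ (fun j => ?_) k
    exact (Continuous.matrix_trace (by fun_prop)).div_const _
  have hae : ∀ᵐ b ∂(Measure.map B P), b.IsHermitian := by
    have hm : MeasurableSet {b : Matrix (Fin d) (Fin d) ℝ | b.IsHermitian} := by
      have : IsClosed {b : Matrix (Fin d) (Fin d) ℝ | b.IsHermitian} :=
        isClosed_eq (by fun_prop) (by fun_prop)
      exact this.measurableSet
    exact (ae_map_iff hB.aemeasurable hm).2 (Filter.Eventually.of_forall hsym)
  have hEB : ∀ b : Matrix (Fin d) (Fin d) ℝ, b.IsHermitian →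
      Integrable (fun n => Φ (b, n)) (gaussLaw 1) ∧ ∫ n, Φ (b, n) ∂(gaussLaw 1) = ρ b := by
    intro b hb
    simp only [hΦ', hρ']
    exact E_B b hb k hk
  have hρi : Integrable ρ (Measure.map B P) := by
    rw [integrable_map_measure hρc.aestronglyMeasurable hB.aemeasurable]
    have h : Integrable (fun ω => ρ (B ω)) P := by simpa only [hρ'] using hIntg
    exact h
  have hΦi : Integrable Φ ((Measure.map B P).prod (gaussLaw 1)) := by
    rw [integrable_prod_iff hΦc.aestronglyMeasurable]
    refine ⟨hae.mono fun b hb => (hEB b hb).1, hρi.congr (hae.mono fun b hb => ?_)⟩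
    rw [← (hEB b hb).2]
    refine integral_congr_ae (Filter.Eventually.of_forall fun n => ?_)
    simp only [hΦ', Real.norm_eq_abs, abs_pow, sq_abs]
  calc ∫ ω, (C (alpha (B ω) (N ω)) k) ^ 2 ∂P = ∫ ω, Φ (B ω, N ω) ∂P := by simp only [hΦ']
    _ = ∫ p, Φ p ∂(Measure.map (fun ω => (B ω, N ω)) P) :=
      (integral_map (hB.aemeasurable.prodMk hNm) hΦc.aestronglyMeasurable).symm
    _ = ∫ b, ∫ n, Φ (b, n) ∂(gaussLaw 1) ∂(Measure.map B P) := by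
      rw [hprod, integral_prod _ hΦi]
    _ = ∫ b, ρ b ∂(Measure.map B P) := integral_congr_ae (hae.mono fun b hb => (hEB b hb).2)
    _ = ∫ ω, ρ (B ω) ∂P := integral_map hB.aemeasurable hρc.aestronglyMeasurable
    _ = _ := by simp only [hρ']

theorem C_alpha_zero {d : ℕ} (n : Fin d → ℝ) (k : ℕ) (hk : 1 ≤ k) (hk' : k ≤ 4) :
    C (alpha (0 : Matrix (Fin d) (Fin d) ℝ) n) k = 0 := by
  interval_cases k <;> simp [C, alpha]

theorem B_meas {Ω : Type*} {m : MeasurableSpace Ω} {d : ℕ} (hd : 1 ≤ d)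
    (K : Matrix (Fin d) (Fin d) ℝ)
    (A : Ω → Matrix (Fin d) (Fin d) ℝ) (hA : Measurable A) (t : ℝ)
    (S : Ω → Matrix (Fin d) (Fin d) ℝ)
    (hS : ∀ ω, (S ω).PosSemidef ∧ S ω * S ω = Gam (A ω) K t) :
    MeasurableSet (EvSet A K) ∧ ∃ B : Ω → Matrix (Fin d) (Fin d) ℝ, Measurable B ∧
      (∀ ω ∈ EvSet A K, B ω = (S ω)⁻¹ * (A ω - K) * (S ω)⁻¹) ∧
      (∀ ω ∉ EvSet A K, B ω = 0) := by
  classical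
  have hE : MeasurableSet (EvSet A K) :=
    hA (ev_closed hd K (lambdaMin K / 2)).measurableSet
  have hΓ : Measurable fun ω => Gam (A ω) K t := by
    have : Continuous fun M : Matrix (Fin d) (Fin d) ℝ => Gam M K t := by unfold Gam; fun_prop
    exact this.measurable.comp hA
  have hSm : Measurable S := S_meas _ S hΓ hS
  have h1 : Measurable fun ω => (S ω)⁻¹ := (meas_inv d).comp hSm
  have h2 : Continuous fun p : Matrix (Fin d) (Fin d) ℝ × Matrix (Fin d) (Fin d) ℝ =>
    p.1 * (p.2 - K) * p.1 := by fun_prop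
  have h3 : Measurable fun ω => ((S ω)⁻¹, A ω) := h1.prodMk hA
  obtain ⟨f, hf⟩ : ∃ f : Matrix (Fin d) (Fin d) ℝ × Matrix (Fin d) (Fin d) ℝ →
    Matrix (Fin d) (Fin d) ℝ, f = fun p => p.1 * (p.2 - K) * p.1 := ⟨_, rfl⟩
  rw [← hf] at h2
  have h4 : Measurable fun ω => f ((S ω)⁻¹, A ω) := h2.measurable.comp h3
  have hf' : ∀ ω, f ((S ω)⁻¹, A ω) = (S ω)⁻¹ * (A ω - K) * (S ω)⁻¹ := fun ω => by rw [hf]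
  refine ⟨hE, fun ω => if ω ∈ EvSet A K then f ((S ω)⁻¹, A ω) else 0,
    Measurable.ite hE h4 measurable_const, fun ω hω => ?_, fun ω hω => ?_⟩
  · rw [← hf']; exact if_pos hω
  · exact if_neg hω

theorem assemble
    {d : ℕ} (hd : 1 ≤ d)
    {Ω : Type*} [mΩ : MeasurableSpace Ω] (P : Measure Ω) [IsProbabilityMeasure P]
    (K : Matrix (Fin d) (Fin d) ℝ) (hK : K.PosDef)
    (A : Ω → Matrix (Fin d) (Fin d) ℝ) (hA : ∀ ω, (A ω).PosSemidef)
    (hAmeas : Measurable fun ω i j => A ω i j)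
    (N : Ω → Fin d → ℝ) (hN : Measure.map N P = gaussLaw (1 : Matrix (Fin d) (Fin d) ℝ))
    (hInd : IndepFun N (fun ω i j => A ω i j) P)
    (t : ℝ) (ht : t ∈ Set.Icc (0 : ℝ) 1)
    (S : Ω → Matrix (Fin d) (Fin d) ℝ)
    (hS : ∀ ω, (S ω).PosSemidef ∧ S ω * S ω = Gam (A ω) K t) :
    ∃ T : ℕ → Ω → ℝ, (∀ j, Measurable (T j)) ∧ (∀ j ω, |T j ω| ≤ (d : ℝ)) ∧
      MeasurableSet (EvSet A K) ∧
      (∀ j, 1 ≤ j → ∀ ω ∉ EvSet A K, T j ω = 0) ∧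
      (∀ j, ∀ ω ∈ EvSet A K, Matrix.trace (((Gam (A ω) K t)⁻¹ * (A ω - K)) ^ (2 * j)) = T j ω) ∧
      ∀ k, 1 ≤ k → k ≤ 4 → Integrable (fun ω => C (fun j => T j ω / 2) k) P →
        ∫ ω in EvSet A K, hfun k (A ω) K t ((S ω).mulVec (N ω)) ^ 2 ∂P =
          (k.factorial : ℝ) ^ 2 * ∫ ω, C (fun j => T j ω / 2) k ∂P := by
  classical
  have hAm : Measurable A := hAmeas
  have hmle : MeasurableSpace.comap A inferInstance ≤ mΩ := hAm.comap_le
  obtain ⟨hE, B, hBm, hBE, hBE'⟩ := B_meas (m := MeasurableSpace.comap A inferInstance) hd K A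
    (comap_measurable A) t S hS
  have hBm' : Measurable B := hBm.mono hmle le_rfl
  have hgood : ∀ ω ∈ EvSet A K, Good (A ω) K (S ω) t := fun ω hω =>
    good hd (A ω) K (S ω) hK (hA ω) hω t ht (hS ω).1 (hS ω).2
  have hsym : ∀ ω, (B ω).IsHermitian := by
    intro ω
    by_cases hω : ω ∈ EvSet A K
    · rw [hBE ω hω]; exact (hgood ω hω).herm
    · rw [hBE' ω hω]; exact Matrix.isHermitian_zero
  have hInd' : IndepFun N B P := by
    rw [IndepFun_iff_Indep] at hInd ⊢
    exact indep_of_indep_of_le_right hInd hBm.comap_le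
  refine ⟨fun j ω => Matrix.trace (B ω ^ (2 * j)), ?_, ?_, hmle _ hE, ?_, ?_, ?_⟩
  · intro j
    have : Continuous fun M : Matrix (Fin d) (Fin d) ℝ => (M ^ (2 * j)).trace :=
      Continuous.matrix_trace (by fun_prop)
    exact this.measurable.comp hBm'
  · intro j ω
    by_cases hω : ω ∈ EvSet A K
    · simp only [hBE ω hω]; exact (hgood ω hω).bd _
    · simp only [hBE' ω hω]
      rcases Nat.eq_zero_or_pos j with rfl | hj
      · simp
      · rw [zero_pow (by omega)]; simp
  · intro j hj ω hω
    simp only [hBE' ω hω]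
    rw [zero_pow (by omega)]; simp
  · intro j ω hω
    simp only [hBE ω hω]; exact (hgood ω hω).tr _
  · intro k hk hk' hIntg
    have := main_abs P B hBm' hsym N hN hInd' k hk' hIntg
    rw [← this, ← integral_const_mul, ← integral_indicator (hmle _ hE)]
    refine integral_congr_ae (Filter.Eventually.of_forall fun ω => ?_)
    by_cases hω : ω ∈ EvSet A K
    · have g := hgood ω hω
      simp only [Set.indicator_of_mem hω, hBE ω hω]
      rw [hfun_eq (A ω) K (S ω) t hK g.u (hS ω).2 g.herm (N ω) k hk' g.T]
      ring
    · simp only [Set.indicator_of_notMem hω, hBE' ω hω, C_alpha_zero _ k hk hk']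
      simp

end MomH
end


/-- Lemma `mom_sec_h`, moments of `h₂`, `h₃`, `h₄`: second moments of
`h₂`, `h₃`, `h₄` evaluated at `F_t`, on the event `E`. -/
theorem statement_12
    {d : ℕ} (hd : 1 ≤ d)
    {Ω : Type*} [mΩ : MeasurableSpace Ω] (P : Measure Ω) [IsProbabilityMeasure P]
    (K : Matrix (Fin d) (Fin d) ℝ) (hK : K.PosDef)
    (A : Ω → Matrix (Fin d) (Fin d) ℝ) (hA : ∀ ω, (A ω).PosSemidef)
    (hAmeas : Measurable fun ω i j => A ω i j)
    (hA8 : Integrable (fun ω => hsNorm (A ω) ^ 8) P)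
    (N : Ω → Fin d → ℝ) (hN : Measure.map N P = gaussLaw (1 : Matrix (Fin d) (Fin d) ℝ))
    (hInd : IndepFun N (fun ω i j => A ω i j) P)
    (t : ℝ) (ht : t ∈ Set.Icc (0 : ℝ) 1)
    (S : Ω → Matrix (Fin d) (Fin d) ℝ)
    (hS : ∀ ω, (S ω).PosSemidef ∧ S ω * S ω = Gam (A ω) K t) :
    ((∫ ω in EvSet A K, hfun 2 (A ω) K t ((S ω).mulVec (N ω)) ^ 2 ∂P) =
      (∫ ω in EvSet A K,
        Matrix.trace (((Gam (A ω) K t)⁻¹ * (A ω - K)) ^ 4) ∂P)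
      + (1 / 2) * ∫ ω in EvSet A K,
          Matrix.trace (((Gam (A ω) K t)⁻¹ * (A ω - K)) ^ 2) ^ 2 ∂P) ∧
    ((∫ ω in EvSet A K, hfun 3 (A ω) K t ((S ω).mulVec (N ω)) ^ 2 ∂P) =
      (3 / 4) * (∫ ω in EvSet A K,
        Matrix.trace (((Gam (A ω) K t)⁻¹ * (A ω - K)) ^ 2) ^ 3 ∂P)
      + 6 * (∫ ω in EvSet A K,
          Matrix.trace (((Gam (A ω) K t)⁻¹ * (A ω - K)) ^ 6) ∂P)
      + (9 / 2) * ∫ ω in EvSet A K,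
          Matrix.trace (((Gam (A ω) K t)⁻¹ * (A ω - K)) ^ 2) *
            Matrix.trace (((Gam (A ω) K t)⁻¹ * (A ω - K)) ^ 4) ∂P) ∧
    ((∫ ω in EvSet A K, hfun 4 (A ω) K t ((S ω).mulVec (N ω)) ^ 2 ∂P) =
      (3 / 2) * (∫ ω in EvSet A K,
        Matrix.trace (((Gam (A ω) K t)⁻¹ * (A ω - K)) ^ 2) ^ 4 ∂P)
      + 18 * (∫ ω in EvSet A K,
          Matrix.trace (((Gam (A ω) K t)⁻¹ * (A ω - K)) ^ 2) ^ 2 *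
            Matrix.trace (((Gam (A ω) K t)⁻¹ * (A ω - K)) ^ 4) ∂P)
      + 18 * (∫ ω in EvSet A K,
          Matrix.trace (((Gam (A ω) K t)⁻¹ * (A ω - K)) ^ 4) ^ 2 ∂P)
      + 72 * (∫ ω in EvSet A K,
          Matrix.trace (((Gam (A ω) K t)⁻¹ * (A ω - K)) ^ 8) ∂P)
      + 48 * ∫ ω in EvSet A K,
          Matrix.trace (((Gam (A ω) K t)⁻¹ * (A ω - K)) ^ 2) *
            Matrix.trace (((Gam (A ω) K t)⁻¹ * (A ω - K)) ^ 6) ∂P) := by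
  obtain ⟨T, hTm, hTb, hE, hT0, hTE, hmain⟩ :=
    MomH.assemble hd P K hK A hA hAmeas N hN hInd t ht S hS
  have h1 : ∀ ω ∈ EvSet A K, Matrix.trace (((Gam (A ω) K t)⁻¹ * (A ω - K)) ^ 2) = T 1 ω := hTE 1
  have h2 : ∀ ω ∈ EvSet A K, Matrix.trace (((Gam (A ω) K t)⁻¹ * (A ω - K)) ^ 4) = T 2 ω := hTE 2
  have h3 : ∀ ω ∈ EvSet A K, Matrix.trace (((Gam (A ω) K t)⁻¹ * (A ω - K)) ^ 6) = T 3 ω := hTE 3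
  have h4 : ∀ ω ∈ EvSet A K, Matrix.trace (((Gam (A ω) K t)⁻¹ * (A ω - K)) ^ 8) = T 4 ω := hTE 4
  have hconv : ∀ f g : Ω → ℝ, (∀ ω ∈ EvSet A K, f ω = g ω) → (∀ ω ∉ EvSet A K, g ω = 0) →
      ∫ ω in EvSet A K, f ω ∂P = ∫ ω, g ω ∂P := by
    intro f g hf hg
    rw [setIntegral_congr_fun hE hf]
    exact setIntegral_eq_integral_of_forall_compl_eq_zero hg
  have z1 := hT0 1 le_rfl
  have z2 := hT0 2 (by norm_num)
  have z3 := hT0 3 (by norm_num)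
  have z4 := hT0 4 (by norm_num)
  have m1 := hTm 1
  have m2 := hTm 2
  have m3 := hTm 3
  have m4 := hTm 4
  have bT : ∀ j : ℕ, ∃ c, ∀ ω, |T j ω| ≤ c := fun j => ⟨d, hTb j⟩
  have bmul : ∀ f g : Ω → ℝ, (∃ c, ∀ ω, |f ω| ≤ c) → (∃ c, ∀ ω, |g ω| ≤ c) →
      ∃ c, ∀ ω, |f ω * g ω| ≤ c := by
    rintro f g ⟨c, hc⟩ ⟨e, he⟩
    refine ⟨c * e, fun ω => ?_⟩
    rw [abs_mul]
    exact mul_le_mul (hc ω) (he ω) (abs_nonneg _) ((abs_nonneg _).trans (hc ω))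
  have bpow : ∀ (f : Ω → ℝ) (n : ℕ), (∃ c, ∀ ω, |f ω| ≤ c) → ∃ c, ∀ ω, |f ω ^ n| ≤ c := by
    rintro f n ⟨c, hc⟩
    refine ⟨c ^ n, fun ω => ?_⟩
    rw [abs_pow]
    exact pow_le_pow_left₀ (abs_nonneg _) (hc ω) n
  have ib : ∀ f : Ω → ℝ, Measurable f → (∃ c, ∀ ω, |f ω| ≤ c) → Integrable f P := by
    rintro f hf ⟨c, hc⟩
    exact Integrable.of_bound hf.aestronglyMeasurable c (Filter.Eventually.of_forall hc)
  have i2 : Integrable (fun ω => T 2 ω) P := ib _ m2 (bT 2)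
  have i3 : Integrable (fun ω => T 3 ω) P := ib _ m3 (bT 3)
  have i4 : Integrable (fun ω => T 4 ω) P := ib _ m4 (bT 4)
  have i11 : Integrable (fun ω => T 1 ω ^ 2) P := ib _ (m1.pow_const 2) (bpow _ 2 (bT 1))
  have i111 : Integrable (fun ω => T 1 ω ^ 3) P := ib _ (m1.pow_const 3) (bpow _ 3 (bT 1))
  have i1111 : Integrable (fun ω => T 1 ω ^ 4) P := ib _ (m1.pow_const 4) (bpow _ 4 (bT 1))
  have i22 : Integrable (fun ω => T 2 ω ^ 2) P := ib _ (m2.pow_const 2) (bpow _ 2 (bT 2))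
  have i12 : Integrable (fun ω => T 1 ω * T 2 ω) P := ib _ (m1.mul m2) (bmul _ _ (bT 1) (bT 2))
  have i13 : Integrable (fun ω => T 1 ω * T 3 ω) P := ib _ (m1.mul m3) (bmul _ _ (bT 1) (bT 3))
  have i112 : Integrable (fun ω => T 1 ω ^ 2 * T 2 ω) P :=
    ib _ ((m1.pow_const 2).mul m2) (bmul _ _ (bpow _ 2 (bT 1)) (bT 2))
  refine ⟨?_, ?_, ?_⟩
  · have e : (fun ω => MomH.C (fun j => T j ω / 2) 2) =
        fun ω => 1 / 4 * T 2 ω + 1 / 8 * T 1 ω ^ 2 := by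
      funext ω; simp only [MomH.C]; ring
    have j1 := i2.const_mul (1 / 4)
    have j2 := i11.const_mul (1 / 8)
    have hi : Integrable (fun ω => MomH.C (fun j => T j ω / 2) 2) P := by
      rw [e]; exact j1.add j2
    rw [hmain 2 (by norm_num) (by norm_num) hi, e, integral_add j1 j2]
    simp only [integral_const_mul]
    rw [hconv _ (fun ω => T 2 ω) h2 z2,
      hconv _ (fun ω => T 1 ω ^ 2) (fun ω h => by simp only [h1 ω h]) (fun ω h => by simp [z1 ω h])]
    norm_num [Nat.factorial]
    ring
  · have e : (fun ω => MomH.C (fun j => T j ω / 2) 3) =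
        fun ω => 1 / 48 * T 1 ω ^ 3 + 1 / 6 * T 3 ω + 1 / 8 * (T 1 ω * T 2 ω) := by
      funext ω; simp only [MomH.C]; ring
    have j1 := i111.const_mul (1 / 48)
    have j2 := i3.const_mul (1 / 6)
    have j3 := i12.const_mul (1 / 8)
    have j12 : Integrable (fun ω => 1 / 48 * T 1 ω ^ 3 + 1 / 6 * T 3 ω) P := j1.add j2
    have hi : Integrable (fun ω => MomH.C (fun j => T j ω / 2) 3) P := by
      rw [e]; exact j12.add j3
    rw [hmain 3 (by norm_num) (by norm_num) hi, e, integral_add j12 j3, integral_add j1 j2]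
    simp only [integral_const_mul]
    rw [hconv _ (fun ω => T 1 ω ^ 3) (fun ω h => by simp only [h1 ω h]) (fun ω h => by simp [z1 ω h]),
      hconv _ (fun ω => T 3 ω) h3 z3,
      hconv _ (fun ω => T 1 ω * T 2 ω) (fun ω h => by simp only [h1 ω h, h2 ω h])
        (fun ω h => by simp [z1 ω h])]
    norm_num [Nat.factorial]
    ring
  · have e : (fun ω => MomH.C (fun j => T j ω / 2) 4) =
        fun ω => 1 / 384 * T 1 ω ^ 4 + 1 / 32 * (T 1 ω ^ 2 * T 2 ω) + 1 / 32 * T 2 ω ^ 2 +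
          1 / 8 * T 4 ω + 1 / 12 * (T 1 ω * T 3 ω) := by
      funext ω; simp only [MomH.C]; ring
    have j1 := i1111.const_mul (1 / 384)
    have j2 := i112.const_mul (1 / 32)
    have j3 := i22.const_mul (1 / 32)
    have j4 := i4.const_mul (1 / 8)
    have j5 := i13.const_mul (1 / 12)
    have j12 : Integrable (fun ω => 1 / 384 * T 1 ω ^ 4 + 1 / 32 * (T 1 ω ^ 2 * T 2 ω)) P :=
      j1.add j2
    have j123 : Integrable (fun ω => 1 / 384 * T 1 ω ^ 4 + 1 / 32 * (T 1 ω ^ 2 * T 2 ω) +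
      1 / 32 * T 2 ω ^ 2) P := j12.add j3
    have j1234 : Integrable (fun ω => 1 / 384 * T 1 ω ^ 4 + 1 / 32 * (T 1 ω ^ 2 * T 2 ω) +
      1 / 32 * T 2 ω ^ 2 + 1 / 8 * T 4 ω) P := j123.add j4
    have hi : Integrable (fun ω => MomH.C (fun j => T j ω / 2) 4) P := by
      rw [e]; exact j1234.add j5
    rw [hmain 4 (by norm_num) (by norm_num) hi, e, integral_add j1234 j5, integral_add j123 j4,
      integral_add j12 j3, integral_add j1 j2]
    simp only [integral_const_mul]
    rw [hconv _ (fun ω => T 1 ω ^ 4) (fun ω h => by simp only [h1 ω h]) (fun ω h => by simp [z1 ω h]),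
      hconv _ (fun ω => T 1 ω ^ 2 * T 2 ω) (fun ω h => by simp only [h1 ω h, h2 ω h])
        (fun ω h => by simp [z1 ω h]),
      hconv _ (fun ω => T 2 ω ^ 2) (fun ω h => by simp only [h2 ω h]) (fun ω h => by simp [z2 ω h]),
      hconv _ (fun ω => T 4 ω) h4 z4,
      hconv _ (fun ω => T 1 ω * T 3 ω) (fun ω h => by simp only [h1 ω h, h3 ω h])
        (fun ω h => by simp [z1 ω h])]
    norm_num [Nat.factorial]
    ring
end

section
/- Let G ~ N_d(0,K) be independent of A, assume E[‖A‖_HS^8] < ∞ and ℙ(E) > 0, and let η ∈ [0,1]. Then ℙ(E)·E[ (∂⁴g̃/∂t⁴)(A,η,G)·log(g̃(A,η,G)) ] ≤ (3√70/2)·E[ ‖Γ_η^{−1}(A−K)‖_HS^8·1_E ]^{1/2}·( (1/2)·max{ |log(2^d det K/(2‖K‖_op+λ(K))^d)|, log(2^d det K/λ(K)^d) } + (√d(√2+1)/4)·‖K^{−1}‖_HS·λ(K) ). -/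
open MeasureTheory ProbabilityTheory Matrix

open MeasureTheory ProbabilityTheory Matrix

/-- standard Gaussian density on the line -/
noncomputable def npdf (y : ℝ) : ℝ := (Real.sqrt (2 * Real.pi))⁻¹ * Real.exp (-(1/2) * y ^ 2)

lemma npdf_pos (y : ℝ) : 0 < npdf y := by
  unfold npdf; positivity

lemma continuous_npdf : Continuous npdf := by
  unfold npdf; fun_prop

lemma integrable_pow_npdf (n : ℕ) : Integrable (fun y : ℝ => y ^ n * npdf y) := by
  have h := integrable_rpow_mul_exp_neg_mul_sq (b := 1/2) (by norm_num) (s := (n:ℝ))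
    (by have : (0:ℝ) ≤ n := Nat.cast_nonneg n
        linarith)
  have h2 := h.const_mul (Real.sqrt (2 * Real.pi))⁻¹
  refine h2.congr (Filter.Eventually.of_forall fun y => ?_)
  simp only [Real.rpow_natCast, npdf]
  ring

lemma moment_npdf (n : ℕ) :
    ∫ y : ℝ, y ^ (2 * n) * npdf y = ((2 * n - 1).doubleFactorial : ℝ) := by
  have h1 : ∀ y : ℝ, y ^ (2 * n) * npdf y = |y| ^ (2 * n) * npdf |y| := by
    intro y
    simp [npdf, pow_mul]
  rw [integral_congr_ae (Filter.Eventually.of_forall h1)]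
  rw [integral_comp_abs (f := fun y => y ^ (2 * n) * npdf y)]
  have h2 : ∀ y : ℝ, y ^ (2 * n) * npdf y =
      (Real.sqrt (2 * Real.pi))⁻¹ * (y ^ ((2 * n : ℕ) : ℝ) * Real.exp (- (1/2) * y ^ (2:ℝ))) := by
    intro y
    have : y ^ (2:ℝ) = y ^ 2 := by exact_mod_cast Real.rpow_natCast y 2
    rw [this, Real.rpow_natCast, npdf]; ring
  simp_rw [h2]
  rw [integral_const_mul]
  have := integral_rpow_mul_exp_neg_mul_rpow (p := 2) (q := ((2 * n : ℕ) : ℝ)) (b := 1/2)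
    (by norm_num) (by have : (0:ℝ) ≤ ((2 * n : ℕ) : ℝ) := Nat.cast_nonneg _
                      linarith) (by norm_num)
  rw [this]
  have e1 : (((2 * n : ℕ) : ℝ) + 1) / 2 = (n : ℝ) + 1 / 2 := by push_cast; ring
  have e2 : -(((2 * n : ℕ) : ℝ) + 1) / 2 = -((n : ℝ) + 1 / 2) := by push_cast; ring
  rw [e1, e2, Real.Gamma_nat_add_half]
  rw [Real.rpow_neg (by norm_num), Real.rpow_add (by norm_num), Real.rpow_natCast,
    ← Real.sqrt_eq_rpow]
  rw [Real.sqrt_mul (by norm_num), Real.sqrt_div (by norm_num)]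
  have : Real.sqrt 2 ≠ 0 := by positivity
  have : Real.sqrt Real.pi ≠ 0 := by positivity
  simp only [Real.sqrt_one]
  field_simp
  rw [← mul_pow]
  norm_num

/-- coefficient table of the normalized even Hermite polynomials -/
noncomputable def qc : ℕ → ℕ → ℝ
  | 0, 0 => 1
  | 1, 0 => -1/2
  | 1, 1 => 1/2
  | 2, 0 => 3/8
  | 2, 1 => -6/8
  | 2, 2 => 1/8
  | 3, 0 => -15/48
  | 3, 1 => 45/48
  | 3, 2 => -15/48
  | 3, 3 => 1/48
  | 4, 0 => 105/384
  | 4, 1 => -420/384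
  | 4, 2 => 210/384
  | 4, 3 => -28/384
  | 4, 4 => 1/384
  | _, _ => 0

/-- normalized even Hermite polynomials `H_{2k}/(2^k k!)`, `k ≤ 4` -/
noncomputable def qp (k : ℕ) (y : ℝ) : ℝ := ∑ a ∈ Finset.range 5, qc k a * y ^ (2 * a)

/-- `∏_{j<k} (j+1/2)` -/
noncomputable def ap (k : ℕ) : ℝ := ∏ j ∈ Finset.range k, ((j : ℝ) + 1 / 2)

lemma qp_mul (j k : ℕ) (y : ℝ) : qp j y * qp k y * npdf y =
    ∑ a ∈ Finset.range 5, ∑ b ∈ Finset.range 5, qc j a * qc k b * (y ^ (2 * (a + b)) * npdf y) := by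
  unfold qp
  rw [Finset.sum_mul_sum, Finset.sum_mul]
  refine Finset.sum_congr rfl fun a _ => ?_
  rw [Finset.sum_mul]
  refine Finset.sum_congr rfl fun b _ => ?_
  ring

lemma integrable_qp_mul (j k : ℕ) : Integrable (fun y => qp j y * qp k y * npdf y) := by
  simp_rw [qp_mul]
  refine integrable_finsetSum _ fun a _ => integrable_finsetSum _ fun b _ => ?_
  exact (integrable_pow_npdf _).const_mul _

set_option maxHeartbeats 2000000 in
lemma integral_qp_mul (j k : ℕ) (hj : j < 5) (hk : k < 5) :
    ∫ y, qp j y * qp k y * npdf y = if j = k then ap k / (k.factorial : ℝ) else 0 := by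
  have : ∫ y, qp j y * qp k y * npdf y =
      ∑ a ∈ Finset.range 5, ∑ b ∈ Finset.range 5,
        qc j a * qc k b * ((2 * (a + b) - 1).doubleFactorial : ℝ) := by
    simp_rw [qp_mul]
    rw [integral_finsetSum _ fun a _ => integrable_finsetSum _ fun b _ =>
      (integrable_pow_npdf _).const_mul _]
    refine Finset.sum_congr rfl fun a _ => ?_
    rw [integral_finsetSum _ fun b _ => (integrable_pow_npdf _).const_mul _]
    refine Finset.sum_congr rfl fun b _ => ?_
    rw [integral_const_mul, moment_npdf]
  rw [this]
  interval_cases j <;> interval_cases k <;>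
    simp [Finset.sum_range_succ, qc, Nat.doubleFactorial, ap, Finset.prod_range_succ,
      Nat.factorial] <;> norm_num

lemma integral_npdf : ∫ y, npdf y = 1 := by
  have := moment_npdf 0
  simpa using this

lemma ap_pos (k : ℕ) : 0 < ap k := Finset.prod_pos fun j _ => by positivity

lemma ap_mul_le (j k : ℕ) : ap j * ap k ≤ ap (j + k) := by
  unfold ap
  rw [Finset.prod_range_add]
  refine mul_le_mul_of_nonneg_left ?_ (ap_pos j).le
  refine Finset.prod_le_prod (fun i _ => by positivity) fun i _ => ?_
  push_cast
  have : (0:ℝ) ≤ j := Nat.cast_nonneg j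
  linarith

lemma ap_prod_le {ι : Type*} (s : Finset ι) (k : ι → ℕ) :
    ∏ i ∈ s, ap (k i) ≤ ap (∑ i ∈ s, k i) := by
  classical
  induction s using Finset.induction_on with
  | empty => simp [ap]
  | insert i s hi ih =>
    rw [Finset.prod_insert hi, Finset.sum_insert hi]
    exact (mul_le_mul_of_nonneg_left ih (ap_pos _).le).trans (ap_mul_le _ _)

open MeasureTheory ProbabilityTheory Matrix

/-- chaos component of order `n` -/
noncomputable def chaosT {d : ℕ} (n : ℕ) (μ : Fin d → ℝ) (y : Fin d → ℝ) : ℝ :=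
  ∑ k ∈ Finset.piAntidiag (Finset.univ : Finset (Fin d)) n, ∏ i, (μ i ^ k i * qp (k i) (y i))

lemma chaosT_sq {d : ℕ} (n : ℕ) (μ : Fin d → ℝ) (y : Fin d → ℝ) :
    chaosT n μ y ^ 2 * ∏ i, npdf (y i) =
    ∑ k ∈ Finset.piAntidiag (Finset.univ : Finset (Fin d)) n,
      ∑ l ∈ Finset.piAntidiag (Finset.univ : Finset (Fin d)) n,
        ∏ i, (μ i ^ k i * μ i ^ l i * (qp (k i) (y i) * qp (l i) (y i) * npdf (y i))) := by
  unfold chaosT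
  rw [sq, Finset.sum_mul_sum, Finset.sum_mul]
  refine Finset.sum_congr rfl fun a _ => ?_
  rw [Finset.sum_mul]
  refine Finset.sum_congr rfl fun b _ => ?_
  rw [← Finset.prod_mul_distrib, ← Finset.prod_mul_distrib]
  refine Finset.prod_congr rfl fun i _ => ?_
  ring

lemma integrable_chaos_aux {d : ℕ} (μ : Fin d → ℝ) (k l : Fin d → ℕ) :
    Integrable (fun y : Fin d → ℝ =>
      ∏ i, (μ i ^ k i * μ i ^ l i * (qp (k i) (y i) * qp (l i) (y i) * npdf (y i)))) :=
  Integrable.fintype_prod (f := fun i y =>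
      (μ i ^ k i * μ i ^ l i * (qp (k i) y * qp (l i) y * npdf y)))
      fun i => (integrable_qp_mul _ _).const_mul _

lemma integrable_chaosT_sq {d : ℕ} (n : ℕ) (μ : Fin d → ℝ) :
    Integrable (fun y : Fin d → ℝ => chaosT n μ y ^ 2 * ∏ i, npdf (y i)) := by
  simp_rw [chaosT_sq]
  exact integrable_finsetSum _ fun k _ => integrable_finsetSum _ fun l _ =>
    integrable_chaos_aux μ k l

lemma integral_chaosT_sq_le {d : ℕ} (n : ℕ) (hn : n < 5) (μ : Fin d → ℝ) :
    ∫ y : Fin d → ℝ, chaosT n μ y ^ 2 * ∏ i, npdf (y i) ≤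
      ap n / (n.factorial : ℝ) * (∑ i, μ i ^ 2) ^ n := by
  simp_rw [chaosT_sq]
  rw [integral_finsetSum _ fun k _ => integrable_finsetSum _ fun l _ =>
    integrable_chaos_aux μ k l]
  rw [Finset.sum_pow_eq_sum_piAntidiag, Finset.mul_sum]
  refine Finset.sum_le_sum fun k hk => ?_
  rw [integral_finsetSum _ fun l _ => integrable_chaos_aux μ k l]
  have hk' : ∑ i, k i = n := (Finset.mem_piAntidiag.1 hk).1
  have hlt : ∀ l ∈ Finset.piAntidiag (Finset.univ : Finset (Fin d)) n, ∀ i, l i < 5 := by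
    intro l hl i
    have h : ∑ i, l i = n := (Finset.mem_piAntidiag.1 hl).1
    have : l i ≤ ∑ i, l i := Finset.single_le_sum (fun _ _ => Nat.zero_le _) (Finset.mem_univ i)
    omega
  have key : ∀ l ∈ Finset.piAntidiag (Finset.univ : Finset (Fin d)) n,
      ∫ y : Fin d → ℝ,
        ∏ i, (μ i ^ k i * μ i ^ l i * (qp (k i) (y i) * qp (l i) (y i) * npdf (y i))) =
      if k = l then ∏ i, (μ i ^ 2) ^ k i * (ap (k i) / ((k i).factorial : ℝ)) else 0 := by
    intro l hl
    rw [integral_fintype_prod_volume_eq_prod (fun i y =>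
      (μ i ^ k i * μ i ^ l i * (qp (k i) y * qp (l i) y * npdf y)))]
    simp_rw [integral_const_mul]
    split_ifs with h
    · subst h
      refine Finset.prod_congr rfl fun i _ => ?_
      rw [integral_qp_mul _ _ (hlt k hk i) (hlt k hk i), if_pos rfl]
      ring
    · obtain ⟨i, hi⟩ := Function.ne_iff.1 h
      refine Finset.prod_eq_zero (Finset.mem_univ i) ?_
      rw [integral_qp_mul _ _ (hlt k hk i) (hlt l hl i), if_neg hi, mul_zero]
  rw [Finset.sum_congr rfl key, Finset.sum_ite_eq, if_pos hk, Finset.prod_mul_distrib, mul_comm,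
    ← mul_assoc]
  refine mul_le_mul_of_nonneg_right ?_ (Finset.prod_nonneg fun i _ => by positivity)
  rw [Finset.prod_div_distrib]
  have hm := Nat.multinomial_spec (Finset.univ : Finset (Fin d)) k
  rw [hk'] at hm
  have hm' : (∏ i, ((k i).factorial : ℝ)) * (Nat.multinomial Finset.univ k : ℝ) = n.factorial := by
    exact_mod_cast hm
  have hpos : (0:ℝ) < ∏ i, ((k i).factorial : ℝ) :=
    Finset.prod_pos fun i _ => by exact_mod_cast Nat.factorial_pos _
  have hnp : (0:ℝ) < n.factorial := by exact_mod_cast Nat.factorial_pos _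
  have : (Nat.multinomial Finset.univ k : ℝ) = n.factorial / ∏ i, ((k i).factorial : ℝ) := by
    rw [eq_div_iff hpos.ne', mul_comm]; exact hm'
  rw [this]
  have h3 := ap_prod_le Finset.univ k
  rw [hk'] at h3
  rw [div_mul_div_comm, mul_comm (ap n), mul_div_mul_left _ _ hnp.ne']
  gcongr

/-- one-dimensional density ratio -/
noncomputable def Fone (y v : ℝ) : ℝ := (Real.sqrt (1 + v))⁻¹ * Real.exp (y ^ 2 * v / (2 * (1 + v)))

lemma hasDerivAt_Fone (y v : ℝ) (hv : 0 < 1 + v) :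
    HasDerivAt (Fone y) (Fone y v * (y ^ 2 / 2 * ((1 + v)⁻¹) ^ 2 - (1 + v)⁻¹ / 2)) v := by
  have h1 : HasDerivAt (fun v : ℝ => 1 + v) 1 v := by
    simpa using (hasDerivAt_id v).const_add 1
  have h2 := (h1.sqrt hv.ne').inv (Real.sqrt_pos.2 hv).ne'
  have h3 : HasDerivAt (fun v : ℝ => y ^ 2 * v / (2 * (1 + v)))
      ((y ^ 2 * 1 * (2 * (1 + v)) - y ^ 2 * v * (2 * 1)) / (2 * (1 + v)) ^ 2) v :=
    ((hasDerivAt_id v).const_mul (y ^ 2)).div (h1.const_mul 2) (by positivity)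
  have h4 := h2.mul h3.exp
  refine h4.congr_deriv ?_
  have hs : Real.sqrt (1 + v) ^ 2 = 1 + v := Real.sq_sqrt hv.le
  have hs0 : Real.sqrt (1 + v) ≠ 0 := (Real.sqrt_pos.2 hv).ne'
  simp only [Fone, Pi.inv_apply, Function.comp]
  rw [hs]
  field_simp
  ring

lemma contDiffAt_Fone (y v : ℝ) (hv : 0 < 1 + v) {n : WithTop ℕ∞} : ContDiffAt ℝ n (Fone y) v := by
  unfold Fone
  refine ContDiffAt.mul ?_ ?_
  · refine ContDiffAt.inv ?_ (Real.sqrt_pos.2 hv).ne'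
    exact ContDiffAt.sqrt (by fun_prop) hv.ne'
  · refine ContDiffAt.exp (ContDiffAt.div (by fun_prop) (by fun_prop) (by positivity))

lemma iteratedDeriv_eq_of_chain (F : ℕ → ℝ → ℝ) (U : Set ℝ) (hU : IsOpen U) (N : ℕ)
    (h : ∀ k < N, ∀ v ∈ U, HasDerivAt (F k) (F (k + 1) v) v) :
    ∀ k ≤ N, ∀ v ∈ U, iteratedDeriv k (F 0) v = F k v := by
  intro k
  induction k with
  | zero => intro _ v _; simp
  | succ k ih =>
    intro hk v hv
    rw [iteratedDeriv_succ]
    have : iteratedDeriv k (F 0) =ᶠ[nhds v] F k := by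
      filter_upwards [hU.mem_nhds hv] with w hw using ih (by omega) w hw
    rw [this.deriv_eq]
    exact (h k (by omega) v hv).deriv

/-- polynomial factors of the derivatives -/
noncomputable def Ppoly (a : ℝ) : ℕ → ℝ → ℝ
  | 0, _ => 1
  | 1, w => a / 2 * w ^ 2 - w / 2
  | 2, w => a ^ 2 / 4 * w ^ 4 - 6 * a / 4 * w ^ 3 + 3 / 4 * w ^ 2
  | 3, w => a ^ 3 / 8 * w ^ 6 - 15 * a ^ 2 / 8 * w ^ 5 + 45 * a / 8 * w ^ 4 - 15 / 8 * w ^ 3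
  | 4, w => a ^ 4 / 16 * w ^ 8 - 28 * a ^ 3 / 16 * w ^ 7 + 210 * a ^ 2 / 16 * w ^ 6
      - 420 * a / 16 * w ^ 5 + 105 / 16 * w ^ 4
  | _, _ => 0

/-- derivatives of the polynomial factors -/
noncomputable def Ppoly' (a : ℝ) : ℕ → ℝ → ℝ
  | 1, w => a * w - 1 / 2
  | 2, w => a ^ 2 * w ^ 3 - 18 * a / 4 * w ^ 2 + 3 / 2 * w
  | 3, w => 6 * a ^ 3 / 8 * w ^ 5 - 75 * a ^ 2 / 8 * w ^ 4 + 180 * a / 8 * w ^ 3 - 45 / 8 * w ^ 2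
  | _, _ => 0

lemma hasDerivAt_Ppoly (a w : ℝ) (k : ℕ) (hk : k < 4) :
    HasDerivAt (Ppoly a k) (Ppoly' a k w) w := by
  have hp : ∀ n : ℕ, HasDerivAt (fun w : ℝ => w ^ n) (n * w ^ (n - 1)) w := fun n =>
    hasDerivAt_pow n w
  interval_cases k
  · exact hasDerivAt_const w (1:ℝ)
  · refine (((hp 2).const_mul (a / 2)).sub ((hasDerivAt_id w).div_const 2)).congr_deriv ?_
    simp only [Ppoly']; norm_num; ring
  · refine ((((hp 4).const_mul (a ^ 2 / 4)).sub ((hp 3).const_mul (6 * a / 4))).add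
      ((hp 2).const_mul (3 / 4))).congr_deriv ?_
    simp only [Ppoly']; norm_num; ring
  · refine (((((hp 6).const_mul (a ^ 3 / 8)).sub ((hp 5).const_mul (15 * a ^ 2 / 8))).add
      ((hp 4).const_mul (45 * a / 8))).sub ((hp 3).const_mul (15 / 8))).congr_deriv ?_
    simp only [Ppoly']; norm_num; ring

lemma iteratedDeriv_Fone (y μ : ℝ) (k : ℕ) (hk : k < 5) :
    iteratedDeriv k (fun u => Fone y (μ * u)) 0 = μ ^ k * ((k.factorial : ℝ) * qp k y) := by
  have hch := iteratedDeriv_eq_of_chain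
    (fun k u => μ ^ k * (Fone y (μ * u) * Ppoly (y ^ 2) k (1 + μ * u)⁻¹))
    {v | 0 < 1 + μ * v} (isOpen_lt (by fun_prop) (by fun_prop)) 4 (by
      intro k hk v hv
      have hv' : 0 < 1 + μ * v := hv
      have h0 : HasDerivAt (fun v : ℝ => μ * v) μ v := by
        simpa using (hasDerivAt_id v).const_mul μ
      have h1 : HasDerivAt (fun v : ℝ => 1 + μ * v) μ v := by
        simpa using h0.const_add 1
      have h2 := (hasDerivAt_Ppoly (y ^ 2) (1 + μ * v)⁻¹ k hk).comp v (h1.inv hv'.ne')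
      have h3 := (hasDerivAt_Fone y (μ * v) hv').comp v h0
      refine ((h3.mul h2).const_mul (μ ^ k)).congr_deriv ?_
      have e : -μ / (1 + μ * v) ^ 2 = - μ * ((1 + μ * v)⁻¹) ^ 2 := by rw [inv_pow]; field_simp
      simp only [Function.comp, Pi.inv_apply]
      rw [e]
      generalize (1 + μ * v)⁻¹ = w
      interval_cases k <;> simp only [Ppoly, Ppoly'] <;> ring) k (by omega) 0 (by simp)
  have e0 : (fun u => μ ^ 0 * (Fone y (μ * u) * Ppoly (y ^ 2) 0 (1 + μ * u)⁻¹)) =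
      fun u => Fone y (μ * u) := by
    funext v; simp [Ppoly]
  simp only [e0] at hch
  rw [hch]
  congr 1
  interval_cases k <;> simp [Fone, Ppoly, qp, qc, Finset.sum_range_succ, Nat.factorial] <;> ring

lemma iteratedDeriv_prod_aux {ι : Type*} [DecidableEq ι] (s : Finset ι) (f : ι → ℝ → ℝ) (x : ℝ)
    (hf : ∀ i ∈ s, ContDiffAt ℝ ⊤ (f i) x) :
    ∀ n : ℕ, iteratedDeriv n (fun v => ∏ i ∈ s, f i v) x / (n.factorial : ℝ) =
      ∑ k ∈ s.piAntidiag n, ∏ i ∈ s, (iteratedDeriv (k i) (f i) x / ((k i).factorial : ℝ)) := by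
  have key : ∀ n : ℕ, iteratedDeriv n (fun v => ∏ i ∈ s, f i v) x / (n.factorial : ℝ) =
      PowerSeries.coeff n (∏ i ∈ s, PowerSeries.mk
        fun m => iteratedDeriv m (f i) x / (m.factorial : ℝ)) := by
    induction s using Finset.induction_on with
    | empty =>
      intro n
      cases n with
      | zero => simp
      | succ n => simp [PowerSeries.coeff_one, iteratedDeriv_const]
    | insert i s hi ih =>
      intro n
      have ih' := ih fun j hj => hf j (Finset.mem_insert_of_mem hj)
      simp_rw [Finset.prod_insert hi]
      rw [PowerSeries.coeff_mul]
      have h1 : ContDiffAt ℝ n (f i) x :=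
        (hf i (Finset.mem_insert_self _ _)).of_le le_top
      have h2 : ContDiffAt ℝ n (fun v => ∏ i ∈ s, f i v) x :=
        contDiffAt_prod fun j hj => (hf j (Finset.mem_insert_of_mem hj)).of_le le_top
      have := iteratedDeriv_mul h1 h2
      have e : (fun v => f i v * ∏ i ∈ s, f i v) = f i * (fun v => ∏ i ∈ s, f i v) := rfl
      rw [e, this, Finset.Nat.sum_antidiagonal_eq_sum_range_succ_mk, Finset.sum_div]
      refine Finset.sum_congr rfl fun m hm => ?_
      rw [← ih', PowerSeries.coeff_mk]
      have hm' : m ≤ n := by simpa [Nat.lt_succ_iff] using hm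
      rw [Nat.cast_choose ℝ hm']
      have a1 : (n.factorial : ℝ) ≠ 0 := by positivity
      field_simp
  intro n
  rw [key, PowerSeries.coeff_prod]
  simp only [PowerSeries.coeff_mk]
  refine Finset.sum_bij (fun f _ => ⇑f) ?_ ?_ ?_ ?_
  · intro f hf'
    rw [Finset.mem_finsuppAntidiag] at hf'
    rw [Finset.mem_piAntidiag]
    exact ⟨hf'.1, fun i hi => hf'.2 (Finsupp.mem_support_iff.2 hi)⟩
  · intro f _ g _ h
    exact DFunLike.coe_injective h
  · intro g hg
    rw [Finset.mem_piAntidiag] at hg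
    refine ⟨Finsupp.onFinset s g hg.2, ?_, rfl⟩
    rw [Finset.mem_finsuppAntidiag]
    exact ⟨hg.1, Finsupp.support_onFinset_subset⟩
  · intro f _
    rfl

lemma iteratedDeriv_four_prod {d : ℕ} (μ y : Fin d → ℝ) :
    iteratedDeriv 4 (fun u => ∏ i, Fone (y i) (μ i * u)) 0 = 24 * chaosT 4 μ y := by
  have h := iteratedDeriv_prod_aux (Finset.univ : Finset (Fin d))
    (fun i u => Fone (y i) (μ i * u)) 0 (by
      intro i _
      have : ContDiffAt ℝ ⊤ (Fone (y i)) (μ i * 0) := contDiffAt_Fone _ _ (by simp)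
      exact this.comp (0:ℝ) (by fun_prop)) 4
  have h4 : ((Nat.factorial 4 : ℕ) : ℝ) = 24 := by norm_num [Nat.factorial]
  rw [h4, div_eq_iff (by norm_num), mul_comm] at h
  rw [h]
  congr 1
  refine Finset.sum_congr rfl fun k hk => Finset.prod_congr rfl fun i _ => ?_
  have hk' : ∑ i, k i = 4 := (Finset.mem_piAntidiag.1 hk).1
  have : k i ≤ ∑ i, k i := Finset.single_le_sum (fun _ _ => Nat.zero_le _) (Finset.mem_univ i)
  rw [iteratedDeriv_Fone _ _ _ (by omega)]
  have : ((k i).factorial : ℝ) ≠ 0 := by positivity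
  field_simp

open MeasureTheory ProbabilityTheory Matrix

lemma spectral_real {d : ℕ} (M : Matrix (Fin d) (Fin d) ℝ) (hM : M.IsHermitian) :
    ∃ U : Matrix (Fin d) (Fin d) ℝ, U * Uᵀ = 1 ∧ M = U * diagonal hM.eigenvalues * Uᵀ := by
  refine ⟨(hM.eigenvectorUnitary : Matrix (Fin d) (Fin d) ℝ), ?_, ?_⟩
  · have := Unitary.mul_star_self_of_mem hM.eigenvectorUnitary.2
    rwa [star_eq_conjTranspose, conjTranspose_eq_transpose_of_trivial] at this
  · have := hM.spectral_theorem
    rw [Unitary.conjStarAlgAut_apply, star_eq_conjTranspose,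
      conjTranspose_eq_transpose_of_trivial] at this
    exact this

lemma sim_diag {d : ℕ} (Γ B : Matrix (Fin d) (Fin d) ℝ) (hΓ : Γ.PosDef) (hB : Bᵀ = B) :
    ∃ (Q : Matrix (Fin d) (Fin d) ℝ) (μ : Fin d → ℝ),
      Q.det ≠ 0 ∧ Γ = Q * Qᵀ ∧ B = Q * diagonal μ * Qᵀ := by
  obtain ⟨U, hU, hUΓ⟩ := spectral_real Γ hΓ.1
  set l := hΓ.1.eigenvalues with hl
  have hlpos : ∀ i, 0 < l i := hΓ.eigenvalues_pos
  set C := U * diagonal (fun i => Real.sqrt (l i)) with hC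
  have hUd : U.det ≠ 0 := by
    intro h
    have := congrArg det hU
    simp [h] at this
  have hCd : C.det ≠ 0 := by
    rw [hC, det_mul, det_diagonal]
    exact mul_ne_zero hUd (Finset.prod_ne_zero_iff.2 fun i _ => (Real.sqrt_pos.2 (hlpos i)).ne')
  have hCu : IsUnit C.det := isUnit_iff_ne_zero.2 hCd
  have hCu' : IsUnit Cᵀ.det := by rwa [det_transpose]
  have hCC : C * Cᵀ = Γ := by
    rw [hC, transpose_mul, diagonal_transpose, Matrix.mul_assoc, ← Matrix.mul_assoc (diagonal _),
      diagonal_mul_diagonal, hUΓ, Matrix.mul_assoc]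
    congr 3
    funext i
    exact Real.mul_self_sqrt (hlpos i).le
  clear_value C
  have hM : (C⁻¹ * B * (Cᵀ)⁻¹).IsHermitian := by
    rw [IsHermitian, conjTranspose_eq_transpose_of_trivial, transpose_mul, transpose_mul,
      transpose_nonsing_inv, transpose_nonsing_inv, transpose_transpose, hB, Matrix.mul_assoc]
  obtain ⟨W, hW, hWM⟩ := spectral_real _ hM
  generalize hM.eigenvalues = ev at hWM
  refine ⟨C * W, ev, ?_, ?_, ?_⟩
  · rw [det_mul]
    refine mul_ne_zero hCd ?_
    intro h
    have := congrArg det hW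
    simp [h] at this
  · rw [transpose_mul, Matrix.mul_assoc, ← Matrix.mul_assoc W, hW, Matrix.one_mul, hCC]
  · have : C * W * diagonal ev * (C * W)ᵀ =
        C * (W * diagonal ev * Wᵀ) * Cᵀ := by
      rw [transpose_mul]; simp only [Matrix.mul_assoc]
    rw [this, ← hWM]
    simp only [Matrix.mul_assoc]
    rw [nonsing_inv_mul _ hCu', Matrix.mul_one, ← Matrix.mul_assoc, mul_nonsing_inv _ hCu,
      Matrix.one_mul]

lemma gaussDensity_diag {d : ℕ} (Q : Matrix (Fin d) (Fin d) ℝ) (hQ : Q.det ≠ 0)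
    (ν : Fin d → ℝ) (hν : ∀ i, 0 < ν i) (y : Fin d → ℝ) :
    gaussDensity (Q * diagonal ν * Qᵀ) (Q *ᵥ y) =
      |Q.det|⁻¹ * ∏ i, ((Real.sqrt (2 * Real.pi))⁻¹ * ((Real.sqrt (ν i))⁻¹ *
        Real.exp (-(1/2) * (y i ^ 2 / ν i)))) := by
  have hQu : IsUnit Q.det := isUnit_iff_ne_zero.2 hQ
  have hQu' : IsUnit Qᵀ.det := by rwa [det_transpose]
  have hinv : (Q * diagonal ν * Qᵀ)⁻¹ = (Qᵀ)⁻¹ * diagonal (fun i => (ν i)⁻¹) * Q⁻¹ := by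
    refine inv_eq_right_inv ?_
    have e : diagonal ν * diagonal (fun i => (ν i)⁻¹) = (1 : Matrix (Fin d) (Fin d) ℝ) := by
      rw [diagonal_mul_diagonal, ← diagonal_one]
      congr 1; funext i; exact mul_inv_cancel₀ (hν i).ne'
    calc Q * diagonal ν * Qᵀ * ((Qᵀ)⁻¹ * diagonal (fun i => (ν i)⁻¹) * Q⁻¹)
        = Q * diagonal ν * (Qᵀ * (Qᵀ)⁻¹) * diagonal (fun i => (ν i)⁻¹) * Q⁻¹ := by
          simp only [Matrix.mul_assoc]
      _ = Q * (diagonal ν * diagonal (fun i => (ν i)⁻¹)) * Q⁻¹ := by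
          rw [mul_nonsing_inv _ hQu', Matrix.mul_one]; simp only [Matrix.mul_assoc]
      _ = 1 := by rw [e, Matrix.mul_one, mul_nonsing_inv _ hQu]
  have hq : (Q *ᵥ y) ⬝ᵥ (Q * diagonal ν * Qᵀ)⁻¹ *ᵥ (Q *ᵥ y) = ∑ i, y i ^ 2 / ν i := by
    rw [hinv, mulVec_mulVec, Matrix.mul_assoc, nonsing_inv_mul _ hQu, Matrix.mul_one,
      ← mulVec_mulVec, dotProduct_mulVec, ← mulVec_transpose, transpose_nonsing_inv,
      transpose_transpose, mulVec_mulVec, nonsing_inv_mul _ hQu, one_mulVec]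
    simp only [dotProduct, mulVec_diagonal]
    refine Finset.sum_congr rfl fun i _ => ?_
    rw [div_eq_mul_inv]; ring
  have hdet : Real.sqrt ((2 * Real.pi) ^ d * (Q * diagonal ν * Qᵀ).det) =
      |Q.det| * ∏ i, (Real.sqrt (2 * Real.pi) * Real.sqrt (ν i)) := by
    rw [det_mul, det_mul, det_transpose, det_diagonal]
    have e : (2 * Real.pi) ^ d * (Q.det * (∏ i, ν i) * Q.det) =
      (|Q.det| * ∏ i, (Real.sqrt (2 * Real.pi) * Real.sqrt (ν i))) ^ 2 := by
      rw [mul_pow |Q.det|, sq_abs, ← Finset.prod_pow]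
      have : ∀ i, (Real.sqrt (2 * Real.pi) * Real.sqrt (ν i)) ^ 2 = (2 * Real.pi) * ν i := by
        intro i
        rw [mul_pow, Real.sq_sqrt (by positivity), Real.sq_sqrt (hν i).le]
      simp_rw [this]
      rw [Finset.prod_mul_distrib]
      simp
      ring
    rw [e, Real.sqrt_sq]
    exact mul_nonneg (abs_nonneg _) (Finset.prod_nonneg fun i _ => by positivity)
  unfold gaussDensity
  rw [hq, hdet, Finset.mul_sum, Real.exp_sum, mul_inv, mul_assoc, ← Finset.prod_inv_distrib,
    ← Finset.prod_mul_distrib]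
  congr 1
  refine Finset.prod_congr rfl fun i _ => ?_
  rw [mul_inv, mul_assoc]

lemma lintegral_comp_Q {d : ℕ} (Q : Matrix (Fin d) (Fin d) ℝ) (hQ : Q.det ≠ 0)
    (f : (Fin d → ℝ) → ENNReal) :
    ∫⁻ x, f x = ENNReal.ofReal |Q.det| * ∫⁻ y, f (Q *ᵥ y) := by
  have hinj : Function.Injective (Matrix.toLin' Q) := by
    have : Function.Injective Q.mulVec :=
      Matrix.mulVec_injective_iff_isUnit.2 ((Matrix.isUnit_iff_isUnit_det Q).2
        (isUnit_iff_ne_zero.2 hQ))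
    exact this
  have hemb : MeasurableEmbedding (Matrix.toLin' Q) :=
    (LinearMap.isClosedEmbedding_of_injective (LinearMap.ker_eq_bot.2 hinj)).measurableEmbedding
  have h := hemb.lintegral_map (μ := volume) f
  rw [Real.map_matrix_volume_pi_eq_smul_volume_pi hQ, lintegral_smul_measure] at h
  simp only [toLin'_apply] at h
  rw [← h, smul_eq_mul, ← mul_assoc, ← ENNReal.ofReal_mul (abs_nonneg _), abs_inv,
    mul_inv_cancel₀ (abs_ne_zero.2 hQ)]
  simp

lemma gaussDensity_Q {d : ℕ} (Q : Matrix (Fin d) (Fin d) ℝ) (hQ : Q.det ≠ 0) (y : Fin d → ℝ) :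
    gaussDensity (Q * Qᵀ) (Q *ᵥ y) = |Q.det|⁻¹ * ∏ i, npdf (y i) := by
  have := gaussDensity_diag Q hQ (fun _ => 1) (fun _ => one_pos) y
  simpa [npdf] using this

lemma gaussDensity_ratio {d : ℕ} (Q : Matrix (Fin d) (Fin d) ℝ) (hQ : Q.det ≠ 0)
    (v : Fin d → ℝ) (hv : ∀ i, 0 < 1 + v i) (y : Fin d → ℝ) :
    gaussDensity (Q * diagonal (fun i => 1 + v i) * Qᵀ) (Q *ᵥ y) =
      gaussDensity (Q * Qᵀ) (Q *ᵥ y) * ∏ i, Fone (y i) (v i) := by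
  rw [gaussDensity_diag Q hQ _ hv, gaussDensity_Q Q hQ, mul_assoc, ← Finset.prod_mul_distrib]
  congr 1
  refine Finset.prod_congr rfl fun i _ => ?_
  have e : -(1/2) * (y i ^ 2 / (1 + v i)) =
      -(1/2) * y i ^ 2 + y i ^ 2 * v i / (2 * (1 + v i)) := by
    have := (hv i).ne'
    field_simp
    ring
  rw [e, Real.exp_add, npdf, Fone]
  ring

/-- Key bound A. -/
lemma keyA {d : ℕ} (Γ B : Matrix (Fin d) (Fin d) ℝ) (hΓ : Γ.PosDef) (hB : Bᵀ = B) :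
    ∫⁻ x, ENNReal.ofReal
      ((iteratedDeriv 4 (fun u : ℝ => gaussDensity (Γ + u • B) x) 0) ^ 2 / gaussDensity Γ x) ≤
    ENNReal.ofReal (315 / 2 * hsNorm (Γ⁻¹ * B) ^ 8) := by
  obtain ⟨Q, μ, hQ, hΓQ, hBQ⟩ := sim_diag Γ B hΓ hB
  have hD : 0 < |Q.det| := abs_pos.2 hQ
  have hu : ∀ u : ℝ, Γ + u • B = Q * diagonal (fun i => 1 + μ i * u) * Qᵀ := by
    intro u
    have : diagonal (fun i => 1 + μ i * u) = (1 : Matrix (Fin d) (Fin d) ℝ) + u • diagonal μ := by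
      rw [← diagonal_one, ← diagonal_smul, diagonal_add]
      congr 1; funext i; simp [mul_comm]
    rw [this, Matrix.mul_add, Matrix.add_mul, Matrix.mul_one, ← hΓQ, hBQ]
    simp
  have hder : ∀ y, iteratedDeriv 4 (fun u : ℝ => gaussDensity (Γ + u • B) (Q *ᵥ y)) 0 =
      gaussDensity Γ (Q *ᵥ y) * (24 * chaosT 4 μ y) := by
    intro y
    have hev : (fun u : ℝ => gaussDensity (Γ + u • B) (Q *ᵥ y)) =ᶠ[nhds 0]
        fun u => gaussDensity Γ (Q *ᵥ y) * ∏ i, Fone (y i) (μ i * u) := by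
      have : ∀ᶠ u : ℝ in nhds 0, ∀ i, 0 < 1 + μ i * u := by
        rw [Filter.eventually_all]
        intro i
        have hc : ContinuousAt (fun u : ℝ => 1 + μ i * u) 0 := by fun_prop
        exact hc.eventually (lt_mem_nhds (by simp))
      filter_upwards [this] with u hu'
      rw [hu u, gaussDensity_ratio Q hQ _ hu', ← hΓQ]
    rw [hev.iteratedDeriv_eq, iteratedDeriv_const_mul_field, iteratedDeriv_four_prod]
  rw [lintegral_comp_Q Q hQ]
  have hintg : ∀ y, ENNReal.ofReal
      ((iteratedDeriv 4 (fun u : ℝ => gaussDensity (Γ + u • B) (Q *ᵥ y)) 0) ^ 2 /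
        gaussDensity Γ (Q *ᵥ y)) =
      ENNReal.ofReal |Q.det|⁻¹ * ENNReal.ofReal (576 * (chaosT 4 μ y ^ 2 * ∏ i, npdf (y i))) := by
    intro y
    rw [hder, ← ENNReal.ofReal_mul (by positivity)]
    have hg : gaussDensity Γ (Q *ᵥ y) = |Q.det|⁻¹ * ∏ i, npdf (y i) := by
      rw [hΓQ, gaussDensity_Q Q hQ]
    have hp : 0 < ∏ i, npdf (y i) := Finset.prod_pos fun i _ => npdf_pos _
    rw [hg]
    congr 1
    field_simp
    ring
  simp_rw [hintg]
  rw [lintegral_const_mul' _ _ ENNReal.ofReal_ne_top, ← mul_assoc,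
    ← ENNReal.ofReal_mul (abs_nonneg _), mul_inv_cancel₀ hD.ne', ENNReal.ofReal_one, one_mul,
    ← ofReal_integral_eq_lintegral_ofReal ((integrable_chaosT_sq 4 μ).const_mul 576)
      (Filter.Eventually.of_forall fun y => mul_nonneg (by norm_num)
        (mul_nonneg (sq_nonneg _) (Finset.prod_nonneg fun i _ => (npdf_pos _).le)))]
  refine ENNReal.ofReal_le_ofReal ?_
  rw [integral_const_mul]
  have h1 := integral_chaosT_sq_le 4 (by norm_num) μ
  have hap : ap 4 / ((Nat.factorial 4 : ℕ) : ℝ) = 35 / 128 := by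
    simp [ap, Finset.prod_range_succ, Nat.factorial]; norm_num
  rw [hap] at h1
  have hs : ∑ i, μ i ^ 2 ≤ hsNorm (Γ⁻¹ * B) ^ 2 := by
    have hQu : IsUnit Q.det := isUnit_iff_ne_zero.2 hQ
    have hN : Γ⁻¹ * B = (Qᵀ)⁻¹ * diagonal μ * Qᵀ := by
      rw [hΓQ, hBQ, Matrix.mul_inv_rev]
      calc (Qᵀ)⁻¹ * Q⁻¹ * (Q * diagonal μ * Qᵀ) = (Qᵀ)⁻¹ * (Q⁻¹ * Q) * diagonal μ * Qᵀ := by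
            simp only [Matrix.mul_assoc]
        _ = _ := by rw [nonsing_inv_mul _ hQu, Matrix.mul_one]
    have hQu' : IsUnit Qᵀ.det := by rwa [det_transpose]
    have htr : ((Γ⁻¹ * B) * (Γ⁻¹ * B)).trace = ∑ i, μ i ^ 2 := by
      have : (Γ⁻¹ * B) * (Γ⁻¹ * B) = (Qᵀ)⁻¹ * (diagonal μ * diagonal μ * Qᵀ) := by
        rw [hN]
        calc (Qᵀ)⁻¹ * diagonal μ * Qᵀ * ((Qᵀ)⁻¹ * diagonal μ * Qᵀ) =
          (Qᵀ)⁻¹ * diagonal μ * (Qᵀ * (Qᵀ)⁻¹) * diagonal μ * Qᵀ := by simp only [Matrix.mul_assoc]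
          _ = _ := by rw [mul_nonsing_inv _ hQu', Matrix.mul_one]; simp only [Matrix.mul_assoc]
      rw [this, trace_mul_comm, Matrix.mul_assoc, mul_nonsing_inv _ hQu', Matrix.mul_one,
        diagonal_mul_diagonal, trace_diagonal]
      refine Finset.sum_congr rfl fun i _ => by ring
    rw [← htr]
    generalize Γ⁻¹ * B = N
    have hq : hsNorm N ^ 2 = ∑ i, ∑ j, N i j ^ 2 :=
      Real.sq_sqrt (Finset.sum_nonneg fun i _ => Finset.sum_nonneg fun j _ => sq_nonneg _)
    rw [hq]
    simp only [trace, diag_apply, mul_apply]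
    have hsw : ∑ i, ∑ j, N j i ^ 2 = ∑ i, ∑ j, N i j ^ 2 := Finset.sum_comm
    have h2 : ∑ i, ∑ j, N i j * N j i ≤ ∑ i, ∑ j, (N i j ^ 2 / 2 + N j i ^ 2 / 2) :=
      Finset.sum_le_sum fun i _ => Finset.sum_le_sum fun j _ => by
        nlinarith [sq_nonneg (N i j - N j i)]
    simp only [Finset.sum_add_distrib, ← Finset.sum_div] at h2
    linarith
  have hs4 : (∑ i, μ i ^ 2) ^ 4 ≤ hsNorm (Γ⁻¹ * B) ^ 8 := by
    have := pow_le_pow_left₀ (Finset.sum_nonneg fun i _ => sq_nonneg (μ i)) hs 4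
    rw [← pow_mul] at this
    exact this
  linarith

open MeasureTheory ProbabilityTheory Matrix

lemma qp_one_aux (y : ℝ) : qp 1 y = (y ^ 2 - 1) / 2 := by
  simp [qp, Finset.sum_range_succ, qc]; ring

lemma qp_zero_aux (y : ℝ) : qp 0 y = 1 := by
  simp [qp, Finset.sum_range_succ, qc]

lemma chaosT_one {d : ℕ} (μ y : Fin d → ℝ) :
    chaosT 1 μ y = ∑ i, μ i * ((y i ^ 2 - 1) / 2) := by
  unfold chaosT
  symm
  refine Finset.sum_bij (fun i _ => Pi.single i 1) ?_ ?_ ?_ ?_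
  · intro i _
    rw [Finset.mem_piAntidiag]
    exact ⟨by simp, fun _ _ => Finset.mem_univ _⟩
  · intro i _ j _ h
    by_contra hij
    have := congrFun h i
    simp [hij] at this
  · intro f hf
    have hf1 := (Finset.mem_piAntidiag.1 hf).1
    obtain ⟨i, hi⟩ : ∃ i, f i ≠ 0 := by
      by_contra! h
      simp [h] at hf1
    refine ⟨i, Finset.mem_univ _, ?_⟩
    rw [← Finset.add_sum_erase _ _ (Finset.mem_univ i)] at hf1
    have h0 : ∑ x ∈ Finset.univ.erase i, f x = 0 := by omega
    have h1 : f i = 1 := by omega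
    rw [Finset.sum_eq_zero_iff] at h0
    funext j
    by_cases hj : j = i
    · subst hj; simp [h1]
    · rw [Pi.single_eq_of_ne hj, h0 j (by simp [hj])]
  · intro i _
    rw [Finset.prod_eq_single i]
    · simp [qp_one_aux]
    · intro j _ hj
      simp [Pi.single_eq_of_ne hj, qp_zero_aux]
    · simp

lemma integrable_prod_npdf {d : ℕ} : Integrable (fun y : Fin d → ℝ => ∏ i, npdf (y i)) := by
  have h : Integrable npdf := by simpa using integrable_pow_npdf 0
  exact Integrable.fintype_prod (f := fun _ : Fin d => npdf) (fun _ => h)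

lemma integral_prod_npdf {d : ℕ} : ∫ y : Fin d → ℝ, ∏ i, npdf (y i) = 1 := by
  have := integral_fintype_prod_volume_eq_prod (fun _ : Fin d => npdf)
  rw [this]; simp [integral_npdf]

lemma lintegral_gaussDensity {d : ℕ} (K : Matrix (Fin d) (Fin d) ℝ) (hK : K.PosDef) :
    ∫⁻ x, ENNReal.ofReal (gaussDensity K x) = 1 := by
  obtain ⟨Q, μ, hQ, hΓQ, -⟩ := sim_diag K 0 hK (by simp)
  have hD : 0 < |Q.det| := abs_pos.2 hQ
  rw [lintegral_comp_Q Q hQ, hΓQ]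
  simp_rw [gaussDensity_Q Q hQ, ENNReal.ofReal_mul (inv_nonneg.2 hD.le)]
  rw [lintegral_const_mul' _ _ ENNReal.ofReal_ne_top, ← mul_assoc,
    ← ENNReal.ofReal_mul (abs_nonneg _), mul_inv_cancel₀ hD.ne', ENNReal.ofReal_one, one_mul,
    ← ofReal_integral_eq_lintegral_ofReal integrable_prod_npdf
      (Filter.Eventually.of_forall fun y => (Finset.prod_nonneg fun i _ => (npdf_pos _).le)),
    integral_prod_npdf, ENNReal.ofReal_one]

lemma log_aux (t : ℝ) (h : -(1/2) ≤ t) : t - Real.log (1 + t) ≤ t ^ 2 := by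
  have hp : 0 < 1 + t := by linarith
  have h1 : Real.exp (t - t ^ 2) ≤ 1 + t := by
    have he : Real.exp (t - t^2) = (Real.exp (t^2 - t))⁻¹ := by
      rw [← Real.exp_neg]; congr 1; ring
    rw [he]
    refine inv_le_of_inv_le₀ hp ?_
    rw [inv_le_iff_one_le_mul₀ hp]
    by_cases h3 : 0 ≤ t
    · have hb := Real.add_one_le_exp (t^2 - t)
      have := mul_le_mul_of_nonneg_right hb hp.le
      nlinarith [pow_nonneg h3 3]
    · push Not at h3
      have hb := Real.quadratic_le_exp_of_nonneg (x := t^2 - t) (by nlinarith)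
      have := mul_le_mul_of_nonneg_right hb hp.le
      refine le_trans ?_ this
      have e : (1 + (t^2-t) + (t^2-t)^2/2) * (1+t) = 1 + t^2 * ((1 + t - t^2 + t^3)/2) := by ring
      rw [e]
      have : 0 ≤ 1 + t - t^2 + t^3 := by
        nlinarith [mul_nonneg (sq_nonneg t) (by linarith : 0 ≤ t + 1/2), mul_nonneg (by linarith : 0 ≤ t + 1/2) (by linarith : 0 ≤ -t)]
      have := mul_nonneg (sq_nonneg t) (by positivity : 0 ≤ (1 + t - t^2 + t^3)/2)
      linarith
  have h2 : t - t^2 ≤ Real.log (1 + t) := (Real.le_log_iff_exp_le hp).2 h1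
  linarith

lemma dot_QdQ {d : ℕ} (Q : Matrix (Fin d) (Fin d) ℝ) (hQ : Q.det ≠ 0) (i : Fin d) :
    ∃ x : Fin d → ℝ, x ≠ 0 ∧ ∀ ν : Fin d → ℝ, x ⬝ᵥ (Q * diagonal ν * Qᵀ) *ᵥ x = ν i := by
  have hQu' : IsUnit Qᵀ.det := by rw [det_transpose]; exact isUnit_iff_ne_zero.2 hQ
  refine ⟨(Qᵀ)⁻¹ *ᵥ Pi.single i 1, ?_, ?_⟩
  · intro h
    have := congrArg (fun z => Qᵀ *ᵥ z) h
    simp only [mulVec_mulVec, mul_nonsing_inv _ hQu', one_mulVec, mulVec_zero] at this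
    have := congrFun this i
    simp at this
  · intro ν
    have e : Qᵀ *ᵥ ((Qᵀ)⁻¹ *ᵥ Pi.single i (1:ℝ)) = Pi.single i 1 := by
      rw [mulVec_mulVec, mul_nonsing_inv _ hQu', one_mulVec]
    generalize (Qᵀ)⁻¹ *ᵥ Pi.single i (1:ℝ) = x at e ⊢
    rw [← mulVec_mulVec, e, ← mulVec_mulVec, dotProduct_mulVec, ← mulVec_transpose, e]
    simp

/-- Key bound B. -/
lemma keyB {d : ℕ} (Γ K : Matrix (Fin d) (Fin d) ℝ) (hΓ : Γ.PosDef) (hK : K.PosDef)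
    (hc : ∀ x : Fin d → ℝ, |x ⬝ᵥ (Γ - K) *ᵥ x| ≤ 1 / 2 * (x ⬝ᵥ K *ᵥ x)) :
    ∫⁻ x, ENNReal.ofReal
      (gaussDensity Γ x * Real.log (gaussDensity Γ x / gaussDensity K x) ^ 2) ≤
    ENNReal.ofReal ((d:ℝ) ^ 2 / 32 + d / 4) := by
  have hsymm : (Γ - K)ᵀ = Γ - K := by
    have h1 : Γᵀ = Γ := by
      have := hΓ.1; rwa [IsHermitian, conjTranspose_eq_transpose_of_trivial] at this
    have h2 : Kᵀ = K := by
      have := hK.1; rwa [IsHermitian, conjTranspose_eq_transpose_of_trivial] at this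
    rw [transpose_sub, h1, h2]
  obtain ⟨Q, μ, hQ, hΓQ, hBQ⟩ := sim_diag Γ (Γ - K) hΓ hsymm
  have hD : 0 < |Q.det| := abs_pos.2 hQ
  have hKQ : K = Q * diagonal (fun i => 1 + -μ i) * Qᵀ := by
    have : diagonal (fun i => 1 + -μ i) = (1 : Matrix (Fin d) (Fin d) ℝ) - diagonal μ := by
      rw [← diagonal_one, diagonal_sub]
      congr 1
    rw [this, Matrix.mul_sub, Matrix.sub_mul, Matrix.mul_one, ← hΓQ, ← hBQ]
    abel
  have hpos : ∀ i, 0 < 1 + -μ i := by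
    intro i
    obtain ⟨x, hx, h⟩ := dot_QdQ Q hQ i
    have h2 := hK.dotProduct_mulVec_pos hx
    rw [hKQ] at h2
    have h3 := h (fun i => 1 + -μ i)
    rw [star_trivial, h3] at h2
    exact h2
  have hb : ∀ i, |μ i| ≤ 1 / 2 * (1 + -μ i) := by
    intro i
    obtain ⟨x, hx, h⟩ := dot_QdQ Q hQ i
    have h2 := hc x
    rw [hBQ, h, hKQ, h] at h2
    exact h2
  set δ : Fin d → ℝ := fun i => μ i / (1 + -μ i) with hδ
  have hδb : ∀ i, |δ i| ≤ 1 / 2 := by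
    intro i
    rw [hδ]
    simp only
    rw [abs_div, abs_of_pos (hpos i), div_le_iff₀ (hpos i)]
    exact hb i
  have h1δ : ∀ i, 1 + δ i = (1 + -μ i)⁻¹ := by
    intro i
    have := (hpos i).ne'
    rw [hδ]
    simp only
    field_simp
    ring
  set a : ℝ := 1 / 2 * ∑ i, (δ i - Real.log (1 + δ i)) with ha
  have ha0 : 0 ≤ a := by
    refine mul_nonneg (by norm_num) (Finset.sum_nonneg fun i _ => ?_)
    have : 0 < 1 + δ i := by rw [h1δ]; exact inv_pos.2 (hpos i)
    have := Real.log_le_sub_one_of_pos this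
    linarith
  have hδ2 : ∀ i, δ i ^ 2 ≤ 1 / 4 := by
    intro i
    have := sq_le_sq' (by linarith [abs_le.1 (hδb i)]) (abs_le.1 (hδb i)).2
    linarith
  have ha1 : a ≤ d / 8 := by
    have : ∑ i, (δ i - Real.log (1 + δ i)) ≤ ∑ i : Fin d, (1/4 : ℝ) :=
      Finset.sum_le_sum fun i _ => (log_aux _ (by linarith [abs_le.1 (hδb i)])).trans (hδ2 i)
    rw [Finset.sum_const, Finset.card_univ, Fintype.card_fin, nsmul_eq_mul] at this
    rw [ha]; linarith
  have hlog : ∀ y, Real.log (gaussDensity Γ (Q *ᵥ y) / gaussDensity K (Q *ᵥ y)) =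
      a + chaosT 1 δ y := by
    intro y
    have hg : gaussDensity Γ (Q *ᵥ y) = |Q.det|⁻¹ * ∏ i, npdf (y i) := by
      rw [hΓQ, gaussDensity_Q Q hQ]
    have hp : 0 < ∏ i, npdf (y i) := Finset.prod_pos fun i _ => npdf_pos _
    have hgp : 0 < gaussDensity Γ (Q *ᵥ y) := by rw [hg]; positivity
    have hF : ∀ i, 0 < Fone (y i) (-μ i) := fun i => by
      unfold Fone
      exact mul_pos (inv_pos.2 (Real.sqrt_pos.2 (hpos i))) (Real.exp_pos _)
    have hr : gaussDensity K (Q *ᵥ y) = gaussDensity Γ (Q *ᵥ y) * ∏ i, Fone (y i) (-μ i) := by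
      rw [hKQ, gaussDensity_ratio Q hQ _ hpos, ← hΓQ]
    have hFp : 0 < ∏ i, Fone (y i) (-μ i) := Finset.prod_pos fun i _ => hF i
    have : gaussDensity Γ (Q *ᵥ y) / gaussDensity K (Q *ᵥ y) = (∏ i, Fone (y i) (-μ i))⁻¹ := by
      rw [hr]; field_simp
    rw [this, Real.log_inv, Real.log_prod (fun i _ => (hF i).ne'), chaosT_one, ha, Finset.mul_sum,
      ← Finset.sum_add_distrib, ← Finset.sum_neg_distrib]
    refine Finset.sum_congr rfl fun i _ => ?_
    rw [h1δ, Fone, Real.log_mul (inv_pos.2 (Real.sqrt_pos.2 (hpos i))).ne' (Real.exp_pos _).ne',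
      Real.log_exp, Real.log_inv, Real.log_inv, Real.log_sqrt (hpos i).le, hδ]
    have := (hpos i).ne'
    field_simp
    ring
  rw [lintegral_comp_Q Q hQ]
  have hintg : ∀ y, ENNReal.ofReal
      (gaussDensity Γ (Q *ᵥ y) *
        Real.log (gaussDensity Γ (Q *ᵥ y) / gaussDensity K (Q *ᵥ y)) ^ 2) ≤
      ENNReal.ofReal |Q.det|⁻¹ * ENNReal.ofReal (2 * a ^ 2 * (∏ i, npdf (y i)) +
        2 * (chaosT 1 δ y ^ 2 * ∏ i, npdf (y i))) := by
    intro y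
    rw [hlog, ← ENNReal.ofReal_mul (by positivity)]
    have hg : gaussDensity Γ (Q *ᵥ y) = |Q.det|⁻¹ * ∏ i, npdf (y i) := by
      rw [hΓQ, gaussDensity_Q Q hQ]
    have hp : 0 < ∏ i, npdf (y i) := Finset.prod_pos fun i _ => npdf_pos _
    rw [hg]
    refine ENNReal.ofReal_le_ofReal ?_
    rw [mul_assoc]
    refine mul_le_mul_of_nonneg_left ?_ (by positivity)
    nlinarith [mul_nonneg hp.le (sq_nonneg (a - chaosT 1 δ y))]
  refine (mul_le_mul_right (lintegral_mono hintg) _).trans ?_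
  have hi : Integrable (fun y : Fin d → ℝ => 2 * a ^ 2 * (∏ i, npdf (y i)) +
        2 * (chaosT 1 δ y ^ 2 * ∏ i, npdf (y i))) :=
    (integrable_prod_npdf.const_mul _).add ((integrable_chaosT_sq 1 δ).const_mul 2)
  rw [lintegral_const_mul' _ _ ENNReal.ofReal_ne_top, ← mul_assoc,
    ← ENNReal.ofReal_mul (abs_nonneg _), mul_inv_cancel₀ hD.ne', ENNReal.ofReal_one, one_mul,
    ← ofReal_integral_eq_lintegral_ofReal hi
      (Filter.Eventually.of_forall fun y => by
        have hp : 0 < ∏ i, npdf (y i) := Finset.prod_pos fun i _ => npdf_pos _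
        simp only [Pi.zero_apply]
        positivity)]
  refine ENNReal.ofReal_le_ofReal ?_
  rw [integral_add (integrable_prod_npdf.const_mul _) ((integrable_chaosT_sq 1 δ).const_mul 2),
    integral_const_mul, integral_const_mul, integral_prod_npdf]
  have h1 := integral_chaosT_sq_le 1 (by norm_num) δ
  have hap : ap 1 / ((Nat.factorial 1 : ℕ) : ℝ) = 1 / 2 := by
    simp [ap]
  rw [hap, pow_one] at h1
  have h2 : ∑ i, δ i ^ 2 ≤ d / 4 := by
    have : ∑ i, δ i ^ 2 ≤ ∑ i : Fin d, (1/4 : ℝ) := Finset.sum_le_sum fun i _ => hδ2 i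
    simp at this
    linarith
  nlinarith [pow_le_pow_left₀ ha0 ha1 2]

open MeasureTheory ProbabilityTheory Matrix

lemma euclNorm_nonneg {d : ℕ} (x : Fin d → ℝ) : 0 ≤ euclNorm x := Real.sqrt_nonneg _

lemma euclNorm_sq {d : ℕ} (x : Fin d → ℝ) : euclNorm x ^ 2 = x ⬝ᵥ x := by
  rw [euclNorm, Real.sq_sqrt (Finset.sum_nonneg fun i _ => sq_nonneg _), dotProduct]
  exact Finset.sum_congr rfl fun i _ => by ring

lemma euclNorm_smul {d : ℕ} (c : ℝ) (x : Fin d → ℝ) : euclNorm (c • x) = |c| * euclNorm x := by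
  have : euclNorm (c • x) ^ 2 = (|c| * euclNorm x) ^ 2 := by
    rw [mul_pow, euclNorm_sq, euclNorm_sq, sq_abs, smul_dotProduct, dotProduct_smul,
      smul_eq_mul, smul_eq_mul]; ring
  exact (sq_eq_sq₀ (euclNorm_nonneg _) (mul_nonneg (abs_nonneg _) (euclNorm_nonneg _))).1 this

lemma hsNorm_nonneg {d : ℕ} (M : Matrix (Fin d) (Fin d) ℝ) : 0 ≤ hsNorm M := Real.sqrt_nonneg _

lemma hsNorm_sq {d : ℕ} (M : Matrix (Fin d) (Fin d) ℝ) : hsNorm M ^ 2 = ∑ i, ∑ j, M i j ^ 2 :=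
  Real.sq_sqrt (Finset.sum_nonneg fun i _ => Finset.sum_nonneg fun j _ => sq_nonneg _)

lemma euclNorm_mulVec_le {d : ℕ} (M : Matrix (Fin d) (Fin d) ℝ) (x : Fin d → ℝ) :
    euclNorm (M *ᵥ x) ≤ hsNorm M * euclNorm x := by
  refine abs_le_of_sq_le_sq' ?_ (mul_nonneg (hsNorm_nonneg _) (euclNorm_nonneg _)) |>.2
  rw [mul_pow, hsNorm_sq, euclNorm, euclNorm, Real.sq_sqrt (Finset.sum_nonneg fun i _ => sq_nonneg _),
    Real.sq_sqrt (Finset.sum_nonneg fun i _ => sq_nonneg _), Finset.sum_mul]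
  refine Finset.sum_le_sum fun i _ => ?_
  exact Finset.sum_mul_sq_le_sq_mul_sq Finset.univ (fun j => M i j) x

lemma abs_dot_le {d : ℕ} (x y : Fin d → ℝ) : |x ⬝ᵥ y| ≤ euclNorm x * euclNorm y := by
  refine abs_le_of_sq_le_sq ?_ (mul_nonneg (euclNorm_nonneg _) (euclNorm_nonneg _))
  rw [mul_pow, euclNorm, euclNorm, Real.sq_sqrt (Finset.sum_nonneg fun i _ => sq_nonneg _),
    Real.sq_sqrt (Finset.sum_nonneg fun i _ => sq_nonneg _)]
  exact Finset.sum_mul_sq_le_sq_mul_sq _ _ _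

lemma opNorm_bdd {d : ℕ} (M : Matrix (Fin d) (Fin d) ℝ) :
    BddAbove {r : ℝ | ∃ x : Fin d → ℝ, euclNorm x = 1 ∧ r = euclNorm (M.mulVec x)} := by
  refine ⟨hsNorm M, ?_⟩
  rintro r ⟨x, hx, rfl⟩
  have := euclNorm_mulVec_le M x
  rwa [hx, mul_one] at this

lemma exists_unit {d : ℕ} (hd : 1 ≤ d) : ∃ x : Fin d → ℝ, euclNorm x = 1 := by
  refine ⟨Pi.single ⟨0, hd⟩ 1, ?_⟩
  have := euclNorm_sq (Pi.single (⟨0, hd⟩ : Fin d) (1:ℝ))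
  rw [single_dotProduct, Pi.single_eq_same, one_mul] at this
  have h := euclNorm_nonneg (Pi.single (⟨0, hd⟩ : Fin d) (1:ℝ))
  nlinarith

lemma opNorm_le_iff {d : ℕ} (hd : 1 ≤ d) (M : Matrix (Fin d) (Fin d) ℝ) (c : ℝ) :
    opNorm M ≤ c ↔ ∀ x : Fin d → ℝ, euclNorm x = 1 → euclNorm (M *ᵥ x) ≤ c := by
  constructor
  · intro h x hx
    exact (le_csSup (opNorm_bdd M) ⟨x, hx, rfl⟩).trans h
  · intro h
    obtain ⟨x, hx⟩ := exists_unit hd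
    refine csSup_le ⟨_, x, hx, rfl⟩ ?_
    rintro r ⟨x, hx, rfl⟩
    exact h x hx

lemma exists_normalize {d : ℕ} (x : Fin d → ℝ) (hx : x ≠ 0) :
    0 < euclNorm x ∧ ∃ y, euclNorm y = 1 ∧ x = euclNorm x • y := by
  have h0 : 0 < euclNorm x := by
    have h1 : 0 < x ⬝ᵥ x := by
      have := dotProduct_star_self_pos_iff.2 hx
      simpa using this
    rw [← euclNorm_sq] at h1
    exact (euclNorm_nonneg x).lt_of_ne' (by intro h; rw [h] at h1; simp at h1)
  refine ⟨h0, (euclNorm x)⁻¹ • x, ?_, ?_⟩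
  · rw [euclNorm_smul, abs_of_pos (inv_pos.2 h0), inv_mul_cancel₀ h0.ne']
  · rw [smul_smul, mul_inv_cancel₀ h0.ne', one_smul]

lemma opNorm_dot {d : ℕ} (hd : 1 ≤ d) (M : Matrix (Fin d) (Fin d) ℝ) (c : ℝ) (hc : opNorm M ≤ c)
    (x : Fin d → ℝ) : |x ⬝ᵥ M *ᵥ x| ≤ c * (x ⬝ᵥ x) := by
  by_cases hx : x = 0
  · subst hx; simp
  obtain ⟨h0, y, hy, hxy⟩ := exists_normalize x hx
  have h1 := (opNorm_le_iff hd M c).1 hc y hy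
  have h2 := abs_dot_le y (M *ᵥ y)
  rw [hy, one_mul] at h2
  rw [← euclNorm_sq, hxy, mulVec_smul, smul_dotProduct, dotProduct_smul, smul_eq_mul, smul_eq_mul,
    abs_mul, abs_mul, euclNorm_smul, hy, mul_one, abs_of_pos h0]
  nlinarith [mul_le_mul_of_nonneg_left (h2.trans h1) (mul_nonneg h0.le h0.le)]

lemma posDef_quad_nonneg {d : ℕ} (K : Matrix (Fin d) (Fin d) ℝ) (hK : K.PosDef) (x : Fin d → ℝ) :
    0 ≤ x ⬝ᵥ K *ᵥ x := by
  have := hK.posSemidef.dotProduct_mulVec_nonneg x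
  simpa using this

lemma lambdaMin_bdd {d : ℕ} (K : Matrix (Fin d) (Fin d) ℝ) (hK : K.PosDef) :
    BddBelow {r : ℝ | ∃ x : Fin d → ℝ, euclNorm x = 1 ∧ r = x ⬝ᵥ K.mulVec x} := by
  refine ⟨0, ?_⟩
  rintro r ⟨x, hx, rfl⟩
  exact posDef_quad_nonneg K hK x

lemma lambdaMin_dot {d : ℕ} (K : Matrix (Fin d) (Fin d) ℝ) (hK : K.PosDef) (x : Fin d → ℝ) :
    lambdaMin K * (x ⬝ᵥ x) ≤ x ⬝ᵥ K *ᵥ x := by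
  by_cases hx : x = 0
  · subst hx; simp
  obtain ⟨h0, y, hy, hxy⟩ := exists_normalize x hx
  have h1 : lambdaMin K ≤ y ⬝ᵥ K *ᵥ y := csInf_le (lambdaMin_bdd K hK) ⟨y, hy, rfl⟩
  rw [← euclNorm_sq, hxy, mulVec_smul, smul_dotProduct, dotProduct_smul, smul_eq_mul, smul_eq_mul,
    euclNorm_smul, hy, mul_one, abs_of_pos h0]
  nlinarith [mul_le_mul_of_nonneg_left h1 (mul_nonneg h0.le h0.le)]

lemma hsNorm_inv_pos {d : ℕ} (hd : 1 ≤ d) (K : Matrix (Fin d) (Fin d) ℝ) (hK : K.PosDef) :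
    0 < hsNorm K⁻¹ := by
  obtain ⟨x, hx⟩ := exists_unit hd
  refine (hsNorm_nonneg _).lt_of_ne' ?_
  intro h
  have hu : IsUnit K.det := isUnit_iff_ne_zero.2 hK.det_pos.ne'
  have h1 := euclNorm_mulVec_le K⁻¹ (K *ᵥ x)
  rw [mulVec_mulVec, nonsing_inv_mul _ hu, one_mulVec, h, zero_mul, hx] at h1
  linarith

lemma inv_hsNorm_le {d : ℕ} (hd : 1 ≤ d) (K : Matrix (Fin d) (Fin d) ℝ) (hK : K.PosDef) :
    (hsNorm K⁻¹)⁻¹ ≤ lambdaMin K := by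
  have hh := hsNorm_inv_pos hd K hK
  obtain ⟨x, hx⟩ := exists_unit hd
  refine le_csInf ⟨_, x, hx, rfl⟩ ?_
  rintro r ⟨x, hx, rfl⟩
  have hu : IsUnit K.det := isUnit_iff_ne_zero.2 hK.det_pos.ne'
  set t := (hsNorm K⁻¹)⁻¹ with ht
  have ht0 : 0 < t := inv_pos.2 hh
  have h1 := posDef_quad_nonneg K hK (x - t • (K⁻¹ *ᵥ x))
  have hKK : K *ᵥ (K⁻¹ *ᵥ x) = x := by rw [mulVec_mulVec, mul_nonsing_inv _ hu, one_mulVec]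
  have hxx : x ⬝ᵥ x = 1 := by rw [← euclNorm_sq, hx]; norm_num
  have hKt : Kᵀ = K := by
    have := hK.1; rwa [IsHermitian, conjTranspose_eq_transpose_of_trivial] at this
  have hsw : (K⁻¹ *ᵥ x) ⬝ᵥ (K *ᵥ x) = 1 := by
    rw [dotProduct_mulVec, ← mulVec_transpose, hKt, hKK, hxx]
  have h2 : |x ⬝ᵥ K⁻¹ *ᵥ x| ≤ hsNorm K⁻¹ := by
    have := (abs_dot_le x (K⁻¹ *ᵥ x)).trans
      (mul_le_mul_of_nonneg_left (euclNorm_mulVec_le K⁻¹ x) (euclNorm_nonneg _))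
    rwa [hx, one_mul, mul_one] at this
  rw [mulVec_sub, mulVec_smul, hKK, sub_dotProduct, dotProduct_sub, dotProduct_sub,
    smul_dotProduct, smul_dotProduct, dotProduct_smul, dotProduct_smul, hsw, hxx,
    dotProduct_comm (K⁻¹ *ᵥ x)] at h1
  simp only [smul_eq_mul, mul_one] at h1
  have h3 := (abs_le.1 h2).2
  have h4 : t * (t * (x ⬝ᵥ K⁻¹ *ᵥ x)) ≤ t := by
    have : t * (x ⬝ᵥ K⁻¹ *ᵥ x) ≤ 1 := by
      calc t * (x ⬝ᵥ K⁻¹ *ᵥ x) ≤ t * hsNorm K⁻¹ := mul_le_mul_of_nonneg_left h3 ht0.le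
        _ = 1 := inv_mul_cancel₀ hh.ne'
    nlinarith
  linarith

lemma lambdaMin_pos {d : ℕ} (hd : 1 ≤ d) (K : Matrix (Fin d) (Fin d) ℝ) (hK : K.PosDef) :
    0 < lambdaMin K := (inv_pos.2 (hsNorm_inv_pos hd K hK)).trans_le (inv_hsNorm_le hd K hK)

lemma lambdaMin_pow_le_det {d : ℕ} (hd : 1 ≤ d) (K : Matrix (Fin d) (Fin d) ℝ) (hK : K.PosDef) :
    lambdaMin K ^ d ≤ K.det := by
  obtain ⟨U, hU, hUK⟩ := spectral_real K hK.1
  have hU' : Uᵀ * U = 1 := mul_eq_one_comm.1 hU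
  have hdet : K.det = ∏ i, hK.1.eigenvalues i := by
    have := hK.1.det_eq_prod_eigenvalues
    simpa using this
  generalize hK.1.eigenvalues = l at hUK hdet
  have hl : ∀ i, lambdaMin K ≤ l i := by
    intro i
    refine csInf_le (lambdaMin_bdd K hK) ⟨U *ᵥ Pi.single i 1, ?_, ?_⟩
    · have : euclNorm (U *ᵥ Pi.single i 1) ^ 2 = 1 := by
        rw [euclNorm_sq, dotProduct_mulVec, ← mulVec_transpose, mulVec_mulVec, hU', one_mulVec]
        simp
      have h := euclNorm_nonneg (U *ᵥ Pi.single i 1)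
      nlinarith
    · rw [hUK, mulVec_mulVec, Matrix.mul_assoc, hU', Matrix.mul_one, ← mulVec_mulVec,
        dotProduct_mulVec, ← mulVec_transpose, mulVec_mulVec, hU', one_mulVec]
      simp
  rw [hdet]
  calc lambdaMin K ^ d = ∏ i : Fin d, lambdaMin K := by simp
    _ ≤ ∏ i, l i := Finset.prod_le_prod (fun i _ => (lambdaMin_pos hd K hK).le) fun i _ => hl i

lemma maxLog_ge {d : ℕ} (hd : 1 ≤ d) (K : Matrix (Fin d) (Fin d) ℝ) (hK : K.PosDef) :
    d * Real.log 2 ≤ maxLog K := by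
  refine le_trans ?_ (le_max_right _ _)
  have hl := pow_pos (lambdaMin_pos hd K hK) d
  rw [← Real.log_pow]
  refine Real.log_le_log (by positivity) ?_
  rw [le_div_iff₀ hl]
  exact mul_le_mul_of_nonneg_left (lambdaMin_pow_le_det hd K hK) (by positivity)

lemma numerics (d : ℕ) (hd : 1 ≤ d) :
    4 * Real.exp (-2) + ((d:ℝ) ^ 2 / 32 + d / 4) ≤
      (1 / 2 * (d * Real.log 2) + Real.sqrt d * (Real.sqrt 2 + 1) / 4) ^ 2 := by
  have hd1 : (1:ℝ) ≤ d := by exact_mod_cast hd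
  have hl : (0.693:ℝ) < Real.log 2 := by linarith [Real.log_two_gt_d9]
  have h2 : (1.414:ℝ) < Real.sqrt 2 := Real.lt_sqrt_of_sq_lt (by norm_num)
  have hs1 : 1 ≤ Real.sqrt d := by rw [Real.one_le_sqrt]; exact hd1
  have hss : Real.sqrt d ^ 2 = d := Real.sq_sqrt (by linarith)
  have he : Real.exp (-2) ≤ 0.136 := by
    have h1 := Real.exp_one_gt_d9
    have : Real.exp (-2) = (Real.exp 1 ^ 2)⁻¹ := by
      rw [← Real.exp_nat_mul, ← Real.exp_neg]; norm_num
    rw [this]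
    refine inv_le_of_inv_le₀ (by norm_num) ?_
    nlinarith
  generalize Real.sqrt d = s at *
  rw [← hss]
  have hb : 0.3465 * s ^ 2 + 0.6035 * s ≤
      1 / 2 * (s ^ 2 * Real.log 2) + s * (Real.sqrt 2 + 1) / 4 := by
    nlinarith [mul_le_mul_of_nonneg_left hl.le (sq_nonneg s)]
  have hb2 := pow_le_pow_left₀ (by positivity) hb 2
  refine le_trans ?_ hb2
  have : 0 ≤ s - 1 := by linarith
  obtain ⟨r, rfl⟩ : ∃ r, s = 1 + r := ⟨s - 1, by ring⟩
  have hr : 0 ≤ r := by linarith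
  have hr2 := pow_nonneg hr 2
  have hr3 := pow_nonneg hr 3
  have hr4 := pow_nonneg hr 4
  nlinarith

lemma bracket_sq {d : ℕ} (hd : 1 ≤ d) (K : Matrix (Fin d) (Fin d) ℝ) (hK : K.PosDef) :
    0 ≤ ((1 / 2) * maxLog K +
          (Real.sqrt d * (Real.sqrt 2 + 1) / 4) * hsNorm K⁻¹ * lambdaMin K) ∧
    4 * Real.exp (-2) + ((d:ℝ) ^ 2 / 32 + d / 4) ≤
      ((1 / 2) * maxLog K +
          (Real.sqrt d * (Real.sqrt 2 + 1) / 4) * hsNorm K⁻¹ * lambdaMin K) ^ 2 := by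
  have h1 := maxLog_ge hd K hK
  have h2 : 1 ≤ hsNorm K⁻¹ * lambdaMin K := by
    have h := hsNorm_inv_pos hd K hK
    have := mul_le_mul_of_nonneg_left (inv_hsNorm_le hd K hK) h.le
    rwa [mul_inv_cancel₀ h.ne'] at this
  have hl : 0 < Real.log 2 := Real.log_pos (by norm_num)
  have h3 : Real.sqrt d * (Real.sqrt 2 + 1) / 4 ≤
      (Real.sqrt d * (Real.sqrt 2 + 1) / 4) * hsNorm K⁻¹ * lambdaMin K := by
    rw [mul_assoc]
    exact le_mul_of_one_le_right (by positivity) h2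
  have h4 : (1 / 2 * (d * Real.log 2) + Real.sqrt d * (Real.sqrt 2 + 1) / 4) ≤
    ((1 / 2) * maxLog K +
          (Real.sqrt d * (Real.sqrt 2 + 1) / 4) * hsNorm K⁻¹ * lambdaMin K) := by linarith
  have h5 : 0 ≤ (1 / 2 * (d * Real.log 2) + Real.sqrt d * (Real.sqrt 2 + 1) / 4) := by positivity
  exact ⟨h5.trans h4, (numerics d hd).trans (pow_le_pow_left₀ h5 h4 2)⟩

open MeasureTheory ProbabilityTheory Matrix
section
open scoped ContDiff

lemma contDiff_det_aux {E : Type*} [NormedAddCommGroup E] [NormedSpace ℝ E] {d : ℕ}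
    (M : E → Matrix (Fin d) (Fin d) ℝ) (h : ∀ i j, ContDiff ℝ ∞ fun p => M p i j) :
    ContDiff ℝ ∞ fun p => (M p).det := by
  simp only [det_apply]
  refine ContDiff.sum fun σ _ => ?_
  refine ContDiff.const_smul _ ?_
  exact contDiff_prod fun i _ => h _ _

lemma contDiff_adj_aux {E : Type*} [NormedAddCommGroup E] [NormedSpace ℝ E] {d : ℕ}
    (M : E → Matrix (Fin d) (Fin d) ℝ) (h : ∀ i j, ContDiff ℝ ∞ fun p => M p i j) (i j : Fin d) :
    ContDiff ℝ ∞ fun p => (M p).adjugate i j := by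
  simp only [adjugate_apply]
  refine contDiff_det_aux _ fun a b => ?_
  simp only [updateRow_apply]
  split_ifs
  · exact contDiff_const
  · exact h a b

lemma inv_entry {d : ℕ} (M : Matrix (Fin d) (Fin d) ℝ) (i j : Fin d) :
    M⁻¹ i j = (M.det)⁻¹ * M.adjugate i j := by
  rw [inv_def, Ring.inverse_eq_inv']; rfl

abbrev TT (d : ℕ) := ℝ × (Fin d → Fin d → ℝ) × (Fin d → ℝ)

/-- The affine matrix path. -/
noncomputable def Mp {d : ℕ} (K : Matrix (Fin d) (Fin d) ℝ) (p : TT d) :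
    Matrix (Fin d) (Fin d) ℝ := K + p.1 • Matrix.of p.2.1

noncomputable def Th {d : ℕ} (K : Matrix (Fin d) (Fin d) ℝ) : ℕ → TT d → ℝ
  | 0 => fun p => gaussDensity (Mp K p) p.2.2
  | k + 1 => fun p => fderiv ℝ (Th K k) p (1, 0, 0)

def UU {d : ℕ} (K : Matrix (Fin d) (Fin d) ℝ) : Set (TT d) := {p | 0 < (Mp K p).det}

lemma contDiff_Mp {d : ℕ} (K : Matrix (Fin d) (Fin d) ℝ) (i j : Fin d) :
    ContDiff ℝ ∞ fun p : TT d => Mp K p i j := by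
  have : (fun p : TT d => Mp K p i j) = fun p => K i j + p.1 * p.2.1 i j := by
    funext p; simp [Mp]
  rw [this]
  fun_prop

lemma isOpen_UU {d : ℕ} (K : Matrix (Fin d) (Fin d) ℝ) : IsOpen (UU K) :=
  isOpen_lt continuous_const (contDiff_det_aux _ (contDiff_Mp K)).continuous

lemma contDiffOn_inv_entry {d : ℕ} (K : Matrix (Fin d) (Fin d) ℝ) (i j : Fin d) :
    ContDiffOn ℝ ∞ (fun p : TT d => (Mp K p)⁻¹ i j) (UU K) := by
  simp only [inv_entry]
  refine ContDiffOn.mul (ContDiffOn.inv (contDiff_det_aux _ (contDiff_Mp K)).contDiffOn ?_)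
    (contDiff_adj_aux _ (contDiff_Mp K) i j).contDiffOn
  intro p hp
  exact (ne_of_gt hp)

lemma contDiffOn_Th_zero {d : ℕ} (K : Matrix (Fin d) (Fin d) ℝ) :
    ContDiffOn ℝ ∞ (Th K 0) (UU K) := by
  change ContDiffOn ℝ ∞ (fun p : TT d => gaussDensity (Mp K p) p.2.2) (UU K)
  unfold gaussDensity
  have hdet := (contDiff_det_aux _ (contDiff_Mp K)).contDiffOn (s := UU K)
  have hp : ∀ p ∈ UU K, 0 < (2 * Real.pi) ^ d * (Mp K p).det := fun p hp => by
    have : 0 < (Mp K p).det := hp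
    positivity
  refine ContDiffOn.mul (ContDiffOn.inv (ContDiffOn.sqrt (contDiffOn_const.mul hdet)
    fun p h => (hp p h).ne') fun p h => (Real.sqrt_pos.2 (hp p h)).ne') ?_
  refine ContDiffOn.exp (contDiffOn_const.mul ?_)
  simp only [dotProduct, mulVec]
  refine ContDiffOn.sum fun i _ => ContDiffOn.mul (by fun_prop) ?_
  refine ContDiffOn.sum fun j _ => ContDiffOn.mul (contDiffOn_inv_entry K i j) (by fun_prop)

lemma contDiffOn_Th {d : ℕ} (K : Matrix (Fin d) (Fin d) ℝ) (k : ℕ) :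
    ContDiffOn ℝ ∞ (Th K k) (UU K) := by
  induction k with
  | zero => exact contDiffOn_Th_zero K
  | succ k ih =>
    change ContDiffOn ℝ ∞ (fun p => fderiv ℝ (Th K k) p (1, 0, 0)) (UU K)
    exact (ih.fderiv_of_isOpen (isOpen_UU K) (by simp)).clm_apply contDiffOn_const

lemma hasDerivAt_Th {d : ℕ} (K : Matrix (Fin d) (Fin d) ℝ) (k : ℕ) (s : ℝ)
    (B : Fin d → Fin d → ℝ) (x : Fin d → ℝ) (h : (s, B, x) ∈ UU K) :
    HasDerivAt (fun s => Th K k (s, B, x)) (Th K (k + 1) (s, B, x)) s := by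
  have h1 : DifferentiableAt ℝ (Th K k) (s, B, x) :=
    ((contDiffOn_Th K k).contDiffAt ((isOpen_UU K).mem_nhds h)).differentiableAt (by simp)
  have h2 : HasDerivAt (fun s : ℝ => ((s, B, x) : TT d)) (1, 0, 0) s :=
    (hasDerivAt_id s).prodMk (hasDerivAt_const s (B, x))
  exact h1.hasFDerivAt.comp_hasDerivAt s h2

/-- The compact set of admissible perturbations. -/
def KKs {d : ℕ} (K : Matrix (Fin d) (Fin d) ℝ) : Set (Fin d → Fin d → ℝ) :=
  {B | (Matrix.of B)ᵀ = Matrix.of B ∧ opNorm (Matrix.of B) ≤ lambdaMin K / 2}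

lemma continuous_euclNorm_mulVec {d : ℕ} (x : Fin d → ℝ) :
    Continuous fun B : Fin d → Fin d → ℝ => euclNorm (Matrix.of B *ᵥ x) := by
  unfold euclNorm
  simp only [mulVec, dotProduct, of_apply]
  fun_prop

lemma isClosed_opNorm {d : ℕ} (hd : 1 ≤ d) (c : ℝ) :
    IsClosed {B : Fin d → Fin d → ℝ | opNorm (Matrix.of B) ≤ c} := by
  have : {B : Fin d → Fin d → ℝ | opNorm (Matrix.of B) ≤ c} =
      ⋂ x : Fin d → ℝ, ⋂ _ : euclNorm x = 1, {B | euclNorm (Matrix.of B *ᵥ x) ≤ c} := by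
    ext B
    simp only [Set.mem_iInter, Set.mem_setOf_eq]
    exact opNorm_le_iff hd _ c
  rw [this]
  exact isClosed_iInter fun x => isClosed_iInter fun _ =>
    isClosed_le (continuous_euclNorm_mulVec x) continuous_const

lemma isCompact_KKs {d : ℕ} (hd : 1 ≤ d) (K : Matrix (Fin d) (Fin d) ℝ) : IsCompact (KKs K) := by
  have hcl : IsClosed (KKs K) := by
    have h1 : IsClosed {B : Fin d → Fin d → ℝ | (Matrix.of B)ᵀ = Matrix.of B} := by
      have : {B : Fin d → Fin d → ℝ | (Matrix.of B)ᵀ = Matrix.of B} =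
        ⋂ i, ⋂ j, {B | B j i = B i j} := by
        ext B
        simp only [Set.mem_iInter, Set.mem_setOf_eq, ← Matrix.ext_iff, transpose_apply, of_apply]
      rw [this]
      exact isClosed_iInter fun i => isClosed_iInter fun j =>
        isClosed_eq (by fun_prop) (by fun_prop)
    exact h1.inter (isClosed_opNorm hd _)
  refine Metric.isCompact_of_isClosed_isBounded hcl ?_
  refine (Metric.isBounded_closedBall (x := 0) (r := |lambdaMin K / 2|)).subset ?_
  rintro B ⟨-, hB⟩
  rw [mem_closedBall_zero_iff, pi_norm_le_iff_of_nonneg (abs_nonneg _)]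
  intro i
  rw [pi_norm_le_iff_of_nonneg (abs_nonneg _)]
  intro j
  have hx : euclNorm (Pi.single j (1:ℝ)) = 1 := by
    have := euclNorm_sq (Pi.single j (1:ℝ))
    rw [single_dotProduct, Pi.single_eq_same, one_mul] at this
    have h := euclNorm_nonneg (Pi.single j (1:ℝ))
    nlinarith
  have h1 := (opNorm_le_iff hd _ _).1 hB _ hx
  have h2 := abs_dot_le (Pi.single i (1:ℝ)) (Matrix.of B *ᵥ Pi.single j 1)
  have hx' : euclNorm (Pi.single i (1:ℝ)) = 1 := by
    have := euclNorm_sq (Pi.single i (1:ℝ))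
    rw [single_dotProduct, Pi.single_eq_same, one_mul] at this
    have h := euclNorm_nonneg (Pi.single i (1:ℝ))
    nlinarith
  rw [hx', one_mul, single_dotProduct, one_mul, mulVec_single_one] at h2
  simp only [col_apply, of_apply, mulVec_single_one] at h1 h2
  rw [Real.norm_eq_abs]
  exact (h2.trans h1).trans (le_abs_self _)

lemma quad_bound {d : ℕ} (hd : 1 ≤ d) (K : Matrix (Fin d) (Fin d) ℝ) (hK : K.PosDef)
    (B : Fin d → Fin d → ℝ) (hB : B ∈ KKs K) (x : Fin d → ℝ) :
    |x ⬝ᵥ (Matrix.of B) *ᵥ x| ≤ 1 / 2 * (x ⬝ᵥ K *ᵥ x) := by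
  have h1 := opNorm_dot hd _ _ hB.2 x
  have h2 := lambdaMin_dot K hK x
  linarith

lemma posDef_path {d : ℕ} (hd : 1 ≤ d) (K : Matrix (Fin d) (Fin d) ℝ) (hK : K.PosDef)
    (B : Fin d → Fin d → ℝ) (hB : B ∈ KKs K) (s : ℝ) (hs : |s| ≤ 3 / 2) :
    (K + s • Matrix.of B).PosDef := by
  refine PosDef.of_dotProduct_mulVec_pos ?_ ?_
  · have h2 : Kᵀ = K := by
      have := hK.1; rwa [IsHermitian, conjTranspose_eq_transpose_of_trivial] at this
    rw [IsHermitian, conjTranspose_eq_transpose_of_trivial, transpose_add, transpose_smul, hB.1, h2]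
  · intro x hx
    have h1 := quad_bound hd K hK B hB x
    have h2 := hK.dotProduct_mulVec_pos hx
    rw [star_trivial] at h2 ⊢
    rw [add_mulVec, dotProduct_add, smul_mulVec, dotProduct_smul, smul_eq_mul]
    have h3 : |s * (x ⬝ᵥ Matrix.of B *ᵥ x)| ≤ 3 / 2 * (1 / 2 * (x ⬝ᵥ K *ᵥ x)) := by
      rw [abs_mul]
      exact mul_le_mul hs h1 (abs_nonneg _) (by norm_num)
    have := (abs_le.1 h3).1
    linarith

lemma mem_UU {d : ℕ} (hd : 1 ≤ d) (K : Matrix (Fin d) (Fin d) ℝ) (hK : K.PosDef)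
    (B : Fin d → Fin d → ℝ) (hB : B ∈ KKs K) (s : ℝ) (hs : |s| ≤ 3 / 2) (x : Fin d → ℝ) :
    (s, B, x) ∈ UU K := (posDef_path hd K hK B hB s hs).det_pos

lemma gaussDensity_pos {d : ℕ} (K : Matrix (Fin d) (Fin d) ℝ) (hK : K.PosDef) (x : Fin d → ℝ) :
    0 < gaussDensity K x := by
  unfold gaussDensity
  have := hK.det_pos
  positivity

lemma continuous_gaussDensity {d : ℕ} (K : Matrix (Fin d) (Fin d) ℝ) :
    Continuous (gaussDensity K) := by
  unfold gaussDensity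
  simp only [mulVec, dotProduct]
  fun_prop

end

open MeasureTheory ProbabilityTheory Matrix

lemma continuous_Th_X {d : ℕ} (hd : 1 ≤ d) (K : Matrix (Fin d) (Fin d) ℝ) (hK : K.PosDef) (k : ℕ)
    (s : ℝ) (hs : |s| ≤ 3 / 2) :
    Continuous (fun q : (KKs K) × (Fin d → ℝ) => Th K k (s, (q.1 : Fin d → Fin d → ℝ), q.2)) := by
  refine (contDiffOn_Th K k).continuousOn.comp_continuous (by fun_prop) ?_
  rintro ⟨b, x⟩
  exact mem_UU hd K hK b b.2 s hs x

lemma Th_bound {d : ℕ} (hd : 1 ≤ d) (K : Matrix (Fin d) (Fin d) ℝ) (hK : K.PosDef) (k : ℕ)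
    (x : Fin d → ℝ) :
    ∃ C : ℝ, ∀ s ∈ Set.Icc (-(1/2) : ℝ) (3/2), ∀ b ∈ KKs K, |Th K k (s, b, x)| ≤ C := by
  have hc : IsCompact (Set.Icc (-(1/2) : ℝ) (3/2) ×ˢ (KKs K)) :=
    isCompact_Icc.prod (isCompact_KKs hd K)
  have hf : ContinuousOn (fun q : ℝ × (Fin d → Fin d → ℝ) => Th K k (q.1, q.2, x))
      (Set.Icc (-(1/2) : ℝ) (3/2) ×ˢ (KKs K)) := by
    refine (contDiffOn_Th K k).continuousOn.comp (by fun_prop) ?_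
    rintro ⟨s, b⟩ ⟨hs, hb⟩
    exact mem_UU hd K hK b hb s (abs_le.2 ⟨by linarith [hs.1], hs.2⟩) x
  obtain ⟨C, hC⟩ := hc.exists_bound_of_continuousOn hf
  exact ⟨C, fun s hs b hb => hC (s, b) ⟨hs, hb⟩⟩

lemma hasDerivAt_int_Th {d : ℕ} (hd : 1 ≤ d) (K : Matrix (Fin d) (Fin d) ℝ) (hK : K.PosDef)
    (ν : Measure (KKs K)) [IsFiniteMeasure ν] (k : ℕ) (x : Fin d → ℝ) (s : ℝ)
    (hs : s ∈ Set.Ioo (-(1/2) : ℝ) (3/2)) :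
    HasDerivAt (fun s => ∫ b, Th K k (s, (b : Fin d → Fin d → ℝ), x) ∂ν)
      (∫ b, Th K (k + 1) (s, (b : Fin d → Fin d → ℝ), x) ∂ν) s := by
  obtain ⟨C, hC⟩ := Th_bound hd K hK (k + 1) x
  obtain ⟨C', hC'⟩ := Th_bound hd K hK k x
  have hab : ∀ s ∈ Set.Ioo (-(1/2) : ℝ) (3/2), |s| ≤ 3 / 2 := fun s hs =>
    abs_le.2 ⟨by linarith [hs.1], hs.2.le⟩
  have hcont : ∀ k, ∀ s ∈ Set.Ioo (-(1/2) : ℝ) (3/2),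
      Continuous (fun b : KKs K => Th K k (s, (b : Fin d → Fin d → ℝ), x)) := fun k s hs =>
    (continuous_Th_X hd K hK k s (hab s hs)).comp (by fun_prop : Continuous fun b : KKs K => (b, x))
  have := hasDerivAt_integral_of_dominated_loc_of_deriv_le (μ := ν) (𝕜 := ℝ)
    (F := fun s b => Th K k (s, (b : Fin d → Fin d → ℝ), x))
    (F' := fun s b => Th K (k + 1) (s, (b : Fin d → Fin d → ℝ), x))
    (x₀ := s) (s := Set.Ioo (-(1/2) : ℝ) (3/2)) (bound := fun _ => C)
    (isOpen_Ioo.mem_nhds hs)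
    (by
      filter_upwards [isOpen_Ioo.mem_nhds hs] with t ht
      exact (hcont k t ht).aestronglyMeasurable)
    (Integrable.of_bound (hcont k s hs).aestronglyMeasurable C'
      (Filter.Eventually.of_forall fun b => hC' s ⟨hs.1.le, hs.2.le⟩ b b.2))
    (hcont (k + 1) s hs).aestronglyMeasurable
    (Filter.Eventually.of_forall fun b t ht => hC t ⟨ht.1.le, ht.2.le⟩ b b.2)
    (integrable_const C)
    (Filter.Eventually.of_forall fun b t ht =>
      hasDerivAt_Th K k t b x (mem_UU hd K hK b b.2 t (hab t ht) x))
  exact this.2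

lemma iteratedDeriv_int_Th {d : ℕ} (hd : 1 ≤ d) (K : Matrix (Fin d) (Fin d) ℝ) (hK : K.PosDef)
    (ν : Measure (KKs K)) [IsFiniteMeasure ν] (x : Fin d → ℝ) (s : ℝ)
    (hs : s ∈ Set.Ioo (-(1/2) : ℝ) (3/2)) :
    iteratedDeriv 4 (fun s => ∫ b, Th K 0 (s, (b : Fin d → Fin d → ℝ), x) ∂ν) s =
      ∫ b, Th K 4 (s, (b : Fin d → Fin d → ℝ), x) ∂ν :=
  iteratedDeriv_eq_of_chain (fun k s => ∫ b, Th K k (s, (b : Fin d → Fin d → ℝ), x) ∂ν)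
    (Set.Ioo (-(1/2) : ℝ) (3/2)) isOpen_Ioo 4
    (fun k _ v hv => hasDerivAt_int_Th hd K hK ν k x v hv) 4 le_rfl s hs

lemma keyA_X {d : ℕ} (hd : 1 ≤ d) (K : Matrix (Fin d) (Fin d) ℝ) (hK : K.PosDef)
    (b : Fin d → Fin d → ℝ) (hb : b ∈ KKs K) (η : ℝ) (hη : η ∈ Set.Icc (0:ℝ) 1) :
    ∫⁻ x, ENNReal.ofReal (Th K 4 (η, b, x) ^ 2 / Th K 0 (η, b, x)) ≤
      ENNReal.ofReal (315 / 2 * hsNorm ((K + η • Matrix.of b)⁻¹ * Matrix.of b) ^ 8) := by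
  have hη' : |η| ≤ 3 / 2 := abs_le.2 ⟨by linarith [hη.1], by linarith [hη.2]⟩
  refine le_trans (le_of_eq ?_) (keyA (K + η • Matrix.of b) (Matrix.of b)
    (posDef_path hd K hK b hb η hη') hb.1)
  refine lintegral_congr fun x => ?_
  have h := iteratedDeriv_eq_of_chain (fun k u => Th K k (η + u, b, x))
    (Set.Ioo (-(1/2) : ℝ) (1/2)) isOpen_Ioo 4 (by
      intro k _ v hv
      have h1 := hasDerivAt_Th K k (η + v) b x (mem_UU hd K hK b hb (η + v)
        (abs_le.2 ⟨by linarith [hη.1, hv.1], by linarith [hη.2, hv.2]⟩) x)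
      exact h1.comp_const_add η v) 4 le_rfl 0 (by constructor <;> norm_num)
  have e : (fun u : ℝ => gaussDensity (K + η • Matrix.of b + u • Matrix.of b) x) =
      fun u => Th K 0 (η + u, b, x) := by
    funext u
    simp only [Th, Mp]
    rw [add_smul, add_assoc]
  rw [e, h, add_zero]
  rfl

/-- The tangent-line inequality for `u ↦ u (log u)^2`. -/
lemma tangent_ineq (w m : ℝ) (hw : 0 < w) (hm : 1 ≤ m) :
    m * Real.log m ^ 2 + (Real.log m ^ 2 + 2 * Real.log m) * (w - m) ≤ w * Real.log w ^ 2 := by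
  have hm0 : 0 < m := by linarith
  have hL : 0 ≤ Real.log m := Real.log_nonneg hm
  have h1 : Real.log m - Real.log w + 1 ≤ m / w := by
    rw [← Real.log_div hm0.ne' hw.ne']
    have := Real.log_le_sub_one_of_pos (div_pos hm0 hw)
    linarith
  have h2 : (Real.log m - Real.log w + 1) * w ≤ m := by
    rwa [le_div_iff₀ hw] at h1
  have h3 := mul_le_mul_of_nonneg_left h2 hL
  nlinarith [mul_nonneg hw.le (sq_nonneg (Real.log w - Real.log m))]

lemma small_ineq (m : ℝ) (hm : 0 < m) (hm1 : m < 1) : m * Real.log m ^ 2 ≤ 4 * Real.exp (-2) := by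
  have hL : Real.log m < 0 := Real.log_neg hm hm1
  set L := Real.log m with hLd
  have hmL : m = Real.exp (L / 2) ^ 2 := by
    rw [← Real.exp_nat_mul]; push_cast
    rw [mul_div_cancel₀ _ (by norm_num), hLd, Real.exp_log hm]
  have h1 := Real.add_one_le_exp (-L / 2 - 1)
  have h2 : -L / 2 * Real.exp (L / 2) ≤ Real.exp (-1) := by
    have : Real.exp (-1) = Real.exp (-L/2 - 1) * Real.exp (L/2) := by
      rw [← Real.exp_add]; congr 1; ring
    rw [this]
    exact mul_le_mul_of_nonneg_right (by linarith) (Real.exp_pos _).le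
  have h3 := pow_le_pow_left₀ (mul_nonneg (by linarith) (Real.exp_pos _).le) h2 2
  have h4 : Real.exp (-1) ^ 2 = Real.exp (-2) := by
    rw [← Real.exp_nat_mul]; norm_num
  rw [h4] at h3
  rw [hmL]
  nlinarith

lemma jensen_like {X : Type*} [TopologicalSpace X] [CompactSpace X] [T2Space X] [MeasurableSpace X]
    [BorelSpace X] (ν : Measure X) [IsFiniteMeasure ν] (hν : 0 < (ν Set.univ).toReal)
    (w : X → ℝ) (hw : Continuous w) (hpos : ∀ b, 0 < w b) :
    (∫ b, w b ∂ν) * Real.log ((∫ b, w b ∂ν) / (ν Set.univ).toReal) ^ 2 ≤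
      (ν Set.univ).toReal * (4 * Real.exp (-2)) + ∫ b, w b * Real.log (w b) ^ 2 ∂ν := by
  have hintg : ∀ f : X → ℝ, Continuous f → Integrable f ν := fun f hf => by
    have := hf.continuousOn.integrableOn_compact (μ := ν) isCompact_univ
    rwa [integrableOn_univ] at this
  have hflog : Continuous fun b => w b * Real.log (w b) ^ 2 :=
    hw.mul ((hw.log fun b => (hpos b).ne').pow 2)
  set p := (ν Set.univ).toReal with hp
  set I := ∫ b, w b ∂ν with hI
  have hIpos : 0 < I := by
    rw [hI, integral_pos_iff_support_of_nonneg (fun b => (hpos b).le) (hintg w hw)]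
    have : Function.support w = Set.univ := by
      ext b; simp [(hpos b).ne']
    rw [this]
    exact (ENNReal.toReal_pos_iff.1 hν).1
  have hnn : 0 ≤ ∫ b, w b * Real.log (w b) ^ 2 ∂ν :=
    integral_nonneg fun b => mul_nonneg (hpos b).le (sq_nonneg _)
  set m := I / p with hm
  have hm0 : 0 < m := div_pos hIpos hν
  have hIm : I = p * m := by rw [hm]; field_simp
  by_cases h1 : m < 1
  · have := mul_le_mul_of_nonneg_left (small_ineq m hm0 h1) hν.le
    rw [hIm]
    nlinarith
  · push Not at h1
    have h2 : ∫ b, (m * Real.log m ^ 2 + (Real.log m ^ 2 + 2 * Real.log m) * (w b - m)) ∂ν ≤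
        ∫ b, w b * Real.log (w b) ^ 2 ∂ν :=
      integral_mono (hintg _ (by fun_prop)) (hintg _ hflog) fun b => tangent_ineq _ _ (hpos b) h1
    rw [integral_add (integrable_const _) (hintg _ (by fun_prop)),
      integral_const_mul (Real.log m ^ 2 + 2 * Real.log m),
      integral_sub (hintg w hw) (integrable_const _), integral_const, integral_const, ← hI] at h2
    simp only [smul_eq_mul, Measure.real, ← hp] at h2
    have h3 : 0 ≤ p * (4 * Real.exp (-2)) := by positivity
    have h4 : I - p * m = 0 := by rw [hIm]; ring
    rw [h4, mul_zero, add_zero, ← mul_assoc, ← hIm] at h2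
    linarith

open MeasureTheory ProbabilityTheory Matrix

lemma continuous_hs_X {d : ℕ} (hd : 1 ≤ d) (K : Matrix (Fin d) (Fin d) ℝ) (hK : K.PosDef)
    (s : ℝ) (hs : |s| ≤ 3 / 2) :
    Continuous (fun b : KKs K => hsNorm ((K + s • Matrix.of (b : Fin d → Fin d → ℝ))⁻¹ *
      Matrix.of (b : Fin d → Fin d → ℝ)) ^ 8) := by
  have h : ∀ i j, Continuous fun b : KKs K =>
      (K + s • Matrix.of (b : Fin d → Fin d → ℝ))⁻¹ i j := by
    intro i j
    have := (contDiffOn_inv_entry K i j).continuousOn.comp_continuous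
      (f := fun b : KKs K => (s, (b : Fin d → Fin d → ℝ), (0 : Fin d → ℝ))) (by fun_prop)
      (fun b => mem_UU hd K hK b b.2 s hs 0)
    exact this
  unfold hsNorm
  simp only [mul_apply, of_apply]
  refine Continuous.pow (Continuous.sqrt ?_) 8
  refine continuous_finsetSum _ fun i _ => continuous_finsetSum _ fun j _ => Continuous.pow ?_ 2
  exact continuous_finsetSum _ fun k _ => (h i k).mul
    ((continuous_apply j).comp ((continuous_apply k).comp continuous_subtype_val))

lemma integrable_X {d : ℕ} (hd : 1 ≤ d) (K : Matrix (Fin d) (Fin d) ℝ)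
    (ν : Measure (KKs K)) [IsFiniteMeasure ν] (f : KKs K → ℝ) (hf : Continuous f) :
    Integrable f ν := by
  have : CompactSpace (KKs K) := isCompact_iff_compactSpace.1 (isCompact_KKs hd K)
  have := hf.continuousOn.integrableOn_compact (μ := ν) isCompact_univ
  rwa [integrableOn_univ] at this

lemma Th_zero_pos {d : ℕ} (hd : 1 ≤ d) (K : Matrix (Fin d) (Fin d) ℝ) (hK : K.PosDef)
    (b : KKs K) (s : ℝ) (hs : |s| ≤ 3 / 2) (x : Fin d → ℝ) :
    0 < Th K 0 (s, (b : Fin d → Fin d → ℝ), x) :=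
  gaussDensity_pos _ (posDef_path hd K hK b b.2 s hs) x

lemma measurable_int_Th {d : ℕ} (hd : 1 ≤ d) (K : Matrix (Fin d) (Fin d) ℝ) (hK : K.PosDef)
    (ν : Measure (KKs K)) [IsFiniteMeasure ν] (k : ℕ) (s : ℝ) (hs : |s| ≤ 3 / 2) :
    Measurable fun x : Fin d → ℝ => ∫ b, Th K k (s, (b : Fin d → Fin d → ℝ), x) ∂ν := by
  have h := (continuous_Th_X hd K hK k s hs).stronglyMeasurable
  exact (h.integral_prod_left' (μ := ν)).measurable

set_option maxHeartbeats 1000000 in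
lemma second_factor {d : ℕ} (hd : 1 ≤ d) (K : Matrix (Fin d) (Fin d) ℝ) (hK : K.PosDef)
    (ν : Measure (KKs K)) [IsFiniteMeasure ν] (hν : 0 < (ν Set.univ).toReal)
    (η : ℝ) (hη : η ∈ Set.Icc (0:ℝ) 1) :
    ∫⁻ x, ∫⁻ b, ENNReal.ofReal (Th K 0 (η, (b : Fin d → Fin d → ℝ), x) *
      Real.log ((∫ b, Th K 0 (η, (b : Fin d → Fin d → ℝ), x) ∂ν) /
        ((ν Set.univ).toReal * gaussDensity K x)) ^ 2) ∂ν ≤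
    ENNReal.ofReal ((ν Set.univ).toReal * (4 * Real.exp (-2) + ((d:ℝ) ^ 2 / 32 + d / 4))) := by
  have : CompactSpace (KKs K) := isCompact_iff_compactSpace.1 (isCompact_KKs hd K)
  have hη' : |η| ≤ 3 / 2 := abs_le.2 ⟨by linarith [hη.1], by linarith [hη.2]⟩
  set p := (ν Set.univ).toReal with hp
  have hcx : ∀ x, Continuous fun b : KKs K => Th K 0 (η, (b : Fin d → Fin d → ℝ), x) := fun x =>
    (continuous_Th_X hd K hK 0 η hη').comp (by fun_prop : Continuous fun b : KKs K => (b, x))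
  have hgK := gaussDensity_pos K hK
  have hclog : Continuous fun q : KKs K × (Fin d → ℝ) =>
      Th K 0 (η, (q.1 : Fin d → Fin d → ℝ), q.2) *
        Real.log (Th K 0 (η, (q.1 : Fin d → Fin d → ℝ), q.2) / gaussDensity K q.2) ^ 2 := by
    have h0 := continuous_Th_X hd K hK 0 η hη'
    have h1 : Continuous fun q : KKs K × (Fin d → ℝ) => gaussDensity K q.2 :=
      (continuous_gaussDensity K).comp continuous_snd
    refine h0.mul (Continuous.pow (Continuous.log (h0.div h1 fun q => (hgK _).ne') fun q => ?_) 2)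
    exact (div_pos (Th_zero_pos hd K hK _ η hη' _) (hgK _)).ne'
  have hpt : ∀ x, ∫⁻ b, ENNReal.ofReal (Th K 0 (η, (b : Fin d → Fin d → ℝ), x) *
      Real.log ((∫ b, Th K 0 (η, (b : Fin d → Fin d → ℝ), x) ∂ν) /
        (p * gaussDensity K x)) ^ 2) ∂ν ≤
      ENNReal.ofReal (p * (4 * Real.exp (-2))) * ENNReal.ofReal (gaussDensity K x) +
      ∫⁻ b, ENNReal.ofReal (Th K 0 (η, (b : Fin d → Fin d → ℝ), x) *
        Real.log (Th K 0 (η, (b : Fin d → Fin d → ℝ), x) / gaussDensity K x) ^ 2) ∂ν := by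
    intro x
    have hc2 : Continuous fun b : KKs K => Th K 0 (η, (b : Fin d → Fin d → ℝ), x) *
        Real.log (Th K 0 (η, (b : Fin d → Fin d → ℝ), x) / gaussDensity K x) ^ 2 :=
      (hcx x).mul (Continuous.pow (Continuous.log ((hcx x).div_const _) fun b =>
        (div_pos (Th_zero_pos hd K hK b η hη' x) (hgK x)).ne') 2)
    have hpos : ∀ b : KKs K, 0 < Th K 0 (η, (b : Fin d → Fin d → ℝ), x) := fun b =>
      Th_zero_pos hd K hK b η hη' x
    rw [← ofReal_integral_eq_lintegral_ofReal ((integrable_X hd K ν _ (hcx x)).mul_const _)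
      (Filter.Eventually.of_forall fun b => mul_nonneg (hpos b).le (sq_nonneg _)),
      ← ofReal_integral_eq_lintegral_ofReal (integrable_X hd K ν _ hc2)
      (Filter.Eventually.of_forall fun b => mul_nonneg (hpos b).le (sq_nonneg _)),
      ← ENNReal.ofReal_mul (by positivity), ← ENNReal.ofReal_add
        (mul_nonneg (by positivity) (hgK x).le)
        (integral_nonneg fun b => mul_nonneg (hpos b).le (sq_nonneg _))]
    refine ENNReal.ofReal_le_ofReal ?_
    rw [integral_mul_const]
    have hj := jensen_like ν hν (fun b => Th K 0 (η, (b : Fin d → Fin d → ℝ), x) / gaussDensity K x)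
      ((hcx x).div_const _) (fun b => div_pos (hpos b) (hgK x))
    rw [← hp, integral_div, div_div, mul_comm (gaussDensity K x) p] at hj
    have hj2 := mul_le_mul_of_nonneg_left hj (hgK x).le
    rw [mul_add, ← integral_const_mul] at hj2
    have e1 : ∀ b : KKs K, gaussDensity K x * (Th K 0 (η, (b : Fin d → Fin d → ℝ), x) /
        gaussDensity K x *
        Real.log (Th K 0 (η, (b : Fin d → Fin d → ℝ), x) / gaussDensity K x) ^ 2) =
        Th K 0 (η, (b : Fin d → Fin d → ℝ), x) *
        Real.log (Th K 0 (η, (b : Fin d → Fin d → ℝ), x) / gaussDensity K x) ^ 2 := fun b => by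
      rw [← mul_assoc, mul_div_cancel₀ _ (hgK x).ne']
    simp_rw [e1] at hj2
    rw [← mul_assoc, mul_div_cancel₀ _ (hgK x).ne'] at hj2
    linarith
  refine (lintegral_mono hpt).trans ?_
  rw [lintegral_add_left (((continuous_gaussDensity K).measurable.ennreal_ofReal).const_mul _),
    lintegral_const_mul' _ _ ENNReal.ofReal_ne_top, lintegral_gaussDensity K hK, mul_one]
  have hswap : ∫⁻ x, ∫⁻ b, ENNReal.ofReal (Th K 0 (η, (b : Fin d → Fin d → ℝ), x) *
        Real.log (Th K 0 (η, (b : Fin d → Fin d → ℝ), x) / gaussDensity K x) ^ 2) ∂ν =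
      ∫⁻ b : KKs K, (∫⁻ x, ENNReal.ofReal (Th K 0 (η, (b : Fin d → Fin d → ℝ), x) *
        Real.log (Th K 0 (η, (b : Fin d → Fin d → ℝ), x) / gaussDensity K x) ^ 2)) ∂ν :=
    (lintegral_lintegral_swap (hclog.measurable.ennreal_ofReal.aemeasurable)).symm
  rw [hswap]
  have hB : ∀ b : KKs K, ∫⁻ x, ENNReal.ofReal (Th K 0 (η, (b : Fin d → Fin d → ℝ), x) *
        Real.log (Th K 0 (η, (b : Fin d → Fin d → ℝ), x) / gaussDensity K x) ^ 2) ≤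
      ENNReal.ofReal ((d:ℝ) ^ 2 / 32 + d / 4) := by
    intro b
    refine keyB (K + η • Matrix.of (b : Fin d → Fin d → ℝ)) K
      (posDef_path hd K hK b b.2 η hη') hK ?_
    intro x
    have h := quad_bound hd K hK b b.2 x
    rw [add_sub_cancel_left, smul_mulVec, dotProduct_smul, smul_eq_mul, abs_mul, abs_of_nonneg hη.1]
    nlinarith [mul_le_mul_of_nonneg_right hη.2 (abs_nonneg (x ⬝ᵥ Matrix.of b *ᵥ x))]
  refine (add_le_add_right (lintegral_mono hB) _).trans ?_
  have hc0 : (0:ℝ) ≤ (d:ℝ) ^ 2 / 32 + d / 4 := by positivity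
  rw [lintegral_const]
  generalize (d:ℝ) ^ 2 / 32 + d / 4 = c at hc0 ⊢
  have hν2 : ν Set.univ = ENNReal.ofReal p := (ENNReal.ofReal_toReal (measure_ne_top _ _)).symm
  rw [hν2, ← ENNReal.ofReal_mul hc0, ← ENNReal.ofReal_add (by positivity) (by positivity)]
  refine ENNReal.ofReal_le_ofReal (le_of_eq (by ring))

lemma first_factor {d : ℕ} (hd : 1 ≤ d) (K : Matrix (Fin d) (Fin d) ℝ) (hK : K.PosDef)
    (ν : Measure (KKs K)) [IsFiniteMeasure ν]
    (η : ℝ) (hη : η ∈ Set.Icc (0:ℝ) 1) :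
    ∫⁻ b : KKs K, (∫⁻ x, ENNReal.ofReal (Th K 4 (η, (b : Fin d → Fin d → ℝ), x) ^ 2 /
      Th K 0 (η, (b : Fin d → Fin d → ℝ), x))) ∂ν ≤
    ENNReal.ofReal (315 / 2 * ∫ b : KKs K, hsNorm ((K + η • Matrix.of (b : Fin d → Fin d → ℝ))⁻¹ *
      Matrix.of (b : Fin d → Fin d → ℝ)) ^ 8 ∂ν) := by
  have hη' : |η| ≤ 3 / 2 := abs_le.2 ⟨by linarith [hη.1], by linarith [hη.2]⟩
  refine (lintegral_mono fun b : KKs K => keyA_X hd K hK b b.2 η hη).trans (le_of_eq ?_)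
  rw [← integral_const_mul, ofReal_integral_eq_lintegral_ofReal]
  · exact (integrable_X hd K ν _ (continuous_hs_X hd K hK η hη')).const_mul _
  · exact Filter.Eventually.of_forall fun b => mul_nonneg (by norm_num)
      (pow_nonneg (hsNorm_nonneg _) _)

set_option maxHeartbeats 1000000 in
lemma main_X {d : ℕ} (hd : 1 ≤ d) (K : Matrix (Fin d) (Fin d) ℝ) (hK : K.PosDef)
    (ν : Measure (KKs K)) [IsFiniteMeasure ν] (hν : 0 < (ν Set.univ).toReal)
    (hν1 : (ν Set.univ).toReal ≤ 1)
    (η : ℝ) (hη : η ∈ Set.Icc (0:ℝ) 1) :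
    ∫⁻ x, ENNReal.ofReal (|∫ b, Th K 4 (η, (b : Fin d → Fin d → ℝ), x) ∂ν| *
      |Real.log ((∫ b, Th K 0 (η, (b : Fin d → Fin d → ℝ), x) ∂ν) /
        ((ν Set.univ).toReal * gaussDensity K x))|) ≤
    ENNReal.ofReal ((3 * Real.sqrt 70 / 2) *
        Real.sqrt (∫ b : KKs K, hsNorm ((K + η • Matrix.of (b : Fin d → Fin d → ℝ))⁻¹ *
          Matrix.of (b : Fin d → Fin d → ℝ)) ^ 8 ∂ν) *
        ((1 / 2) * maxLog K +
          (Real.sqrt d * (Real.sqrt 2 + 1) / 4) * hsNorm K⁻¹ * lambdaMin K)) := by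
  have hη' : |η| ≤ 3 / 2 := abs_le.2 ⟨by linarith [hη.1], by linarith [hη.2]⟩
  have hfst := first_factor hd K hK ν η hη
  have hsnd := second_factor hd K hK ν hν η hη
  obtain ⟨hR0, hR⟩ := bracket_sq hd K hK
  set R := ((1 / 2) * maxLog K +
          (Real.sqrt d * (Real.sqrt 2 + 1) / 4) * hsNorm K⁻¹ * lambdaMin K) with hRd
  set p := (ν Set.univ).toReal with hp
  set J := ∫ b : KKs K, hsNorm ((K + η • Matrix.of (b : Fin d → Fin d → ℝ))⁻¹ *
          Matrix.of (b : Fin d → Fin d → ℝ)) ^ 8 ∂ν with hJ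
  have hJ0 : 0 ≤ J := integral_nonneg fun b => pow_nonneg (hsNorm_nonneg _) _
  set l : (Fin d → ℝ) → ℝ := fun x =>
    Real.log ((∫ b, Th K 0 (η, (b : Fin d → Fin d → ℝ), x) ∂ν) / (p * gaussDensity K x)) with hl
  have hlm : Measurable l := Real.measurable_log.comp
    ((measurable_int_Th hd K hK ν 0 η hη').div
      (measurable_const.mul (continuous_gaussDensity K).measurable))
  have hpos : ∀ (b : KKs K) x, 0 < Th K 0 (η, (b : Fin d → Fin d → ℝ), x) := fun b x =>
    Th_zero_pos hd K hK b η hη' x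
  have h0m := (continuous_Th_X hd K hK 0 η hη').measurable
  have h4m := (continuous_Th_X hd K hK 4 η hη').measurable
  set f : KKs K × (Fin d → ℝ) → ENNReal := fun q =>
    ENNReal.ofReal (|Th K 4 (η, (q.1 : Fin d → Fin d → ℝ), q.2)| /
      Real.sqrt (Th K 0 (η, (q.1 : Fin d → Fin d → ℝ), q.2))) with hf
  set g : KKs K × (Fin d → ℝ) → ENNReal := fun q =>
    ENNReal.ofReal (Real.sqrt (Th K 0 (η, (q.1 : Fin d → Fin d → ℝ), q.2)) * |l q.2|) with hg
  have hfm : Measurable f := by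
    refine Measurable.ennreal_ofReal ?_
    have : Measurable fun q : KKs K × (Fin d → ℝ) => |Th K 4 (η, (q.1 : Fin d → Fin d → ℝ), q.2)| :=
      h4m.abs
    exact this.div h0m.sqrt
  have hgm : Measurable g := by
    refine Measurable.ennreal_ofReal ?_
    exact h0m.sqrt.mul (hlm.comp measurable_snd).abs
  have hstep1 : ∫⁻ x, ENNReal.ofReal (|∫ b, Th K 4 (η, (b : Fin d → Fin d → ℝ), x) ∂ν| * |l x|) ≤
      ∫⁻ q, (f * g) q ∂(ν.prod volume) := by
    rw [lintegral_prod_symm _ (hfm.mul hgm).aemeasurable]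
    refine lintegral_mono fun x => ?_
    rw [ENNReal.ofReal_mul (abs_nonneg _)]
    have h1 : ENNReal.ofReal |∫ b, Th K 4 (η, (b : Fin d → Fin d → ℝ), x) ∂ν| ≤
        ∫⁻ b, ENNReal.ofReal |Th K 4 (η, (b : Fin d → Fin d → ℝ), x)| ∂ν := by
      have := enorm_integral_le_lintegral_enorm (μ := ν)
        (fun b : KKs K => Th K 4 (η, (b : Fin d → Fin d → ℝ), x))
      simpa only [Real.enorm_eq_ofReal_abs] using this
    refine (mul_le_mul_left h1 _).trans (le_of_eq ?_)
    rw [← lintegral_mul_const' _ _ ENNReal.ofReal_ne_top]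
    refine lintegral_congr fun b => ?_
    simp only [Pi.mul_apply, hf, hg]
    rw [← ENNReal.ofReal_mul (abs_nonneg _), ← ENNReal.ofReal_mul (by positivity)]
    congr 1
    have := Real.sqrt_pos.2 (hpos b x)
    field_simp
  refine hstep1.trans ((ENNReal.lintegral_mul_le_Lp_mul_Lq _ Real.HolderConjugate.two_two
    hfm.aemeasurable hgm.aemeasurable).trans ?_)
  have hf2 : ∫⁻ q, f q ^ (2:ℝ) ∂(ν.prod volume) ≤ ENNReal.ofReal (315 / 2 * J) := by
    rw [lintegral_prod _ (by fun_prop)]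
    refine le_trans (le_of_eq ?_) hfst
    refine lintegral_congr fun b => lintegral_congr fun x => ?_
    rw [ENNReal.rpow_two, hf]
    simp only
    rw [← ENNReal.ofReal_pow (by positivity), div_pow, Real.sq_sqrt (hpos b x).le, sq_abs]
  have hg2 : ∫⁻ q, g q ^ (2:ℝ) ∂(ν.prod volume) ≤ ENNReal.ofReal (R ^ 2) := by
    rw [lintegral_prod_symm _ (by fun_prop)]
    refine le_trans (le_of_eq ?_) (hsnd.trans (ENNReal.ofReal_le_ofReal ?_))
    · refine lintegral_congr fun x => lintegral_congr fun b => ?_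
      rw [ENNReal.rpow_two, hg]
      simp only
      rw [← ENNReal.ofReal_pow (by positivity), mul_pow, Real.sq_sqrt (hpos b x).le, sq_abs]
    · have h0 : 0 ≤ 4 * Real.exp (-2) + ((d:ℝ) ^ 2 / 32 + d / 4) := by positivity
      exact (mul_le_of_le_one_left h0 hν1).trans hR
  refine (mul_le_mul' (ENNReal.rpow_le_rpow hf2 (by norm_num))
    (ENNReal.rpow_le_rpow hg2 (by norm_num))).trans (le_of_eq ?_)
  rw [ENNReal.ofReal_rpow_of_nonneg (by positivity) (by norm_num),
    ENNReal.ofReal_rpow_of_nonneg (by positivity) (by norm_num), ← ENNReal.ofReal_mul (by positivity),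
    ← Real.sqrt_eq_rpow, ← Real.sqrt_eq_rpow, Real.sqrt_sq hR0, Real.sqrt_mul (by norm_num)]
  have : Real.sqrt (315 / 2) = 3 * Real.sqrt 70 / 2 := by
    rw [Real.sqrt_eq_iff_mul_self_eq (by norm_num) (by positivity)]
    have := Real.mul_self_sqrt (show (0:ℝ) ≤ 70 by norm_num)
    nlinarith
  rw [this]

open MeasureTheory ProbabilityTheory Matrix

lemma gaussLaw_ne_zero {d : ℕ} (K : Matrix (Fin d) (Fin d) ℝ) (hK : K.PosDef) : gaussLaw K ≠ 0 := by
  intro h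
  have h1 : gaussLaw K Set.univ = 1 := by
    rw [gaussLaw, withDensity_apply _ MeasurableSet.univ, setLIntegral_univ,
      lintegral_gaussDensity K hK]
  rw [h] at h1
  simp at h1

lemma Gam_eq {d : ℕ} (A K : Matrix (Fin d) (Fin d) ℝ) (s : ℝ) : Gam A K s = K + s • (A - K) := by
  unfold Gam
  rw [smul_sub, sub_smul, one_smul]
  abel

/-- Transfer of integrals over the event to the compact set. -/
lemma exists_transfer {d : ℕ} (hd : 1 ≤ d) {Ω : Type*} [MeasurableSpace Ω] (P : Measure Ω)
    [IsProbabilityMeasure P]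
    (K : Matrix (Fin d) (Fin d) ℝ) (hK : K.PosDef)
    (A : Ω → Matrix (Fin d) (Fin d) ℝ) (hA : ∀ ω, (A ω).PosSemidef)
    (hAmeas : Measurable fun ω i j => A ω i j) :
    ∃ ν : Measure (KKs K), IsFiniteMeasure ν ∧ ν Set.univ = P (EvSet A K) ∧
      ∀ H : (Fin d → Fin d → ℝ) → ℝ, Continuous (fun b : KKs K => H b) →
        ∫ ω in EvSet A K, H (fun i j => (A ω - K) i j) ∂P = ∫ b : KKs K, H b ∂ν := by
  classical
  have hKt : Kᵀ = K := by
    have := hK.1; rwa [IsHermitian, conjTranspose_eq_transpose_of_trivial] at this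
  have hAt : ∀ ω, (A ω)ᵀ = A ω := fun ω => by
    have := (hA ω).1; rwa [IsHermitian, conjTranspose_eq_transpose_of_trivial] at this
  have hBm : Measurable fun ω => (fun i j => (A ω - K) i j : Fin d → Fin d → ℝ) := by
    refine measurable_pi_lambda _ fun i => measurable_pi_lambda _ fun j => ?_
    have h1 : Measurable fun ω => A ω i j :=
      (measurable_pi_apply j).comp ((measurable_pi_apply i).comp hAmeas)
    exact h1.sub_const _
  have hmem : ∀ ω, ω ∈ EvSet A K ↔ (fun i j => (A ω - K) i j) ∈ KKs K := by
    intro ω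
    constructor
    · intro h
      refine ⟨?_, h⟩
      change (A ω - K)ᵀ = A ω - K
      rw [transpose_sub, hAt, hKt]
    · intro h
      exact h.2
  have hE : MeasurableSet (EvSet A K) := by
    have : EvSet A K = (fun ω => (fun i j => (A ω - K) i j : Fin d → Fin d → ℝ)) ⁻¹' (KKs K) := by
      ext ω; exact hmem ω
    rw [this]
    exact hBm (isCompact_KKs hd K).isClosed.measurableSet
  have h0 : (0 : Fin d → Fin d → ℝ) ∈ KKs K := by
    refine ⟨by ext; simp, ?_⟩
    rw [opNorm_le_iff hd]
    intro x _
    have : (Matrix.of (0 : Fin d → Fin d → ℝ)) *ᵥ x = 0 := by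
      have : (Matrix.of (0 : Fin d → Fin d → ℝ)) = 0 := rfl
      rw [this, zero_mulVec]
    rw [this]
    have h : euclNorm (0 : Fin d → ℝ) = 0 := by simp [euclNorm]
    rw [h]
    linarith [lambdaMin_pos hd K hK]
  set B : Ω → KKs K := fun ω => if h : ω ∈ EvSet A K then ⟨_, (hmem ω).1 h⟩ else ⟨0, h0⟩ with hB
  have hBmeas : Measurable B := by
    have hcoe : Measurable fun ω => (B ω : Fin d → Fin d → ℝ) := by
      have heq : (fun ω => (B ω : Fin d → Fin d → ℝ)) = fun ω => if ω ∈ EvSet A K then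
          (fun i j => (A ω - K) i j : Fin d → Fin d → ℝ) else 0 := by
        funext ω
        by_cases hω : ω ∈ EvSet A K
        · simp only [hB, dif_pos hω, if_pos hω]
        · simp only [hB, dif_neg hω, if_neg hω]
      rw [heq]
      exact Measurable.ite hE hBm measurable_const
    exact hcoe.subtype_mk (h := fun ω => (B ω).2)
  have hBE : ∀ ω ∈ EvSet A K, (fun i j => (A ω - K) i j) = (B ω : Fin d → Fin d → ℝ) := by
    intro ω hω
    simp only [hB, hω, dif_pos]
  refine ⟨(P.restrict (EvSet A K)).map B, inferInstance, ?_, ?_⟩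
  · rw [Measure.map_apply hBmeas MeasurableSet.univ, Set.preimage_univ, Measure.restrict_apply_univ]
  · intro H hH
    rw [integral_map hBmeas.aemeasurable hH.aestronglyMeasurable]
    refine setIntegral_congr_fun hE fun ω hω => ?_
    exact congrArg H (hBE ω hω)

/-- Lemma `term_log`: bound on the term involving `∂⁴g̃/∂t⁴ · log g̃`. -/
theorem statement_13
    {d : ℕ} (hd : 1 ≤ d)
    {Ω : Type*} [mΩ : MeasurableSpace Ω] (P : Measure Ω) [IsProbabilityMeasure P]
    (K : Matrix (Fin d) (Fin d) ℝ) (hK : K.PosDef)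
    (A : Ω → Matrix (Fin d) (Fin d) ℝ) (hA : ∀ ω, (A ω).PosSemidef)
    (hAmeas : Measurable fun ω i j => A ω i j)
    (hA8 : Integrable (fun ω => hsNorm (A ω) ^ 8) P)
    (G : Ω → Fin d → ℝ) (hG : Measure.map G P = gaussLaw K)
    (hInd : IndepFun G (fun ω i j => A ω i j) P)
    (hPE : 0 < P (EvSet A K))
    (η : ℝ) (hη : η ∈ Set.Icc (0 : ℝ) 1) :
    (P (EvSet A K)).toReal *
      ∫ ω, iteratedDeriv 4 (fun s => gtilde P A K s (G ω)) η *
        Real.log (gtilde P A K η (G ω)) ∂P ≤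
      (3 * Real.sqrt 70 / 2) *
        Real.sqrt (∫ ω in EvSet A K,
          hsNorm ((Gam (A ω) K η)⁻¹ * (A ω - K)) ^ 8 ∂P) *
        ((1 / 2) * maxLog K +
          (Real.sqrt d * (Real.sqrt 2 + 1) / 4) * hsNorm K⁻¹ * lambdaMin K) := by
  obtain ⟨ν, hνf, hνp, htr⟩ := exists_transfer hd P K hK A hA hAmeas
  have hη' : |η| ≤ 3 / 2 := abs_le.2 ⟨by linarith [hη.1], by linarith [hη.2]⟩
  have hηI : η ∈ Set.Ioo (-(1/2) : ℝ) (3/2) := ⟨by linarith [hη.1], by linarith [hη.2]⟩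
  have hp0 : 0 < (P (EvSet A K)).toReal := ENNReal.toReal_pos hPE.ne' (measure_ne_top _ _)
  have hp1 : (P (EvSet A K)).toReal ≤ 1 := by
    have := ENNReal.toReal_mono ENNReal.one_ne_top (prob_le_one (μ := P) (s := EvSet A K))
    simpa using this
  have hmain := main_X hd K hK ν (by rw [hνp]; exact hp0) (by rw [hνp]; exact hp1) η hη
  rw [hνp] at hmain
  have hgK := gaussDensity_pos K hK
  have hJ : ∫ ω in EvSet A K, hsNorm ((Gam (A ω) K η)⁻¹ * (A ω - K)) ^ 8 ∂P =
      ∫ b : KKs K, hsNorm ((K + η • Matrix.of (b : Fin d → Fin d → ℝ))⁻¹ *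
          Matrix.of (b : Fin d → Fin d → ℝ)) ^ 8 ∂ν := by
    rw [← htr (fun b => hsNorm ((K + η • Matrix.of b)⁻¹ * Matrix.of b) ^ 8)
      (continuous_hs_X hd K hK η hη')]
    refine integral_congr_ae (Filter.Eventually.of_forall fun ω => ?_)
    simp only [Gam_eq]
    rfl
  rw [hJ]
  have hu : ∀ s ∈ Set.Ioo (-(1/2) : ℝ) (3/2), ∀ x, gtilde P A K s x =
      ((P (EvSet A K)).toReal * gaussDensity K x)⁻¹ *
        ∫ b, Th K 0 (s, (b : Fin d → Fin d → ℝ), x) ∂ν := by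
    intro s hs x
    have hs' : |s| ≤ 3 / 2 := abs_le.2 ⟨by linarith [hs.1], hs.2.le⟩
    rw [gtilde, div_eq_inv_mul, ← htr (fun b => Th K 0 (s, b, x))
      ((continuous_Th_X hd K hK 0 s hs').comp
        (by fun_prop : Continuous fun b : KKs K => (b, x)))]
    congr 1
    refine integral_congr_ae (Filter.Eventually.of_forall fun ω => ?_)
    simp only [Gam_eq]
    rfl
  have hD : ∀ x, iteratedDeriv 4 (fun s => gtilde P A K s x) η =
      ((P (EvSet A K)).toReal * gaussDensity K x)⁻¹ *
        ∫ b, Th K 4 (η, (b : Fin d → Fin d → ℝ), x) ∂ν := by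
    intro x
    have hev : (fun s => gtilde P A K s x) =ᶠ[nhds η] fun s =>
        ((P (EvSet A K)).toReal * gaussDensity K x)⁻¹ *
        ∫ b, Th K 0 (s, (b : Fin d → Fin d → ℝ), x) ∂ν := by
      filter_upwards [isOpen_Ioo.mem_nhds hηI] with s hs
      exact hu s hs x
    rw [hev.iteratedDeriv_eq, iteratedDeriv_const_mul_field, iteratedDeriv_int_Th hd K hK ν x η hηI]
  have hGm : AEMeasurable G P := by
    by_contra h
    rw [Measure.map_of_not_aemeasurable h] at hG
    exact gaussLaw_ne_zero K hK hG.symm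
  set p := (P (EvSet A K)).toReal with hp
  set W : (Fin d → ℝ) → ℝ := fun x =>
    ((p * gaussDensity K x)⁻¹ * ∫ b, Th K 4 (η, (b : Fin d → Fin d → ℝ), x) ∂ν) *
      Real.log ((∫ b, Th K 0 (η, (b : Fin d → Fin d → ℝ), x) ∂ν) / (p * gaussDensity K x)) with hW
  have hgKm : Measurable (gaussDensity K) := (continuous_gaussDensity K).measurable
  have hWm : Measurable W := by
    have h0 := measurable_int_Th hd K hK ν 0 η hη'
    have h4 := measurable_int_Th hd K hK ν 4 η hη'
    exact ((measurable_const.mul hgKm).inv.mul h4).mul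
      (Real.measurable_log.comp (h0.div (measurable_const.mul hgKm)))
  have hintg : ∫ ω, iteratedDeriv 4 (fun s => gtilde P A K s (G ω)) η *
        Real.log (gtilde P A K η (G ω)) ∂P = ∫ x, W x ∂(gaussLaw K) := by
    rw [← hG, integral_map hGm hWm.aestronglyMeasurable]
    refine integral_congr_ae (Filter.Eventually.of_forall fun ω => ?_)
    simp only [hW]
    rw [hD, hu η hηI, div_eq_inv_mul]
  rw [hintg]
  set C := (3 * Real.sqrt 70 / 2) *
        Real.sqrt (∫ b : KKs K, hsNorm ((K + η • Matrix.of (b : Fin d → Fin d → ℝ))⁻¹ *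
          Matrix.of (b : Fin d → Fin d → ℝ)) ^ 8 ∂ν) *
        ((1 / 2) * maxLog K +
          (Real.sqrt d * (Real.sqrt 2 + 1) / 4) * hsNorm K⁻¹ * lambdaMin K) with hC
  have hC0 : 0 ≤ C := mul_nonneg (by positivity) (bracket_sq hd K hK).1
  have hWl : ENNReal.ofReal p * ∫⁻ x, ‖W x‖ₑ ∂(gaussLaw K) ≤ ENNReal.ofReal C := by
    refine le_trans (le_of_eq ?_) hmain
    rw [gaussLaw, lintegral_withDensity_eq_lintegral_mul _ hgKm.ennreal_ofReal hWm.enorm,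
      ← lintegral_const_mul' _ _ ENNReal.ofReal_ne_top]
    refine lintegral_congr fun x => ?_
    simp only [Pi.mul_apply]
    rw [Real.enorm_eq_ofReal_abs, ← ENNReal.ofReal_mul (hgK x).le, ← ENNReal.ofReal_mul hp0.le]
    congr 1
    simp only [hW]
    have h1 : 0 < p * gaussDensity K x := mul_pos hp0 (hgK x)
    rw [abs_mul, abs_mul, abs_of_pos (inv_pos.2 h1), ← mul_assoc, ← mul_assoc, ← mul_assoc,
      mul_inv_cancel₀ h1.ne', one_mul]
  have h2 : ENNReal.ofReal (p * |∫ x, W x ∂(gaussLaw K)|) ≤ ENNReal.ofReal C := by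
    rw [ENNReal.ofReal_mul hp0.le, ← Real.enorm_eq_ofReal_abs]
    exact (mul_le_mul_right (enorm_integral_le_lintegral_enorm _) _).trans hWl
  have h3 := (ENNReal.ofReal_le_ofReal_iff hC0).1 h2
  exact (mul_le_mul_of_nonneg_left (le_abs_self _) hp0.le).trans h3
end
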